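/- An orientation-preserving recurrent homeomorphism of the closed disc D² that restricts to the identity on the boundary circle is the identity on the whole disc. -/

import Mathlib

open Filter Topology Metric

/-- `f` is recurrent with respect to the metric `m`: some sequence of iterates
`f^[n k]` with `n k → ∞` converges uniformly to the identity. -/
def RecurrentWith {X : Type*} (m : MetricSpace X) (f : X → X) : Prop :=
  ∃ n : ℕ → ℕ, Filter.Tendsto n Filter.atTop Filter.atTop ∧
    ∀ ε > 0, ∀ᶠ k in Filter.atTop, ∀ x, @dist X m.toDist (f^[n k] x) x < ε

/-- `f` is a recurrent map of the metric space `X`. -/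
def IsRecurrent {X : Type*} [m : MetricSpace X] (f : X → X) : Prop :=
  RecurrentWith m f

/-- The closed unit disc in the plane. -/
abbrev Disc2 : Set (EuclideanSpace ℝ (Fin 2)) := Metric.closedBall 0 1

/-- The standard parametrization of the boundary circle of the disc. -/
noncomputable def circlePt (t : ℝ) : EuclideanSpace ℝ (Fin 2) :=
  (EuclideanSpace.equiv (Fin 2) ℝ).symm ![Real.cos (2 * Real.pi * t), Real.sin (2 * Real.pi * t)]

/-- A homeomorphism of the closed disc is orientation-preserving iff its
restriction to the boundary circle is an orientation-preserving circle
homeomorphism, i.e. admits a strictly increasing lift commuting with `t ↦ t+1`. -/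
def DiscOrientationPreserving (f : Disc2 ≃ₜ Disc2) : Prop :=
  ∃ F : ℝ → ℝ, StrictMono F ∧ (∀ t, F (t + 1) = F t + 1) ∧
    ∀ (t : ℝ) (h : circlePt t ∈ Disc2),
      ((f ⟨circlePt t, h⟩ : Disc2) : EuclideanSpace ℝ (Fin 2)) = circlePt (F t)

/-- A homeomorphism of the closed disc is orientation-reversing iff its
restriction to the boundary circle admits a strictly decreasing lift with
period relation `F (t+1) = F t - 1`. -/
def DiscOrientationReversing (f : Disc2 ≃ₜ Disc2) : Prop :=
  ∃ F : ℝ → ℝ, StrictAnti F ∧ (∀ t, F (t + 1) = F t - 1) ∧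
    ∀ (t : ℝ) (h : circlePt t ∈ Disc2),
      ((f ⟨circlePt t, h⟩ : Disc2) : EuclideanSpace ℝ (Fin 2)) = circlePt (F t)

namespace DR
open Set Complex

/-! ### Logarithms of continuous functions -/

theorem logLift {E : Type*} [NormedAddCommGroup E] [NormedSpace ℝ E] {S : Set E} {x0 : E}
    (hS : StarConvex ℝ x0 S) (hx : x0 ∈ S) {F : E → ℂ} (hF : ContinuousOn F S)
    (h0 : ∀ x ∈ S, F x ≠ 0) (z0 : ℂ) (hz : exp z0 = F x0) :
    ∃ l : E → ℂ, ContinuousOn l S ∧ l x0 = z0 ∧ ∀ x ∈ S, exp (l x) = F x := by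
  classical
  have hmem : ∀ (t : unitInterval) (x : S), x0 + (t : ℝ) • ((x : E) - x0) ∈ S := by
    intro t x
    have := hS x.2 (a := 1 - (t : ℝ)) (b := t) (by linarith [t.2.2]) t.2.1 (by ring)
    convert this using 1
    module
  let q : unitInterval × S → S := fun p => ⟨_, hmem p.1 p.2⟩
  have hq : Continuous q := by
    apply Continuous.subtype_mk
    fun_prop
  have hFr : Continuous (S.domRestrict F) := hF.domRestrict
  let H : C(unitInterval × S, {z : ℂ // z ≠ 0}) :=
    ⟨fun p => ⟨F (q p), h0 _ (q p).2⟩, (hFr.comp hq).subtype_mk _⟩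
  let f : C(S, ℂ) := ⟨fun _ => z0, continuous_const⟩
  have H0 : ∀ a, H (0, a) = (fun z : ℂ ↦ (⟨_, z.exp_ne_zero⟩ : {z : ℂ // z ≠ 0})) (f a) := by
    intro a
    apply Subtype.ext
    change F (x0 + ((0 : unitInterval) : ℝ) • ((a : E) - x0)) = exp z0
    simp [hz]
  let G := isCoveringMap_exp.liftHomotopy H f H0
  have hG1 : ∀ p, exp (G p) = F (q p) := by
    intro p
    have := congr_fun (isCoveringMap_exp.liftHomotopy_lifts H f H0) p
    exact congrArg Subtype.val this
  have hG2 : ∀ t : unitInterval, G (t, ⟨x0, hx⟩) = z0 := by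
    have h2 : G (0, ⟨x0, hx⟩) = z0 := isCoveringMap_exp.liftHomotopy_zero H f H0 _
    have key := isCoveringMap_exp.eq_of_comp_eq (g₁ := fun t : unitInterval => G (t, ⟨x0, hx⟩))
      (g₂ := fun _ => z0) (by fun_prop) continuous_const (by
        funext t
        apply Subtype.ext
        simp [hG1, q, hz]) 0 h2
    exact fun t => congr_fun key t
  refine ⟨fun x => if h : x ∈ S then G (1, ⟨x, h⟩) else 0, ?_, ?_, ?_⟩
  · rw [continuousOn_iff_continuous_domRestrict]
    have : S.domRestrict (fun x => if h : x ∈ S then G (1, ⟨x, h⟩) else 0) = fun x => G (1, x) := by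
      funext x; simp [Set.domRestrict]
    rw [this]; fun_prop
  · simp [hx, hG2]
  · intro x h
    simp only [h, dif_pos, hG1]
    simp [q]

theorem logUnique {X : Type*} [TopologicalSpace X] {S : Set X} (hS : IsPreconnected S)
    {l1 l2 : X → ℂ} (h1 : ContinuousOn l1 S) (h2 : ContinuousOn l2 S)
    (he : ∀ x ∈ S, exp (l1 x) = exp (l2 x)) {x0 : X} (hx : x0 ∈ S) (h0 : l1 x0 = l2 x0) :
    ∀ x ∈ S, l1 x = l2 x :=
  isCoveringMap_exp.eqOn_of_comp_eqOn hS h1 h2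
    (fun x hx => Subtype.ext (he x hx)) hx h0

theorem logConst {X : Type*} [TopologicalSpace X] {S : Set X} (hS : IsPreconnected S)
    {l1 l2 : X → ℂ} (h1 : ContinuousOn l1 S) (h2 : ContinuousOn l2 S)
    (he : ∀ x ∈ S, exp (l1 x) = exp (l2 x)) :
    ∃ m : ℤ, ∀ x ∈ S, l1 x = l2 x + m * (2 * Real.pi * I) := by
  rcases S.eq_empty_or_nonempty with rfl | ⟨x0, hx⟩
  · exact ⟨0, by simp⟩
  obtain ⟨m, hm⟩ := Complex.exp_eq_exp_iff_exists_int.1 (he x0 hx)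
  refine ⟨m, logUnique hS (l2 := fun x => l2 x + m * (2 * Real.pi * I)) h1 (by fun_prop) ?_ hx hm⟩
  intro x hx
  rw [he x hx]
  exact (Complex.exp_eq_exp_iff_exists_int.2 ⟨m, rfl⟩).symm

/-- A continuous logarithm of a holomorphic function is holomorphic. -/
theorem log_holo {U : Set ℂ} (hU : IsOpen U) {F l : ℂ → ℂ} (hF : DifferentiableOn ℂ F U)
    (hl : ContinuousOn l U) (he : ∀ x ∈ U, exp (l x) = F x) : DifferentiableOn ℂ l U := by
  intro x hx
  have hFx : DifferentiableAt ℂ F x := hF.differentiableAt (hU.mem_nhds hx)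
  have hlx : ContinuousAt l x := hl.continuousAt (hU.mem_nhds hx)
  have hne : F x ≠ 0 := by rw [← he x hx]; exact exp_ne_zero _
  have h1 : DifferentiableAt ℂ (fun y => Complex.log (F y / F x) + l x) x := by
    have : DifferentiableAt ℂ (fun y => F y / F x) x := hFx.div_const _
    refine (this.clog ?_).add_const _
    simp [hne]
  refine (h1.congr_of_eventuallyEq ?_).differentiableWithinAt
  have h2 : ∀ᶠ y in 𝓝 x, |(l y - l x).im| < Real.pi := by
    have : ContinuousAt (fun y => |(l y - l x).im|) x := by fun_prop
    have h3 := this.tendsto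
    simp only [sub_self, zero_im, abs_zero] at h3
    exact h3.eventually_lt_const Real.pi_pos
  filter_upwards [h2, hU.mem_nhds hx] with y hy hyU
  rw [← he x hx, ← he y hyU, ← exp_sub, Complex.log_exp (abs_lt.1 hy).1 (abs_lt.1 hy).2.le]
  ring

end DR

namespace DR
open Set Complex

theorem logLiftConvex {E : Type*} [NormedAddCommGroup E] [NormedSpace ℝ E] {S : Set E}
    (hS : Convex ℝ S) {F : E → ℂ} (hF : ContinuousOn F S)
    (h0 : ∀ x ∈ S, F x ≠ 0) :
    ∃ l : E → ℂ, ContinuousOn l S ∧ ∀ x ∈ S, exp (l x) = F x := by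
  rcases S.eq_empty_or_nonempty with rfl | ⟨x0, hx⟩
  · exact ⟨0, by simp⟩
  obtain ⟨l, h1, -, h2⟩ := logLift (hS.starConvex hx) hx hF h0 (log (F x0))
    (exp_log (h0 _ hx))
  exact ⟨l, h1, h2⟩

theorem lambdaLemma {g : ℂ → ℂ} (hg : Continuous g) (inj : Function.Injective g)
    (hH : ∀ w, 1 ≤ ‖w‖ → g w = w) :
    ∃ L : ℂ × ℂ → ℂ, Continuous L ∧
      (∀ p z, exp (L (p, z)) * exp z = g (p + exp z) - g p) ∧
      (∀ p z, L (p, z + 2 * Real.pi * I) = L (p, z)) ∧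
      (∀ p z, L (p + exp z, z + Real.pi * I) = L (p, z)) := by
  let F : ℂ × ℂ → ℂ := fun x => (g (x.1 + exp x.2) - g x.1) / exp x.2
  have hF : Continuous F := by
    apply Continuous.div (by fun_prop) (by fun_prop)
    intro x; exact exp_ne_zero _
  have hF0 : ∀ x, F x ≠ 0 := by
    intro x
    refine div_ne_zero (sub_ne_zero.2 fun h => ?_) (exp_ne_zero _)
    have := inj h
    simp at this
  obtain ⟨L, hL, h0, hexp⟩ := logLift (E := ℂ × ℂ) (S := univ) (x0 := (2, 0))
    (convex_univ.starConvex (mem_univ _)) (mem_univ _) (F := F) hF.continuousOn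
    (fun x _ => hF0 x) 0 (by
      simp only [F]
      rw [hH, hH] <;> norm_num)
  have hLc : Continuous L := continuousOn_univ.1 hL
  have hzero : ∀ p z : ℂ, 2 ≤ p.re → z.re ≤ 0 → L (p, z) = 0 := by
    have hconv : Convex ℝ {x : ℂ × ℂ | 2 ≤ x.1.re ∧ x.2.re ≤ 0} := by
      intro x hx y hy a b ha hb hab
      simp only [mem_ofPred_eq, Prod.fst_add, Prod.snd_add, Prod.smul_fst, Prod.smul_snd, add_re,
        real_smul, re_ofReal_mul] at *
      constructor <;> nlinarith [mul_nonneg ha (sub_nonneg.2 hx.1), mul_nonneg hb (sub_nonneg.2 hy.1), mul_nonneg ha (sub_nonneg.2 hx.2), mul_nonneg hb (sub_nonneg.2 hy.2)]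
    have := logUnique (l1 := L) (l2 := fun _ => 0) hconv.isPreconnected hLc.continuousOn
      continuousOn_const (x0 := (2, 0)) (by
        rintro ⟨p, z⟩ ⟨h1, h2⟩
        rw [hexp _ (mem_univ _)]
        simp only [F] at *
        have hz : ‖exp z‖ ≤ 1 := by rw [norm_exp]; exact Real.exp_le_one_iff.2 h2
        have hp : 2 ≤ ‖p‖ := h1.trans (re_le_norm p)
        rw [hH p (by linarith), hH]
        · simp
        · have := norm_sub_norm_le p (-exp z)
          simp only [norm_neg, sub_neg_eq_add] at this
          linarith) (by simp) h0
    intro p z h1 h2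
    exact this (p, z) ⟨h1, h2⟩
  have hexp' : ∀ p z, exp (L (p, z)) * exp z = g (p + exp z) - g p := by
    intro p z
    rw [hexp _ (mem_univ _)]
    simp [F]
  refine ⟨L, hLc, hexp', ?_, ?_⟩
  · intro p z
    refine logUnique (l1 := fun x : ℂ × ℂ => L (x.1, x.2 + 2 * Real.pi * I)) (l2 := L)
      isPreconnected_univ (by fun_prop) hL ?_ (x0 := (2, 0)) (mem_univ _) ?_ (p, z) (mem_univ _)
    · intro x _
      rw [hexp _ (mem_univ _), hexp _ (mem_univ _)]
      simp only [F]
      rw [exp_periodic]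
    · simp only
      rw [hzero, hzero] <;> simp
  · intro p z
    refine logUnique (l1 := fun x : ℂ × ℂ => L (x.1 + exp x.2, x.2 + Real.pi * I)) (l2 := L)
      isPreconnected_univ (by fun_prop) hL ?_ (x0 := (2, 0)) (mem_univ _) ?_ (p, z) (mem_univ _)
    · intro x _
      rw [hexp _ (mem_univ _), hexp _ (mem_univ _)]
      simp only [F]
      rw [exp_add, exp_pi_mul_I]
      simp only [mul_neg, mul_one, add_neg_cancel_right, div_neg]
      ring
    · simp only
      rw [hzero, hzero] <;> norm_num

theorem coreLemma {g : ℂ → ℂ} (hg : Continuous g) (inj : Function.Injective g)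
    (hH : ∀ w, 1 ≤ ‖w‖ → g w = w) (k : ℝ) (hk : 2 ≤ k) (γ : ℝ → ℂ)
    (hγ : ContinuousOn γ (Icc 0 k)) (hstep : ∀ t, 0 ≤ t → t ≤ k - 1 → γ (t + 1) = g (γ t))
    (hcl : γ k = γ 0)
    (hne : ∀ s t, 0 ≤ s → t ≤ k → 1 ≤ t - s → t - s ≤ k - 1 → γ s ≠ γ t)
    (W : Set ℂ) (hW : Convex ℝ W) (hγW : ∀ t ∈ Icc 0 k, γ t ∈ W) (hfix : ∀ p ∈ W, g p ≠ p) :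
    False := by
  obtain ⟨L, hL, hLexp, hLper, hLsym⟩ := lambdaLemma hg inj hH
  have hLper' : ∀ (n : ℕ) p z, L (p, z + n * (2 * Real.pi * I)) = L (p, z) := by
    intro n
    induction n with
    | zero => intro p z; simp
    | succ n ih => intro p z; rw [← ih p z, ← hLper p (z + n * _)]; congr 2; push_cast; ring
  have hLperZ : ∀ (n : ℤ) p z, L (p, z + n * (2 * Real.pi * I)) = L (p, z) := by
    intro n p z
    obtain ⟨m, rfl | rfl⟩ := n.eq_nat_or_neg
    · exact_mod_cast hLper' m p z
    · rw [← hLper' m p (z + _)]; congr 2; push_cast; ring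
  -- the angle function Θ
  let R : Set (ℝ × ℝ) := {x | 0 ≤ x.1 ∧ x.2 ≤ k ∧ 1 ≤ x.2 - x.1 ∧ x.2 - x.1 ≤ k - 1}
  have hR : Convex ℝ R := by
    intro x hx y hy a b ha hb hab
    simp only [R, mem_ofPred_eq, Prod.fst_add, Prod.snd_add, Prod.smul_fst, Prod.smul_snd,
      smul_eq_mul] at *
    obtain ⟨h1, h2, h3, h4⟩ := hx
    obtain ⟨h1', h2', h3', h4'⟩ := hy
    have hb' : b = 1 - a := by linarith
    subst hb'
    refine ⟨by nlinarith, by nlinarith, by nlinarith, by nlinarith⟩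
  obtain ⟨Θ, hΘ, hΘe⟩ := logLiftConvex hR (F := fun x => γ x.2 - γ x.1)
    (by
      refine ContinuousOn.sub (hγ.comp continuous_snd.continuousOn ?_)
        (hγ.comp continuous_fst.continuousOn ?_)
      · rintro x ⟨h1, h2, h3, h4⟩; exact ⟨by linarith, by linarith⟩
      · rintro x ⟨h1, h2, h3, h4⟩; exact ⟨by linarith, by linarith⟩)
    (by
      rintro x ⟨h1, h2, h3, h4⟩
      exact sub_ne_zero.2 (hne _ _ h1 h2 h3 h4).symm)
  have hΘe' : ∀ s t, 0 ≤ s → t ≤ k → 1 ≤ t - s → t - s ≤ k - 1 → exp (Θ (s, t)) = γ t - γ s :=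
    fun s t h1 h2 h3 h4 => hΘe (s, t) ⟨h1, h2, h3, h4⟩
  -- λ
  obtain ⟨l, hl, hle⟩ := logLiftConvex hW (F := fun p => g p - p)
    (by fun_prop) (fun p hp => sub_ne_zero.2 (hfix p hp))
  have hD : ContinuousOn (fun t => l (γ t)) (Icc 0 k) := hl.comp hγ hγW
  -- c
  obtain ⟨c, hc⟩ := logConst (S := Icc (1 : ℝ) (k - 1)) isPreconnected_Icc
    (l1 := fun s => Θ (s, k)) (l2 := fun s => Θ (0, s) + Real.pi * I)
    (hΘ.comp (by fun_prop) (by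
      rintro s ⟨h1, h2⟩; exact ⟨by linarith, by linarith, by linarith, by linarith⟩))
    (ContinuousOn.add (hΘ.comp (by fun_prop) (by
      rintro s ⟨h1, h2⟩; exact ⟨le_refl _, by linarith, by linarith, by linarith⟩))
      continuousOn_const)
    (by
      rintro s ⟨h1, h2⟩
      rw [hΘe' _ _ (by linarith) (by linarith) (by linarith) (by linarith), exp_add,
        hΘe' _ _ (by linarith) (by linarith) (by linarith) (by linarith), exp_pi_mul_I, hcl]
      ring)
  -- m
  obtain ⟨m, hm⟩ := logConst (S := R ∩ {x | x.2 ≤ k - 1})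
    (Convex.isPreconnected (hR.inter (by
      intro x hx y hy a b ha hb hab
      simp only [mem_ofPred_eq, Prod.snd_add, Prod.smul_snd, smul_eq_mul] at *
      have hb' : b = 1 - a := by linarith
      subst hb'
      nlinarith)))
    (l1 := fun x : ℝ × ℝ => Θ (x.1 + 1, x.2 + 1)) (l2 := fun x => Θ x + L (γ x.1, Θ x))
    (hΘ.comp (by fun_prop) (by
      rintro s ⟨⟨h1, h2, h3, h4⟩, h5⟩
      simp only [mem_ofPred_eq] at h5
      exact ⟨by linarith, by linarith, by linarith, by linarith⟩))
    (by
      have h1 : ContinuousOn Θ (R ∩ {x | x.2 ≤ k - 1}) := hΘ.mono inter_subset_left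
      refine h1.add (hL.comp_continuousOn (ContinuousOn.prodMk (hγ.comp (by fun_prop) ?_) h1))
      rintro s ⟨⟨h1, h2, h3, h4⟩, h5⟩
      exact ⟨by linarith, by linarith⟩)
    (by
      rintro ⟨s, t⟩ ⟨⟨h1, h2, h3, h4⟩, h5⟩
      simp only [mem_ofPred_eq] at h1 h2 h3 h4 h5
      simp only
      rw [hΘe' _ _ (by linarith) (by linarith) (by linarith) (by linarith), exp_add, mul_comm,
        hLexp, hΘe' _ _ (by linarith) (by linarith) (by linarith) (by linarith),
        hstep _ (by linarith) (by linarith), hstep _ (by linarith) (by linarith)]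
      congr 2
      ring)
  -- Δ on [0, k-1]
  obtain ⟨m0, hm0⟩ := logConst (S := Icc (0 : ℝ) (k - 1)) isPreconnected_Icc
    (l1 := fun t => l (γ t)) (l2 := fun t => Θ (t, t + 1))
    (hD.mono (Icc_subset_Icc_right (by linarith)))
    (hΘ.comp (by fun_prop) (by
      rintro s ⟨h1, h2⟩; exact ⟨by linarith, by linarith, by linarith, by linarith⟩))
    (by
      rintro t ⟨h1, h2⟩
      rw [hle _ (hγW _ ⟨h1, by linarith⟩), hΘe' _ _ (by linarith) (by linarith) (by linarith)
        (by linarith), hstep _ h1 h2])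
  -- Δ on [1, k]
  obtain ⟨m1, hm1⟩ := logConst (S := Icc (1 : ℝ) k) isPreconnected_Icc
    (l1 := fun t => l (γ t)) (l2 := fun t => Θ (t - 1, t) + L (γ (t - 1), Θ (t - 1, t)))
    (hD.mono (Icc_subset_Icc_left (by linarith)))
    (by
      have h1 : ContinuousOn (fun t => Θ (t - 1, t)) (Icc (1 : ℝ) k) :=
        hΘ.comp (by fun_prop) (by
          rintro s ⟨h1, h2⟩; exact ⟨by linarith, by linarith, by linarith, by linarith⟩)
      refine h1.add (hL.comp_continuousOn (ContinuousOn.prodMk (hγ.comp (by fun_prop) ?_) h1))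
      rintro s ⟨h1, h2⟩
      exact ⟨by linarith, by linarith⟩)
    (by
      rintro t ⟨h1, h2⟩
      rw [hle _ (hγW _ ⟨by linarith, by linarith⟩), exp_add, mul_comm, hLexp,
        hΘe' _ _ (by linarith) (by linarith) (by linarith) (by linarith),
        ← hstep (t - 1) (by linarith) (by linarith)]
      simp)
  -- combine
  have e1 := hm0 (k - 1) ⟨by linarith, le_refl _⟩
  have e2 := hm0 0 ⟨le_refl _, by linarith⟩
  have e3 := hm1 (k - 1) ⟨by linarith, by linarith⟩
  have e4 := hm1 k ⟨by linarith, by linarith⟩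
  have e5 := hm (0, k - 1) ⟨⟨le_refl _, by linarith, by simp only; linarith, by simp⟩, by simp⟩
  have e6 := hm (k - 1 - 1, k - 1)
    ⟨⟨by simp only; linarith, by simp, by simp, by simp only; linarith⟩, by simp⟩
  have e7 := hc 1 ⟨le_refl _, by linarith⟩
  have e8 := hc (k - 1) ⟨by linarith, le_refl _⟩
  simp only [sub_add_cancel, zero_add] at e1 e2 e3 e4 e5 e6 e7 e8
  have e9 : L (γ (k - 1), Θ (k - 1, k)) = L (γ 0, Θ (0, k - 1)) := by
    rw [← hLsym, hΘe' _ _ (by linarith) (by linarith) (by linarith) (by linarith)]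
    have h1 : γ (k - 1) + (γ k - γ (k - 1)) = γ 0 := by rw [hcl]; ring
    rw [h1, e8, ← hLperZ (c + 1) (γ 0) (Θ (0, k - 1))]
    congr 2; push_cast; ring
  rw [hcl] at e4
  have hfin : (2 * c + 1 : ℂ) * (2 * Real.pi * I) = 0 := by
    linear_combination -(e1 - e3 + e4 - e2 + e6 - e5) - e7 - e8 - e9
  have h2pi : (2 * Real.pi * I : ℂ) ≠ 0 := by simp [Real.pi_ne_zero]
  have := (mul_eq_zero.1 hfin).resolve_right h2pi
  have h3 : (2 * c + 1 : ℤ) = 0 := by exact_mod_cast this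
  omega

end DR

namespace DR
open Set Complex

/-! ### Tool B -/

theorem exists_push_aux {ρ : ℝ} (hρ : 0 < ρ) {a : ℂ} (ha : ‖a‖ < ρ) :
    ∃ φ : ℂ ≃ₜ ℂ, (∀ p, ρ ≤ ‖p‖ → φ p = p) ∧ (∀ p, ‖p‖ < ρ → ‖φ p‖ < ρ) ∧ φ 0 = a := by
  let f : ℂ → ℂ := fun p => p + (max 0 (ρ - ‖p‖) / ρ : ℝ) • a
  have hlip : ∀ p q : ℂ, |max 0 (ρ - ‖p‖) - max 0 (ρ - ‖q‖)| ≤ ‖p - q‖ := by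
    intro p q
    have h0 : |max 0 (ρ - ‖p‖) - max 0 (ρ - ‖q‖)| ≤ |(ρ - ‖p‖) - (ρ - ‖q‖)| := by
      rw [max_comm 0, max_comm 0]; exact abs_max_sub_max_le_abs _ _ _
    refine h0.trans ?_
    rw [abs_le]
    have h1 := norm_sub_norm_le p q
    have h2 := norm_sub_norm_le q p
    rw [norm_sub_rev] at h2
    constructor <;> linarith
  have hc : ‖a‖ / ρ < 1 := by rwa [div_lt_one hρ]
  have happ : ApproximatesLinearOn f ((ContinuousLinearEquiv.refl ℝ ℂ : ℂ ≃L[ℝ] ℂ) : ℂ →L[ℝ] ℂ)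
      univ ⟨‖a‖ / ρ, by positivity⟩ := by
    intro p _ q _
    have : f p - f q - (((ContinuousLinearEquiv.refl ℝ ℂ : ℂ ≃L[ℝ] ℂ) : ℂ →L[ℝ] ℂ)) (p - q)
        = ((max 0 (ρ - ‖p‖) - max 0 (ρ - ‖q‖)) / ρ : ℝ) • a := by
      simp only [f, ContinuousLinearEquiv.coe_refl, ContinuousLinearMap.id_apply]
      module
    rw [this, norm_smul, Real.norm_eq_abs, abs_div, abs_of_pos hρ]
    change _ ≤ ‖a‖ / ρ * ‖p - q‖
    have := hlip p q
    calc _ = ‖a‖ / ρ * |max 0 (ρ - ‖p‖) - max 0 (ρ - ‖q‖)| := by ring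
      _ ≤ _ := by gcongr
  have hN : (⟨‖a‖ / ρ, by positivity⟩ : NNReal) <
      ‖(((ContinuousLinearEquiv.refl ℝ ℂ).symm : ℂ ≃L[ℝ] ℂ) : ℂ →L[ℝ] ℂ)‖₊⁻¹ := by
    have : ‖(((ContinuousLinearEquiv.refl ℝ ℂ).symm : ℂ ≃L[ℝ] ℂ) : ℂ →L[ℝ] ℂ)‖₊ = 1 := by
      simp
    rw [this, inv_one]
    exact_mod_cast hc
  let φ := happ.toHomeomorph f (Or.inr hN)
  have hφ : ∀ p, φ p = f p := fun p => rfl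
  refine ⟨φ, ?_, ?_, ?_⟩
  · intro p hp
    rw [hφ]; simp [f, hp]
  · intro p hp
    rw [hφ]
    simp only [f]
    rw [max_eq_right (by linarith)]
    refine (norm_add_le _ _).trans_lt ?_
    rw [norm_smul, Real.norm_eq_abs, abs_of_pos (div_pos (by linarith) hρ)]
    have : (ρ - ‖p‖) / ρ * ‖a‖ < ρ - ‖p‖ := by
      rw [div_mul_eq_mul_div, div_lt_iff₀ hρ]
      have : 0 < ρ - ‖p‖ := by linarith
      nlinarith
    linarith
  · rw [hφ]; simp [f, hρ.le, hρ.ne']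

theorem exists_push {ρ : ℝ} {x y : ℂ} (hx : ‖x‖ < ρ) (hy : ‖y‖ < ρ) :
    ∃ φ : ℂ ≃ₜ ℂ, (∀ p, ρ ≤ ‖p‖ → φ p = p) ∧ (∀ p, ‖p‖ < ρ → ‖φ p‖ < ρ) ∧ φ y = x := by
  have hρ : 0 < ρ := (norm_nonneg x).trans_lt hx
  obtain ⟨φ, h1, h2, h3⟩ := exists_push_aux hρ hx
  obtain ⟨ψ, k1, k2, k3⟩ := exists_push_aux hρ hy
  refine ⟨ψ.symm.trans φ, ?_, ?_, ?_⟩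
  · intro p hp
    have : ψ.symm p = p := by rw [Homeomorph.symm_apply_eq, k1 p hp]
    simp [this, h1 p hp]
  · intro p hp
    have : ‖ψ.symm p‖ < ρ := by
      by_contra h
      have := k1 _ (not_lt.1 h)
      rw [Homeomorph.apply_symm_apply] at this
      rw [← this] at h
      exact h hp
    simpa using h2 _ this
  · have : ψ.symm y = 0 := by rw [Homeomorph.symm_apply_eq, k3]
    simp [this, h3]

/-- the orbit path of a fundamental arc -/
noncomputable def orbitPath (G : ℂ → ℂ) (α : ℝ → ℂ) (t : ℝ) : ℂ := G^[⌊t⌋₊] (α (t - ⌊t⌋₊))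

theorem orbitPath_cont {G : ℂ → ℂ} (hG : Continuous G) {α : ℝ → ℂ} (hα : ContinuousOn α (Icc 0 1))
    (h : α 1 = G (α 0)) (N : ℕ) : ContinuousOn (orbitPath G α) (Icc 0 (N : ℝ)) := by
  induction N with
  | zero => simp
  | succ N ih =>
    have hun : Icc (0 : ℝ) ((N + 1 : ℕ) : ℝ) = Icc (0 : ℝ) N ∪ Icc (N : ℝ) (N + 1) := by
      rw [Icc_union_Icc_eq_Icc (by positivity) (by linarith)]; push_cast; rfl
    rw [hun]
    refine ih.union_of_isClosed ?_ isClosed_Icc isClosed_Icc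
    have h1 : ContinuousOn (fun t : ℝ => G^[N] (α (t - N))) (Icc (N : ℝ) (N + 1)) := by
      refine (hG.iterate N).comp_continuousOn (hα.comp (by fun_prop) ?_)
      rintro t ⟨a, b⟩
      exact ⟨by linarith, by linarith⟩
    refine h1.congr ?_
    rintro t ⟨a, b⟩
    rcases eq_or_lt_of_le b with rfl | b
    · unfold orbitPath
      have : ⌊(N : ℝ) + 1⌋₊ = N + 1 := by
        rw [Nat.floor_add_one (by positivity), Nat.floor_natCast]
      rw [this, Function.iterate_succ_apply]
      simp [h]
    · have : ⌊t⌋₊ = N := (Nat.floor_eq_iff (by linarith [N.cast_nonneg (α := ℝ)])).2 ⟨a, b⟩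
      simp [orbitPath, this]

theorem orbitPath_succ {G : ℂ → ℂ} {α : ℝ → ℂ} {t : ℝ} (ht : 0 ≤ t) :
    orbitPath G α (t + 1) = G (orbitPath G α t) := by
  unfold orbitPath
  rw [Nat.floor_add_one ht, Function.iterate_succ_apply']
  push_cast
  congr 3
  ring

theorem toolB (g : ℂ ≃ₜ ℂ) (hH : ∀ w, 1 ≤ ‖w‖ → g w = w) {ε ρ0 R : ℝ} (hε : 0 < ε)
    (h0R : ρ0 < R) (hR1 : R ≤ 1) (hfix : ∀ p, ‖p‖ < R → g p ≠ p)
    (hfree : ∀ p, ‖p‖ < ε → ε ≤ ‖g p‖) (q : ℂ) (hq : ‖q‖ ≤ ρ0) (hgq : ‖g q‖ ≤ ρ0)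
    (n : ℕ) (hn : 2 ≤ n) (hret : ‖g^[n] 0‖ < ε)
    (hstay : ∀ i ≤ n, ∀ p, ‖p‖ ≤ ρ0 → ‖g^[i] p‖ < R) : False := by
  -- the minimal non-free closed ball
  obtain ⟨w, hw0, hwmin⟩ := (isCompact_closedBall (0 : ℂ) ρ0).exists_isMinOn
    (f := fun p => max ‖p‖ ‖g p‖) ⟨q, by simpa using hq⟩ (by fun_prop)
  simp only [mem_closedBall, dist_zero_right] at hw0
  set ρ := max ‖w‖ ‖g w‖ with hρdef
  have hmin : ∀ p, ‖p‖ ≤ ρ0 → ρ ≤ max ‖p‖ ‖g p‖ := fun p hp => hwmin (by simpa using hp)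
  have hρ0 : ρ ≤ ρ0 := (hmin q hq).trans (max_le hq hgq)
  have hρε : ε ≤ ρ := by
    by_contra h
    push Not at h
    exact absurd ((le_max_right ‖w‖ _).trans_lt h)
      (not_lt.2 (hfree w ((le_max_left _ _).trans_lt h)))
  have hρpos : 0 < ρ := hε.trans_le hρε
  have hBfree : ∀ p, ‖p‖ < ρ → ρ ≤ ‖g p‖ := by
    intro p hp
    by_contra h
    exact absurd (hmin p (hp.le.trans hρ0)) (not_le.2 (max_lt hp (not_le.1 h)))
  have hcl : closure (ball (0 : ℂ) ρ) = closedBall 0 ρ := closure_ball _ hρpos.ne'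
  have hwle : ‖w‖ ≤ ρ := le_max_left _ _
  have hgwle : ‖g w‖ ≤ ρ := le_max_right _ _
  -- general closure principle
  have hclos : ∀ F : ℂ ≃ₜ ℂ, (∀ p, ‖p‖ < ρ → ρ ≤ ‖F p‖) → ∀ p, ‖p‖ ≤ ρ → ρ ≤ ‖F p‖ := by
    intro F hF p hp
    have hp' : p ∈ closure (ball (0 : ℂ) ρ) := by rw [hcl]; simpa using hp
    have hcs : IsClosed {p | ρ ≤ ‖F p‖} := isClosed_le continuous_const (by fun_prop)
    exact closure_minimal (fun p hp => hF p (by simpa using hp)) hcs hp'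
  have hpow : ∀ i : ℕ, ∃ F : ℂ ≃ₜ ℂ, (∀ p, F p = g^[i] p) := by
    intro i
    induction i with
    | zero => exact ⟨Homeomorph.refl _, fun p => rfl⟩
    | succ i ih =>
      obtain ⟨F, hF⟩ := ih
      exact ⟨g.trans F, fun p => by simp [hF]⟩
  have hgw : ‖g w‖ = ρ := le_antisymm hgwle (hclos g hBfree w hwle)
  have hw : ‖w‖ = ρ := by
    refine le_antisymm hwle ?_
    have := hclos g.symm (fun p hp => by
      by_contra h
      have := hBfree (g.symm p) (not_le.1 h)
      rw [Homeomorph.apply_symm_apply] at this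
      linarith) (g w) hgwle
    simpa using this
  -- the first return
  have hex : ∃ k, 2 ≤ k ∧ ∃ x, ‖x‖ < ρ ∧ ‖g^[k] x‖ < ρ :=
    ⟨n, hn, 0, by simpa using hρpos, hret.trans_le hρε⟩
  classical
  let k := Nat.find hex
  obtain ⟨hk2, x, hx, hy⟩ : 2 ≤ k ∧ ∃ x, ‖x‖ < ρ ∧ ‖g^[k] x‖ < ρ := Nat.find_spec hex
  have hkn : k ≤ n := Nat.find_min' hex ⟨hn, 0, by simpa using hρpos, hret.trans_le hρε⟩
  have hBd : ∀ d, 1 ≤ d → d < k → ∀ p, ‖p‖ < ρ → ρ ≤ ‖g^[d] p‖ := by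
    intro d hd1 hdk p hp
    rcases eq_or_lt_of_le hd1 with rfl | hd
    · simpa using hBfree p hp
    · by_contra h
      exact Nat.find_min hex hdk ⟨hd, p, hp, not_le.1 h⟩
  have hBd1 : ∀ d, 1 ≤ d → d < k → ∀ p, ‖p‖ ≤ ρ → ρ ≤ ‖g^[d] p‖ := by
    intro d hd1 hdk p hp
    obtain ⟨F, hF⟩ := hpow d
    rw [← hF]
    exact hclos F (fun p hp => by rw [hF]; exact hBd d hd1 hdk p hp) p hp
  have hBd2 : ∀ d, 1 ≤ d → d < k → ∀ p, ‖p‖ < ρ → ρ < ‖g^[d] p‖ := by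
    intro d hd1 hdk p hp
    obtain ⟨F, hF⟩ := hpow d
    by_contra h
    have := hclos F.symm (fun p hp => by
      by_contra h
      have := hBd d hd1 hdk (F.symm p) (not_le.1 h)
      rw [← hF, Homeomorph.apply_symm_apply] at this
      linarith) (g^[d] p) (not_lt.1 h)
    rw [← hF] at this
    simp at this
    linarith
  have hNC : ∀ m ≤ k, (∀ d, 1 ≤ d → d < m → g^[d] w ≠ w) → ∀ d, 1 ≤ d → d < m →
      ∀ p p', (‖p‖ < ρ ∨ p = w) → (‖p'‖ < ρ ∨ p' = w) → g^[d] p ≠ p' := by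
    intro m hm hper d hd1 hdm p p' hp hp' he
    rcases hp with hp | rfl
    · have := hBd2 d hd1 (by omega) p hp
      rw [he] at this
      rcases hp' with hp' | rfl <;> linarith
    · rcases hp' with hp' | rfl
      · have := hBd1 d hd1 (by omega) p hwle
        rw [he] at this
        linarith
      · exact hper d hd1 hdm he
  have hginj : Function.Injective g := g.injective
  by_cases hper : ∃ m, 1 ≤ m ∧ m < k ∧ g^[m] w = w
  · -- Case (i)
    let m := Nat.find hper
    obtain ⟨hm1, hmk, hmw⟩ : 1 ≤ m ∧ m < k ∧ g^[m] w = w := Nat.find_spec hper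
    have hm2 : 2 ≤ m := by
      rcases eq_or_lt_of_le hm1 with h | h
      · rw [← h] at hmw
        exact absurd hmw (hfix w (by linarith))
      · exact h
    have hmm : ∀ d, 1 ≤ d → d < m → g^[d] w ≠ w := fun d h1 h2 h3 =>
      Nat.find_min hper h2 ⟨h1, h2.trans hmk, h3⟩
    let α : ℝ → ℂ := fun u => (max (1 - 2 * u) 0 : ℝ) • w + (max (2 * u - 1) 0 : ℝ) • g w
    have hα : Continuous α := by fun_prop
    have hα0 : α 0 = w := by simp [α]
    have hα1 : α 1 = g w := by norm_num [α]
    have hαB : ∀ u, 0 ≤ u → u < 1 → ‖α u‖ < ρ ∨ α u = w := by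
      intro u h0 h1
      rcases eq_or_lt_of_le h0 with rfl | h0
      · exact Or.inr hα0
      left
      refine (norm_add_le _ _).trans_lt ?_
      rw [norm_smul, norm_smul, hw, hgw, ← add_mul]
      simp only [Real.norm_eq_abs]
      rw [abs_of_nonneg (le_max_right _ _), abs_of_nonneg (le_max_right _ _)]
      have : max (1 - 2 * u) 0 + max (2 * u - 1) 0 < 1 := by
        rcases le_total (1 - 2 * u) 0 with h | h
        · rw [max_eq_right h, max_eq_left (by linarith)]; linarith
        · rw [max_eq_left h, max_eq_right (by linarith)]; linarith
      nlinarith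
    have hmem : ∀ t : ℝ, 0 ≤ t → ∃ p, (‖p‖ < ρ ∨ p = w) ∧ orbitPath g α t = g^[⌊t⌋₊] p := by
      intro t ht
      refine ⟨_, hαB (t - ⌊t⌋₊) ?_ ?_, rfl⟩
      · linarith [Nat.floor_le ht]
      · linarith [Nat.lt_floor_add_one t]
    refine coreLemma g.continuous g.injective hH m (by exact_mod_cast hm2) (orbitPath g α)
      (orbitPath_cont g.continuous hα.continuousOn (by rw [hα1, hα0]) m)
      (fun t ht _ => orbitPath_succ ht) ?_ ?_ (ball 0 R) (convex_ball _ _) ?_ ?_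
    · simp [orbitPath, hα0, hmw]
    · intro s t hs ht h1 h2 he
      obtain ⟨p', hp', hs'⟩ := hmem s hs
      obtain ⟨p, hp, ht'⟩ := hmem t (by linarith)
      rw [hs', ht'] at he
      have a1 := Nat.floor_le hs
      have a2 := Nat.lt_floor_add_one s
      have a3 := Nat.floor_le (show 0 ≤ t by linarith)
      have a4 := Nat.lt_floor_add_one t
      have b1 : ⌊s⌋₊ < ⌊t⌋₊ := by
        have : (⌊s⌋₊ : ℝ) < (⌊t⌋₊ : ℝ) := by linarith
        exact_mod_cast this
      have b2 : ⌊t⌋₊ < ⌊s⌋₊ + m := by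
        have : (⌊t⌋₊ : ℝ) < (⌊s⌋₊ : ℝ) + m := by linarith
        exact_mod_cast this
      obtain ⟨d, hd⟩ := Nat.exists_eq_add_of_lt b1
      rw [hd, add_assoc, Function.iterate_add_apply] at he
      exact hNC m hmk.le hmm (d + 1) (by omega) (by omega) p p' hp hp'
        ((hginj.iterate _) he).symm
    · rintro t ⟨h1, h2⟩
      obtain ⟨p, hp, ht'⟩ := hmem t h1
      rw [ht', mem_ball_zero_iff]
      have : ⌊t⌋₊ ≤ m := Nat.floor_le_of_le h2
      refine hstay _ (by omega) p ?_
      rcases hp with hp | rfl <;> linarith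
    · intro p hp
      exact hfix p (by simpa using hp)
  · -- Case (ii)
    push Not at hper
    obtain ⟨φ, hφ1, hφ2, hφy⟩ := exists_push hx hy
    let G : ℂ → ℂ := fun p => φ (g p)
    have hGc : Continuous G := φ.continuous.comp g.continuous
    have hGi : Function.Injective G := φ.injective.comp g.injective
    have hGit : ∀ j p, (∀ l, 1 ≤ l → l ≤ j → ρ ≤ ‖g^[l] p‖) → G^[j] p = g^[j] p := by
      intro j p
      induction j with
      | zero => intro _; rfl
      | succ j ih =>
        intro h
        rw [Function.iterate_succ_apply', ih (fun l h1 h2 => h l h1 (by omega))]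
        have := h (j + 1) (by omega) le_rfl
        rw [Function.iterate_succ_apply'] at this ⊢
        exact hφ1 _ this
    have hgx : G x = g x := hφ1 _ (hBfree x hx)
    let α : ℝ → ℂ := fun u => if u ≤ 1 / 2 then x + (2 * u : ℝ) • (g w - x)
      else g (w + (2 * u - 1 : ℝ) • (x - w))
    have hα : Continuous α := by
      refine Continuous.if_le (by fun_prop) ?_ continuous_id continuous_const ?_
      · exact g.continuous.comp (by fun_prop)
      · rintro u rfl
        norm_num
    have hα0 : α 0 = x := by simp [α]
    have hα1 : α 1 = g x := by norm_num [α]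
    have hαk : G^[k] x = x := by
      obtain ⟨k', hk'⟩ : ∃ k', k = k' + 1 := ⟨k - 1, by omega⟩
      have : G^[k'] x = g^[k'] x := hGit k' x (fun l h1 h2 => hBd l h1 (by omega) x hx)
      rw [hk', Function.iterate_succ_apply', this]
      simp only [G]
      rw [← Function.iterate_succ_apply' (⇑g)]
      rw [hk'] at hφy
      exact hφy
    have hmem : ∀ t : ℝ, 0 ≤ t → t ≤ k → ∃ i : ℕ, i ≤ k ∧ (i : ℝ) - 1 / 2 ≤ t ∧ t < i + 1 / 2 ∧
        ((∃ p, (‖p‖ < ρ ∨ p = w) ∧ orbitPath G α t = g^[i] p) ∨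
          (i = k ∧ ‖orbitPath G α t‖ < ρ)) := by
      intro t ht htk
      have a1 := Nat.floor_le ht
      have a2 := Nat.lt_floor_add_one t
      rcases eq_or_lt_of_le htk with rfl | htk
      · refine ⟨k, le_rfl, by linarith, by linarith, Or.inr ⟨rfl, ?_⟩⟩
        simp [orbitPath, hα0, hαk, hx]
      have hfl : ⌊t⌋₊ < k := (Nat.floor_lt ht).2 htk
      by_cases hfr : t - ⌊t⌋₊ < 1 / 2
      · refine ⟨⌊t⌋₊, hfl.le, by linarith, by linarith, Or.inl ⟨α (t - ⌊t⌋₊), ?_, ?_⟩⟩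
        · left
          simp only [α]
          rw [if_pos hfr.le]
          set u := t - (⌊t⌋₊ : ℝ)
          have : x + (2 * u : ℝ) • (g w - x) = (1 - 2 * u : ℝ) • x + (2 * u : ℝ) • g w := by
            module
          rw [this]
          refine (norm_add_le _ _).trans_lt ?_
          rw [norm_smul, norm_smul, Real.norm_eq_abs, Real.norm_eq_abs, hgw,
            abs_of_nonneg (by linarith : 0 ≤ 1 - 2 * u), abs_of_nonneg (by linarith)]
          nlinarith
        · refine hGit _ _ ?_
          intro l h1 h2
          refine hBd l h1 (by omega) _ ?_
          simp only [α]
          rw [if_pos hfr.le]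
          set u := t - (⌊t⌋₊ : ℝ)
          have : x + (2 * u : ℝ) • (g w - x) = (1 - 2 * u : ℝ) • x + (2 * u : ℝ) • g w := by
            module
          rw [this]
          refine (norm_add_le _ _).trans_lt ?_
          rw [norm_smul, norm_smul, Real.norm_eq_abs, Real.norm_eq_abs, hgw,
            abs_of_nonneg (by linarith : 0 ≤ 1 - 2 * u), abs_of_nonneg (by linarith)]
          nlinarith
      · push Not at hfr
        refine ⟨⌊t⌋₊ + 1, hfl, by push_cast; linarith, by push_cast; linarith, ?_⟩
        obtain ⟨p, hp, hαp⟩ : ∃ p, (‖p‖ < ρ ∨ p = w) ∧ α (t - ⌊t⌋₊) = g p := by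
          set u := t - (⌊t⌋₊ : ℝ)
          refine ⟨w + (2 * u - 1 : ℝ) • (x - w), ?_, ?_⟩
          · rcases eq_or_lt_of_le hfr with h | h
            · right; rw [← h]; norm_num
            left
            have : w + (2 * u - 1 : ℝ) • (x - w) = (2 - 2 * u : ℝ) • w + (2 * u - 1 : ℝ) • x := by
              module
            rw [this]
            refine (norm_add_le _ _).trans_lt ?_
            rw [norm_smul, norm_smul, Real.norm_eq_abs, Real.norm_eq_abs, hw,
              abs_of_nonneg (by linarith : 0 ≤ 2 - 2 * u), abs_of_nonneg (by linarith)]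
            nlinarith
          · rcases eq_or_lt_of_le hfr with h | h
            · simp only [α]; rw [← h]; norm_num
            · simp only [α]; rw [if_neg (by linarith)]
        have hple : ‖p‖ ≤ ρ := by rcases hp with hp | rfl <;> linarith
        unfold orbitPath
        rw [hαp]
        by_cases hlast : ⌊t⌋₊ + 1 < k
        · refine Or.inl ⟨p, hp, ?_⟩
          rw [hGit _ _ (fun l h1 h2 => ?_), ← Function.iterate_succ_apply]
          rw [← Function.iterate_succ_apply]
          exact hBd1 _ (by omega) (by omega) p hple
        · have hkt : ⌊t⌋₊ + 1 = k := by omega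
          obtain ⟨j, hj⟩ : ∃ j, ⌊t⌋₊ = j + 1 := ⟨⌊t⌋₊ - 1, by omega⟩
          have e1 : G^[⌊t⌋₊] (g p) = φ (g^[⌊t⌋₊ + 1] p) := by
            rw [hj, Function.iterate_succ_apply', hGit j _ (fun l h1 h2 => ?_),
              Function.iterate_succ_apply' (⇑g), Function.iterate_succ_apply (⇑g)]
            rw [← Function.iterate_succ_apply]
            exact hBd1 _ (by omega) (by omega) p hple
          rw [e1]
          by_cases hin : ‖g^[⌊t⌋₊ + 1] p‖ < ρ
          · exact Or.inr ⟨hkt, hφ2 _ hin⟩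
          · exact Or.inl ⟨p, hp, hφ1 _ (not_lt.1 hin)⟩
    have hNCk := hNC k le_rfl hper
    refine coreLemma hGc hGi ?_ k (by exact_mod_cast hk2) (orbitPath G α)
      (orbitPath_cont hGc hα.continuousOn (by rw [hα1, hα0, hgx]) k)
      (fun t ht _ => orbitPath_succ ht) ?_ ?_ (ball 0 R) (convex_ball _ _) ?_ ?_
    · intro v hv
      simp only [G]
      rw [hH v hv, hφ1 v (by linarith)]
    · simp [orbitPath, hα0, hαk]
    · intro s t hs ht h1 h2 he
      obtain ⟨j, hjk, j1, j2, hs'⟩ := hmem s hs (by linarith)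
      obtain ⟨i, hik, i1, i2, ht'⟩ := hmem t (by linarith) ht
      have b1 : j < i := by
        have : (j : ℝ) < (i : ℝ) := by linarith
        exact_mod_cast this
      have b2 : i < j + k := by
        have : (i : ℝ) < (j : ℝ) + k := by linarith
        exact_mod_cast this
      obtain ⟨p', hp', hs'⟩ := hs'.resolve_right (fun h => by omega)
      rcases ht' with ⟨p, hp, ht'⟩ | ⟨rfl, ht'⟩
      · rw [hs', ht'] at he
        obtain ⟨d, hd⟩ := Nat.exists_eq_add_of_lt b1
        rw [hd, add_assoc, Function.iterate_add_apply] at he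
        exact hNCk (d + 1) (by omega) (by omega) p p' hp hp'
          ((hginj.iterate _) he).symm
      · rw [← he, hs'] at ht'
        exact hNCk j (by omega) (by omega) p' _ hp' (Or.inl ht') rfl
    · rintro t ⟨h1, h2⟩
      rw [mem_ball_zero_iff]
      obtain ⟨i, hik, i1, i2, ht'⟩ := hmem t h1 h2
      rcases ht' with ⟨p, hp, ht'⟩ | ⟨rfl, ht'⟩
      · rw [ht']
        refine hstay _ (by omega) p ?_
        rcases hp with hp | rfl <;> linarith
      · linarith
    · intro p hp he
      rw [mem_ball_zero_iff] at hp
      simp only [G] at he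
      by_cases hpB : ‖p‖ < ρ
      · rw [hφ1 _ (hBfree p hpB)] at he
        exact hfix p hp he
      · have : ρ ≤ ‖g p‖ := by
          by_contra h
          have := hφ2 _ (not_le.1 h)
          rw [he] at this
          exact hpB this
        rw [hφ1 _ this] at he
        exact hfix p hp he

end DR

namespace DR
open Set Complex ComplexConjugate

/-! ### The triod lemma -/

theorem one_sub_re_pos {w ξ : ℂ} (hw : ‖w‖ ≤ 1) (hξ : ‖ξ‖ = 1) (hne : w ≠ ξ) :
    0 < (1 - w * conj ξ).re := by
  have h1 : w.re ^ 2 + w.im ^ 2 ≤ 1 := by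
    have := normSq_eq_norm_sq w
    rw [normSq_apply] at this
    nlinarith [norm_nonneg w]
  have h2 : ξ.re ^ 2 + ξ.im ^ 2 = 1 := by
    have := normSq_eq_norm_sq ξ
    rw [normSq_apply, hξ] at this
    linarith
  have h3 : 0 < (w.re - ξ.re) ^ 2 + (w.im - ξ.im) ^ 2 := by
    by_contra h
    have h4 : (w.re - ξ.re) ^ 2 = 0 := by nlinarith [sq_nonneg (w.re - ξ.re), sq_nonneg (w.im - ξ.im)]
    have h5 : (w.im - ξ.im) ^ 2 = 0 := by nlinarith [sq_nonneg (w.re - ξ.re), sq_nonneg (w.im - ξ.im)]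
    apply hne
    apply Complex.ext
    · exact sub_eq_zero.1 (pow_eq_zero_iff two_ne_zero |>.1 h4)
    · exact sub_eq_zero.1 (pow_eq_zero_iff two_ne_zero |>.1 h5)
  simp only [sub_re, one_re, mul_re, conj_re, conj_im]
  nlinarith

theorem mul_one_sub_conj {w ξ : ℂ} (hξ : ‖ξ‖ = 1) : ξ * (1 - w * conj ξ) = ξ - w := by
  have : ξ * conj ξ = 1 := by rw [mul_conj, normSq_eq_norm_sq, hξ]; simp
  linear_combination (-w) * this

theorem triod {g : ℂ → ℂ} (hg : Continuous g) (hH : ∀ w, 1 ≤ ‖w‖ → g w = w)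
    (hle : ∀ w, ‖w‖ ≤ 1 → ‖g w‖ ≤ 1) (β : Fin 3 → ℝ → ℂ) (o : ℂ)
    (hβ : ∀ m, ContinuousOn (β m) (Icc 0 1)) (hβ1 : ∀ m, ∀ t ∈ Icc (0 : ℝ) 1, ‖β m t‖ ≤ 1)
    (ho : ∀ m, β m 0 = o) (hend : ∀ m, ‖β m 1‖ = 1) :
    ∃ l m, l ≠ m ∧ ∃ t ∈ Icc (0 : ℝ) 1, ∃ s ∈ Icc (0 : ℝ) 1, g (β l t) = β m s := by
  by_contra hcon
  push Not at hcon
  have I0 : (0 : ℝ) ∈ Icc (0 : ℝ) 1 := by simp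
  have I1 : (1 : ℝ) ∈ Icc (0 : ℝ) 1 := by simp
  have hex : ∀ l : Fin 3, ∃ m, l ≠ m := by decide
  have hgo : g o - o ≠ 0 := by
    have := hcon 0 1 (by decide) 0 I0 0 I0
    rw [ho, ho] at this
    exact sub_ne_zero.2 this
  obtain ⟨z0, hz0⟩ : ∃ z0, exp z0 = g o - o := ⟨log (g o - o), exp_log hgo⟩
  have hco : Convex ℝ (Icc (0 : ℝ) 1) := convex_Icc 0 1
  have hpre : IsPreconnected (Icc (0 : ℝ) 1) := isPreconnected_Icc
  have hAex : ∀ l, ∃ A : ℝ → ℂ, ContinuousOn A (Icc 0 1) ∧ A 0 = z0 ∧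
      ∀ t ∈ Icc (0 : ℝ) 1, exp (A t) = g (β l t) - o := by
    intro l
    refine logLift (hco.starConvex I0) I0 (F := fun t => g (β l t) - o)
      ((hg.comp_continuousOn (hβ l)).sub continuousOn_const) ?_ z0 (by rw [ho, hz0])
    intro t ht
    obtain ⟨m, hm⟩ := hex l
    have := hcon l m hm t ht 0 I0
    rw [ho] at this
    exact sub_ne_zero.2 this
  have hBex : ∀ m, ∃ B : ℝ → ℂ, ContinuousOn B (Icc 0 1) ∧ B 0 = z0 ∧
      ∀ s ∈ Icc (0 : ℝ) 1, exp (B s) = g o - β m s := by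
    intro m
    refine logLift (hco.starConvex I0) I0 (F := fun t => g o - β m t)
      (continuousOn_const.sub (hβ m)) ?_ z0 (by rw [ho, hz0])
    intro t ht
    obtain ⟨l, hl⟩ := hex m
    have := hcon l m hl.symm 0 I0 t ht
    rw [ho] at this
    exact sub_ne_zero.2 this
  choose A hA hA0 hAe using hAex
  choose B hB hB0 hBe using hBex
  let ell : Fin 3 → ℂ → ℂ := fun m w => log (1 - w * conj (β m 1))
  have hellc : ∀ m (S : Set ℝ) (F : ℝ → ℂ), ContinuousOn F S →
      (∀ t ∈ S, ‖F t‖ ≤ 1 ∧ F t ≠ β m 1) → ContinuousOn (fun t => ell m (F t)) S := by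
    intro m S F hF h
    refine ContinuousOn.clog (by fun_prop) ?_
    intro t ht
    exact Or.inl (one_sub_re_pos (h t ht).1 (hend m) (h t ht).2)
  have helle : ∀ m w, ‖w‖ ≤ 1 → w ≠ β m 1 → β m 1 * exp (ell m w) = β m 1 - w := by
    intro m w hw hne
    have := one_sub_re_pos hw (hend m) hne
    rw [exp_log (fun h => by rw [h] at this; simp at this), mul_one_sub_conj (hend m)]
  have hg1 : ∀ l, g (β l 1) = β l 1 := fun l => hH _ (hend l).ge
  have hne_a : ∀ l m, l ≠ m → ∀ s ∈ Icc (0 : ℝ) 1, β m s ≠ β l 1 := by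
    intro l m hlm s hs h
    have := hcon l m hlm 1 I1 s hs
    rw [hg1] at this
    exact this h.symm
  have key : ∀ l m, l ≠ m → B m 1 - ell m (g o) + ell m (β l 1) = A l 1 - ell l o + ell l (β m 1) := by
    intro l m hlm
    have hsq : Convex ℝ (Icc (0 : ℝ) 1 ×ˢ Icc (0 : ℝ) 1) := hco.prod hco
    obtain ⟨Θ, hΘ, hΘ0, hΘe⟩ := logLift (S := Icc (0 : ℝ) 1 ×ˢ Icc (0 : ℝ) 1) (x0 := (0, 0))
      (hsq.starConvex ⟨I0, I0⟩) ⟨I0, I0⟩ (F := fun x => g (β l x.2) - β m x.1)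
      (by
        refine ContinuousOn.sub (hg.comp_continuousOn ((hβ l).comp continuousOn_snd ?_))
          ((hβ m).comp continuousOn_fst ?_)
        · exact fun x hx => hx.2
        · exact fun x hx => hx.1)
      (fun x hx => sub_ne_zero.2 (hcon l m hlm _ hx.2 _ hx.1)) z0 (by simp only; rw [ho, ho, hz0])
    have e1 : Θ (0, 1) = A l 1 :=
      logUnique hpre (l1 := fun t => Θ (0, t)) (hΘ.comp (by fun_prop) fun t ht => ⟨I0, ht⟩) (hA l)
        (fun t ht => by rw [hΘe _ ⟨I0, ht⟩, hAe l t ht, ho]) I0 (by rw [hΘ0, hA0]) 1 I1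
    have e2 : Θ (1, 0) = B m 1 :=
      logUnique hpre (l1 := fun t => Θ (t, 0)) (hΘ.comp (by fun_prop) fun t ht => ⟨ht, I0⟩) (hB m)
        (fun t ht => by rw [hΘe _ ⟨ht, I0⟩, hBe m t ht, ho]) I0 (by rw [hΘ0, hB0]) 1 I1
    obtain ⟨u, hu⟩ : ∃ u, exp u = -β m 1 := ⟨log (-β m 1), exp_log (by
      rw [neg_ne_zero, ← norm_ne_zero_iff, hend]; norm_num)⟩
    obtain ⟨v, hv⟩ : ∃ v, exp v = β l 1 := ⟨log (β l 1), exp_log (by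
      rw [← norm_ne_zero_iff, hend]; norm_num)⟩
    have hgl : ∀ t ∈ Icc (0 : ℝ) 1, ‖g (β l t)‖ ≤ 1 ∧ g (β l t) ≠ β m 1 := fun t ht =>
      ⟨hle _ (hβ1 l t ht), hcon l m hlm t ht 1 I1⟩
    have hgm : ∀ t ∈ Icc (0 : ℝ) 1, ‖β m t‖ ≤ 1 ∧ β m t ≠ β l 1 := fun t ht =>
      ⟨hβ1 m t ht, hne_a l m hlm t ht⟩
    obtain ⟨c, hc⟩ := logConst hpre (l1 := fun t => Θ (1, t))
      (l2 := fun t => u + ell m (g (β l t))) (hΘ.comp (by fun_prop) fun t ht => ⟨I1, ht⟩)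
      (continuousOn_const.add (hellc m _ _ (hg.comp_continuousOn (hβ l)) hgl))
      (fun t ht => by
        have := helle m _ (hgl t ht).1 (hgl t ht).2
        rw [hΘe _ ⟨I1, ht⟩, exp_add, hu]
        linear_combination this)
    obtain ⟨d, hd⟩ := logConst hpre (l1 := fun t => Θ (t, 1))
      (l2 := fun t => v + ell l (β m t)) (hΘ.comp (by fun_prop) fun t ht => ⟨ht, I1⟩)
      (continuousOn_const.add (hellc l _ _ (hβ m) hgm))
      (fun t ht => by
        have := helle l _ (hgm t ht).1 (hgm t ht).2
        rw [hΘe _ ⟨ht, I1⟩, exp_add, hv]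
        simp only
        rw [hg1]
        linear_combination -this)
    have c0 := hc 0 I0
    have c1 := hc 1 I1
    have d0 := hd 0 I0
    have d1 := hd 1 I1
    simp only [ho, hg1] at c0 c1 d0 d1
    rw [e2] at c0
    rw [e1] at d0
    linear_combination c0 - c1 - d0 + d1
  have ho1 : ‖o‖ ≤ 1 := ho 0 ▸ hβ1 0 0 I0
  have hone : ∀ m, o ≠ β m 1 := by
    intro m
    obtain ⟨l, hl⟩ := hex m
    have := hne_a m l hl 0 I0
    rwa [ho] at this
  have hgone : ∀ m, g o ≠ β m 1 := by
    intro m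
    obtain ⟨l, hl⟩ := hex m
    have := hcon l m hl.symm 0 I0 1 I1
    rwa [ho] at this
  have hkap : ∀ m, ∃ κ : ℤ, B m 1 - ell m (g o) = A m 1 - ell m o + Real.pi * I
      + κ * (2 * Real.pi * I) := by
    intro m
    apply Complex.exp_eq_exp_iff_exists_int.1
    have hb0 : β m 1 ≠ 0 := by rw [← norm_ne_zero_iff, hend]; norm_num
    have h1 := helle m (g o) (hle o ho1) (hgone m)
    have h2 := helle m o ho1 (hone m)
    rw [exp_sub, exp_add, exp_sub, exp_pi_mul_I, hBe m 1 I1, hAe m 1 I1, hg1]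
    rw [← h2, show g o - β m 1 = -(β m 1 * exp (ell m (g o))) by rw [h1]; ring]
    field_simp
  choose κ hκ using hkap
  have hsum : ∀ l m, l ≠ m → κ l + κ m + 1 = 0 := by
    intro l m hlm
    have e1 := key l m hlm
    have e2 := key m l hlm.symm
    rw [hκ] at e1 e2
    have : ((κ l + κ m + 1 : ℤ) : ℂ) * (2 * Real.pi * I) = 0 := by
      push_cast
      linear_combination e1 + e2
    have h2pi : (2 * Real.pi * I : ℂ) ≠ 0 := by simp [Real.pi_ne_zero]
    exact_mod_cast (mul_eq_zero.1 this).resolve_right h2pi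
  have s1 := hsum 0 1 (by decide)
  have s2 := hsum 1 2 (by decide)
  have s3 := hsum 0 2 (by decide)
  omega

end DR

namespace DR
set_option linter.unusedSectionVars false
set_option linter.unusedVariables false
open Set Complex ComplexConjugate

/-! ### The universal covering of the punctured disc -/

/-- Moebius map -/
noncomputable def Mob (a w : ℂ) : ℂ := (w - a) / (1 - conj a * w)
/-- the base point in the half plane -/
noncomputable def cz (a : ℂ) : ℂ := log (-a)
/-- Cayley map -/
noncomputable def Cay (a u : ℂ) : ℂ := (cz a + conj (cz a) * u) / (1 - u)
/-- inverse Cayley map -/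
noncomputable def Cin (a z : ℂ) : ℂ := (z - cz a) / (z + conj (cz a))
/-- the covering map in the half plane -/
noncomputable def Ea (a z : ℂ) : ℂ := Mob (-a) (exp z)
/-- the covering map in the disc -/
noncomputable def Pa (a u : ℂ) : ℂ := Ea a (Cay a u)

theorem mob_den {a w : ℂ} (ha : ‖a‖ < 1) (hw : ‖w‖ ≤ 1) : 1 - conj a * w ≠ 0 := by
  intro h
  have h1 : conj a * w = 1 := (sub_eq_zero.1 h).symm
  have h2 : ‖conj a * w‖ = 1 := by rw [h1]; simp
  rw [norm_mul, RCLike.norm_conj] at h2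
  nlinarith [norm_nonneg a, norm_nonneg w]

theorem mob_normSq {a w : ℂ} (ha : ‖a‖ < 1) (hw : ‖w‖ ≤ 1) :
    1 - ‖Mob a w‖ ^ 2 = (1 - ‖a‖ ^ 2) * (1 - ‖w‖ ^ 2) / ‖1 - conj a * w‖ ^ 2 := by
  have h := mob_den ha hw
  have h' : ‖1 - conj a * w‖ ^ 2 ≠ 0 := by simpa using h
  rw [Mob, norm_div, div_pow, eq_div_iff h', sub_mul, div_mul_cancel₀ _ h']
  simp only [← normSq_eq_norm_sq, normSq_apply, sub_re, sub_im, mul_re, mul_im, conj_re, conj_im,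
    one_re, one_im]
  ring

theorem mob_norm_lt {a w : ℂ} (ha : ‖a‖ < 1) (hw : ‖w‖ < 1) : ‖Mob a w‖ < 1 := by
  have h := mob_normSq ha hw.le
  have h1 : 0 < ‖1 - conj a * w‖ := norm_pos_iff.2 (mob_den ha hw.le)
  have h2 : 0 < 1 - ‖a‖ ^ 2 := by nlinarith [norm_nonneg a]
  have h3 : 0 < 1 - ‖w‖ ^ 2 := by nlinarith [norm_nonneg w]
  have : 0 < (1 - ‖a‖ ^ 2) * (1 - ‖w‖ ^ 2) / ‖1 - conj a * w‖ ^ 2 := by positivity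
  nlinarith [norm_nonneg (Mob a w)]

theorem mob_norm_eq {a w : ℂ} (ha : ‖a‖ < 1) (hw : ‖w‖ = 1) : ‖Mob a w‖ = 1 := by
  have h := mob_normSq ha hw.le
  rw [hw] at h
  simp only [one_pow, sub_self, mul_zero, zero_div] at h
  have : (‖Mob a w‖ - 1) * (‖Mob a w‖ + 1) = 0 := by linarith
  rcases mul_eq_zero.1 this with h | h <;> linarith [norm_nonneg (Mob a w)]

theorem mob_norm_le {a w : ℂ} (ha : ‖a‖ < 1) (hw : ‖w‖ ≤ 1) : ‖Mob a w‖ ≤ 1 := by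
  rcases eq_or_lt_of_le hw with h | h
  · exact (mob_norm_eq ha h).le
  · exact (mob_norm_lt ha h).le

theorem mob_inv {a w : ℂ} (ha : ‖a‖ < 1) (hw : ‖w‖ ≤ 1) : Mob (-a) (Mob a w) = w := by
  have h := mob_den ha hw
  have h2 : 1 - conj (-a) * Mob a w ≠ 0 := mob_den (by simpa using ha) (mob_norm_le ha hw)
  rw [Mob, div_eq_iff h2, map_neg]
  unfold Mob
  generalize conj a = b at h ⊢
  have h3 : 1 - w * b ≠ 0 := by rwa [mul_comm]
  field_simp
  ring

theorem mob_inv' {a w : ℂ} (ha : ‖a‖ < 1) (hw : ‖w‖ ≤ 1) : Mob a (Mob (-a) w) = w := by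
  have := mob_inv (a := -a) (by simpa using ha) hw
  simpa using this

theorem mob_eq_zero {a w : ℂ} (ha : ‖a‖ < 1) (hw : ‖w‖ ≤ 1) : Mob a w = 0 ↔ w = a := by
  rw [Mob, div_eq_zero_iff, or_iff_left (mob_den ha hw), sub_eq_zero]

theorem mob_sub {a w w' : ℂ} (ha : ‖a‖ < 1) (hw : ‖w‖ ≤ 1) (hw' : ‖w'‖ ≤ 1) :
    Mob a w - Mob a w' = (1 - conj a * a) * (w - w') / ((1 - conj a * w) * (1 - conj a * w')) := by
  have h := mob_den ha hw
  have h' := mob_den ha hw'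
  unfold Mob
  generalize conj a = b at h h' ⊢
  rw [div_sub_div _ _ h h']
  congr 1
  ring

theorem mob_diff {a : ℂ} (ha : ‖a‖ < 1) {w : ℂ} (hw : ‖w‖ ≤ 1) : DifferentiableAt ℂ (Mob a) w := by
  unfold Mob
  exact DifferentiableAt.div (by fun_prop) (by fun_prop) (mob_den ha hw)

theorem mob_hasDeriv {a : ℂ} (ha : ‖a‖ < 1) {w : ℂ} (hw : ‖w‖ ≤ 1) :
    HasDerivAt (Mob a) ((1 - conj a * a) / (1 - conj a * w) ^ 2) w := by
  have h1 : HasDerivAt (fun w => w - a) 1 w := (hasDerivAt_id w).sub_const a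
  have h2 : HasDerivAt (fun w => 1 - conj a * w) (-(conj a)) w := by
    simpa using ((hasDerivAt_id w).const_mul (conj a)).const_sub 1
  have := h1.div h2 (mob_den ha hw)
  refine HasDerivAt.congr_deriv (f := Mob a) this ?_
  congr 1
  ring

theorem mob_cont {a : ℂ} (ha : ‖a‖ < 1) : ContinuousOn (Mob a) (closedBall 0 1) := fun w hw =>
  (mob_diff ha (by simpa using hw)).continuousAt.continuousWithinAt

section
variable {a : ℂ}

theorem cz_re (ha0 : a ≠ 0) (ha : ‖a‖ < 1) : (cz a).re < 0 := by
  rw [cz, log_re, norm_neg]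
  exact Real.log_neg (norm_pos_iff.2 ha0) ha

theorem exp_cz (ha0 : a ≠ 0) (ha : ‖a‖ < 1) : exp (cz a) = -a := exp_log (neg_ne_zero.2 ha0)

theorem cay_re (ha0 : a ≠ 0) (ha : ‖a‖ < 1) {u : ℂ} (hu : u ≠ 1) :
    (Cay a u).re = (cz a).re * (1 - ‖u‖ ^ 2) / ‖1 - u‖ ^ 2 := by
  have h : ‖1 - u‖ ^ 2 ≠ 0 := by simpa [sub_eq_zero] using hu.symm
  have h' : normSq (1 - u) ≠ 0 := by rwa [normSq_eq_norm_sq]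
  rw [Cay, div_re, eq_div_iff h, ← normSq_eq_norm_sq (1 - u), add_mul, div_mul_cancel₀ _ h',
    div_mul_cancel₀ _ h']
  simp only [← normSq_eq_norm_sq, normSq_apply, sub_re, sub_im, mul_re, mul_im, conj_re, conj_im,
    one_re, one_im, add_re, add_im]
  ring

theorem cay_re_neg (ha0 : a ≠ 0) (ha : ‖a‖ < 1) {u : ℂ} (hu : ‖u‖ < 1) : (Cay a u).re < 0 := by
  have hu1 : u ≠ 1 := by rintro rfl; simp at hu
  rw [cay_re ha0 ha hu1]
  have h1 := cz_re ha0 ha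
  have h : 0 < ‖1 - u‖ ^ 2 := by
    have : 0 < ‖1 - u‖ := by simpa [sub_eq_zero] using hu1.symm
    positivity
  refine div_neg_of_neg_of_pos ?_ h
  have : 0 < 1 - ‖u‖ ^ 2 := by nlinarith [norm_nonneg u]
  nlinarith

theorem cay_re_zero (ha0 : a ≠ 0) (ha : ‖a‖ < 1) {u : ℂ} (hu : ‖u‖ = 1) (hu1 : u ≠ 1) : (Cay a u).re = 0 := by
  rw [cay_re ha0 ha hu1, hu]; simp

theorem cay_re_le (ha0 : a ≠ 0) (ha : ‖a‖ < 1) {u : ℂ} (hu : ‖u‖ ≤ 1) (hu1 : u ≠ 1) : (Cay a u).re ≤ 0 := by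
  rcases eq_or_lt_of_le hu with h | h
  · exact (cay_re_zero ha0 ha h hu1).le
  · exact (cay_re_neg ha0 ha h).le

theorem cin_den_ge (ha0 : a ≠ 0) (ha : ‖a‖ < 1) {z : ℂ} (hz : z.re ≤ 0) : -(cz a).re - z.re ≤ ‖z + conj (cz a)‖ := by
  have := neg_abs_le (z + conj (cz a)).re
  have h2 := abs_re_le_norm (z + conj (cz a))
  simp only [add_re, conj_re] at this h2
  linarith

theorem cin_den (ha0 : a ≠ 0) (ha : ‖a‖ < 1) {z : ℂ} (hz : z.re ≤ 0) : z + conj (cz a) ≠ 0 := by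
  rw [← norm_pos_iff]
  linarith [cin_den_ge ha0 ha hz, cz_re ha0 ha]

theorem cin_normSq (ha0 : a ≠ 0) (ha : ‖a‖ < 1) {z : ℂ} (hz : z.re ≤ 0) :
    1 - ‖Cin a z‖ ^ 2 = 4 * z.re * (cz a).re / ‖z + conj (cz a)‖ ^ 2 := by
  have h' : ‖z + conj (cz a)‖ ^ 2 ≠ 0 := by simpa using cin_den ha0 ha hz
  rw [Cin, norm_div, div_pow, eq_div_iff h', sub_mul, div_mul_cancel₀ _ h']
  simp only [← normSq_eq_norm_sq, normSq_apply, sub_re, sub_im, conj_re, conj_im, add_re, add_im]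
  ring

theorem cin_norm_lt (ha0 : a ≠ 0) (ha : ‖a‖ < 1) {z : ℂ} (hz : z.re < 0) : ‖Cin a z‖ < 1 := by
  have h := cin_normSq ha0 ha hz.le
  have h1 : 0 < ‖z + conj (cz a)‖ := norm_pos_iff.2 (cin_den ha0 ha hz.le)
  have h2 : 0 < 4 * z.re * (cz a).re := by nlinarith [cz_re ha0 ha]
  have : 0 < 4 * z.re * (cz a).re / ‖z + conj (cz a)‖ ^ 2 := by positivity
  nlinarith [norm_nonneg (Cin a z)]

theorem cin_norm_eq (ha0 : a ≠ 0) (ha : ‖a‖ < 1) {z : ℂ} (hz : z.re = 0) : ‖Cin a z‖ = 1 := by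
  have h := cin_normSq ha0 ha hz.le
  rw [hz] at h
  simp only [mul_zero, zero_mul, zero_div] at h
  have : (‖Cin a z‖ - 1) * (‖Cin a z‖ + 1) = 0 := by linarith
  rcases mul_eq_zero.1 this with h | h <;> linarith [norm_nonneg (Cin a z)]

theorem cin_norm_le (ha0 : a ≠ 0) (ha : ‖a‖ < 1) {z : ℂ} (hz : z.re ≤ 0) : ‖Cin a z‖ ≤ 1 := by
  rcases eq_or_lt_of_le hz with h | h
  · exact (cin_norm_eq ha0 ha h).le
  · exact (cin_norm_lt ha0 ha h).le

theorem cin_sub_one (ha0 : a ≠ 0) (ha : ‖a‖ < 1) {z : ℂ} (hz : z.re ≤ 0) :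
    Cin a z - 1 = (-2 * (cz a).re : ℝ) / (z + conj (cz a)) := by
  have h := cin_den ha0 ha hz
  have h2 : cz a + conj (cz a) = (2 * (cz a).re : ℝ) := by
    rw [add_conj]
  rw [Cin, eq_div_iff h, sub_mul, div_mul_cancel₀ _ h]
  push_cast at h2 ⊢
  linear_combination -h2

theorem cin_ne_one (ha0 : a ≠ 0) (ha : ‖a‖ < 1) {z : ℂ} (hz : z.re ≤ 0) : Cin a z ≠ 1 := by
  rw [← sub_ne_zero, cin_sub_one ha0 ha hz]
  refine div_ne_zero ?_ (cin_den ha0 ha hz)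
  have := cz_re ha0 ha
  exact_mod_cast (by linarith : -2 * (cz a).re > 0).ne'

theorem cin_sub (ha0 : a ≠ 0) (ha : ‖a‖ < 1) {z z' : ℂ} (hz : z.re ≤ 0) (hz' : z'.re ≤ 0) :
    Cin a z - Cin a z' = (2 * (cz a).re : ℝ) * (z - z') /
      ((z + conj (cz a)) * (z' + conj (cz a))) := by
  have h := cin_den ha0 ha hz
  have h' := cin_den ha0 ha hz'
  have h2 : cz a + conj (cz a) = (2 * (cz a).re : ℝ) := by
    rw [add_conj]
  rw [← h2]
  unfold Cin
  field_simp
  ring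

theorem cin_cay (ha0 : a ≠ 0) (ha : ‖a‖ < 1) {u : ℂ} (hu : u ≠ 1) : Cin a (Cay a u) = u := by
  have h1 : 1 - u ≠ 0 := sub_ne_zero.2 hu.symm
  have h2 : cz a + conj (cz a) ≠ 0 := by
    rw [add_conj]
    have := cz_re ha0 ha
    exact_mod_cast (by linarith : 2 * (cz a).re < 0).ne
  have h3 : Cay a u + conj (cz a) = (cz a + conj (cz a)) / (1 - u) := by
    unfold Cay; field_simp; ring
  have h4 : Cay a u - cz a = u * (cz a + conj (cz a)) / (1 - u) := by
    unfold Cay; field_simp; ring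
  rw [Cin, h3, h4]
  field_simp

theorem cay_cin (ha0 : a ≠ 0) (ha : ‖a‖ < 1) {z : ℂ} (hz : z.re ≤ 0) : Cay a (Cin a z) = z := by
  have h := cin_den ha0 ha hz
  have h2 : cz a + conj (cz a) ≠ 0 := by
    rw [add_conj]
    have := cz_re ha0 ha
    exact_mod_cast (by linarith : 2 * (cz a).re < 0).ne
  have h3 : 1 - Cin a z = (cz a + conj (cz a)) / (z + conj (cz a)) := by
    unfold Cin; field_simp; ring
  have h4 : cz a + conj (cz a) * Cin a z = z * (cz a + conj (cz a)) / (z + conj (cz a)) := by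
    unfold Cin; field_simp; ring
  rw [Cay, h3, h4]
  field_simp

theorem cin_diff (ha0 : a ≠ 0) (ha : ‖a‖ < 1) {z : ℂ} (hz : z.re ≤ 0) : DifferentiableAt ℂ (Cin a) z := by
  unfold Cin
  exact DifferentiableAt.div (by fun_prop) (by fun_prop) (cin_den ha0 ha hz)

theorem cay_diff {u : ℂ} (hu : u ≠ 1) : DifferentiableAt ℂ (Cay a) u := by
  unfold Cay
  exact DifferentiableAt.div (by fun_prop) (by fun_prop) (sub_ne_zero.2 hu.symm)

theorem exp_norm_le (ha0 : a ≠ 0) (ha : ‖a‖ < 1) {z : ℂ} (hz : z.re ≤ 0) : ‖exp z‖ ≤ 1 := by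
  rw [norm_exp]; exact Real.exp_le_one_iff.2 hz

theorem exp_norm_lt (ha0 : a ≠ 0) (ha : ‖a‖ < 1) {z : ℂ} (hz : z.re < 0) : ‖exp z‖ < 1 := by
  rw [norm_exp]; exact Real.exp_lt_one_iff.2 hz

theorem ea_norm_le (ha0 : a ≠ 0) (ha : ‖a‖ < 1) {z : ℂ} (hz : z.re ≤ 0) : ‖Ea a z‖ ≤ 1 :=
  mob_norm_le (by simpa using ha) (exp_norm_le ha0 ha hz)

theorem ea_norm_lt (ha0 : a ≠ 0) (ha : ‖a‖ < 1) {z : ℂ} (hz : z.re < 0) : ‖Ea a z‖ < 1 :=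
  mob_norm_lt (by simpa using ha) (exp_norm_lt ha0 ha hz)

theorem ea_norm_eq (ha0 : a ≠ 0) (ha : ‖a‖ < 1) {z : ℂ} (hz : z.re = 0) : ‖Ea a z‖ = 1 :=
  mob_norm_eq (by simpa using ha) (by rw [norm_exp, hz, Real.exp_zero])

theorem mob_ea (ha0 : a ≠ 0) (ha : ‖a‖ < 1) {z : ℂ} (hz : z.re ≤ 0) : Mob a (Ea a z) = exp z :=
  mob_inv' ha (exp_norm_le ha0 ha hz)

theorem ea_ne (ha0 : a ≠ 0) (ha : ‖a‖ < 1) {z : ℂ} (hz : z.re ≤ 0) : Ea a z ≠ a := by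
  intro h
  have := mob_ea ha0 ha hz
  rw [h, (mob_eq_zero ha ha.le).2 rfl] at this
  exact exp_ne_zero z this.symm

theorem ea_diff (ha0 : a ≠ 0) (ha : ‖a‖ < 1) {z : ℂ} (hz : z.re ≤ 0) : DifferentiableAt ℂ (Ea a) z :=
  (mob_diff (a := -a) (by simpa using ha) (exp_norm_le ha0 ha hz)).comp z
    Complex.differentiableAt_exp

theorem pa_norm_le (ha0 : a ≠ 0) (ha : ‖a‖ < 1) {u : ℂ} (hu : ‖u‖ ≤ 1) (hu1 : u ≠ 1) : ‖Pa a u‖ ≤ 1 :=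
  ea_norm_le ha0 ha (cay_re_le ha0 ha hu hu1)

theorem pa_norm_lt (ha0 : a ≠ 0) (ha : ‖a‖ < 1) {u : ℂ} (hu : ‖u‖ < 1) : ‖Pa a u‖ < 1 :=
  ea_norm_lt ha0 ha (cay_re_neg ha0 ha hu)

theorem pa_norm_eq (ha0 : a ≠ 0) (ha : ‖a‖ < 1) {u : ℂ} (hu : ‖u‖ = 1) (hu1 : u ≠ 1) : ‖Pa a u‖ = 1 :=
  ea_norm_eq ha0 ha (cay_re_zero ha0 ha hu hu1)

theorem mob_pa (ha0 : a ≠ 0) (ha : ‖a‖ < 1) {u : ℂ} (hu : ‖u‖ ≤ 1) (hu1 : u ≠ 1) : Mob a (Pa a u) = exp (Cay a u) :=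
  mob_ea ha0 ha (cay_re_le ha0 ha hu hu1)

theorem ne_one_of_lt {u : ℂ} (hu : ‖u‖ < 1) : u ≠ 1 := by rintro rfl; simp at hu

theorem pa_ne (ha0 : a ≠ 0) (ha : ‖a‖ < 1) {u : ℂ} (hu : ‖u‖ ≤ 1) (hu1 : u ≠ 1) : Pa a u ≠ a :=
  ea_ne ha0 ha (cay_re_le ha0 ha hu hu1)

theorem pa_zero (ha0 : a ≠ 0) (ha : ‖a‖ < 1) : Pa a 0 = 0 := by
  have : Cay a 0 = cz a := by simp [Cay]
  rw [Pa, this, Ea, exp_cz ha0 ha, Mob]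
  simp

theorem pa_diff (ha0 : a ≠ 0) (ha : ‖a‖ < 1) {u : ℂ} (hu : ‖u‖ ≤ 1) (hu1 : u ≠ 1) : DifferentiableAt ℂ (Pa a) u :=
  DifferentiableAt.comp u (ea_diff ha0 ha (cay_re_le ha0 ha hu hu1)) (cay_diff hu1)

theorem pa_diffOn (ha0 : a ≠ 0) (ha : ‖a‖ < 1) : DifferentiableOn ℂ (Pa a) (ball 0 1) := fun u hu => by
  rw [mem_ball_zero_iff] at hu
  exact (pa_diff ha0 ha hu.le (ne_one_of_lt hu)).differentiableWithinAt

theorem pa_norm_le_norm (ha0 : a ≠ 0) (ha : ‖a‖ < 1) {u : ℂ} (hu : ‖u‖ < 1) : ‖Pa a u‖ ≤ ‖u‖ := by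
  refine Complex.norm_le_norm_of_mapsTo_ball (pa_diffOn ha0 ha) ?_ (pa_zero ha0 ha) hu
  intro v hv
  rw [mem_ball_zero_iff] at hv
  simpa using (pa_norm_lt ha0 ha hv).le

theorem pa_deriv_zero (ha0 : a ≠ 0) (ha : ‖a‖ < 1) : ‖deriv (Pa a) 0‖ = 2 * ‖a‖ * (-Real.log ‖a‖) / (1 - ‖a‖ ^ 2) := by
  have h1 : HasDerivAt (Cay a) (conj (cz a) + cz a) 0 := by
    have h1 : HasDerivAt (fun u => cz a + conj (cz a) * u) (conj (cz a)) 0 := by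
      simpa using ((hasDerivAt_id (0 : ℂ)).const_mul (conj (cz a))).const_add (cz a)
    have h2 : HasDerivAt (fun u : ℂ => 1 - u) (-1) 0 := by
      simpa using (hasDerivAt_id (0 : ℂ)).const_sub 1
    have := h1.div h2 (by simp)
    refine HasDerivAt.congr_deriv (f := Cay a) this ?_
    simp
  have hc : Cay a 0 = cz a := by simp [Cay]
  have h2 : HasDerivAt (Ea a) ((1 - conj (-a) * (-a)) / (1 - conj (-a) * exp (cz a)) ^ 2
      * exp (cz a)) (cz a) :=
    (mob_hasDeriv (a := -a) (by simpa using ha) (exp_norm_le ha0 ha (cz_re ha0 ha).le)).comp (cz a)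
      (hasDerivAt_exp _)
  have h3 : HasDerivAt (Pa a) _ 0 := HasDerivAt.comp 0 (by rw [hc]; exact h2) h1
  rw [h3.deriv, exp_cz ha0 ha]
  have h4 : conj (cz a) + cz a = ((2 * Real.log ‖a‖ : ℝ) : ℂ) := by
    rw [add_comm, add_conj, cz, log_re, norm_neg]
  have h5 : (1 - conj (-a) * (-a)) = ((1 - ‖a‖ ^ 2 : ℝ) : ℂ) := by
    have : conj a * a = ((‖a‖ ^ 2 : ℝ) : ℂ) := by
      rw [mul_comm, mul_conj, normSq_eq_norm_sq]
    push_cast at this ⊢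
    rw [map_neg]
    linear_combination -this
  rw [h4, h5]
  have h6 : 0 < 1 - ‖a‖ ^ 2 := by nlinarith [norm_nonneg a]
  have h7 : Real.log ‖a‖ < 0 := Real.log_neg (norm_pos_iff.2 ha0) ha
  rw [norm_mul, norm_mul, norm_div, norm_pow, norm_neg, norm_real, norm_real, Real.norm_eq_abs,
    Real.norm_eq_abs, abs_of_pos h6, abs_of_neg (by linarith)]
  field_simp

end

theorem cfun_lt_one {x : ℝ} (hx0 : 0 < x) (hx : x < 1) :
    2 * x * (-Real.log x) / (1 - x ^ 2) < 1 := by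
  have h1 : 0 < 1 - x ^ 2 := by nlinarith
  rw [div_lt_one h1]
  have h2 : 0 < -Real.log x := by linarith [Real.log_neg hx0 hx]
  have h3 := Real.self_lt_sinh_iff.2 h2
  rw [Real.sinh_eq, neg_neg, Real.exp_log hx0, Real.exp_neg, Real.exp_log hx0] at h3
  have : x * ((x⁻¹ - x) / 2) = (1 - x ^ 2) / 2 := by field_simp
  nlinarith

end DR

namespace DR
set_option linter.unusedSectionVars false
set_option linter.unusedVariables false
open Set Complex ComplexConjugate

/-! ### Lifting homeomorphisms of the disc fixing a point -/

/-- identity outside the open unit disc -/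
def HH (g : ℂ ≃ₜ ℂ) : Prop := ∀ w, 1 ≤ ‖w‖ → g w = w

theorem HH.symm {g : ℂ ≃ₜ ℂ} (hg : HH g) : HH g.symm := fun w hw => by
  rw [Homeomorph.symm_apply_eq, hg w hw]

theorem HH.lt {g : ℂ ≃ₜ ℂ} (hg : HH g) {w : ℂ} (hw : ‖w‖ < 1) : ‖g w‖ < 1 := by
  by_contra h
  push Not at h
  have := hg _ h
  have h2 := g.injective this
  rw [h2] at h
  linarith

theorem HH.le {g : ℂ ≃ₜ ℂ} (hg : HH g) {w : ℂ} (hw : ‖w‖ ≤ 1) : ‖g w‖ ≤ 1 := by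
  rcases eq_or_lt_of_le hw with h | h
  · rw [hg w h.ge, h]
  · exact (hg.lt h).le

/-- recurrence in the plane -/
def Rec (g : ℂ → ℂ) : Prop := ∀ ε > 0, ∃ N, 1 ≤ N ∧ ∀ w, ‖g^[N] w - w‖ < ε

/-- the closed left half plane -/
def LH : Set ℂ := {z | z.re ≤ 0}

theorem mem_LH {z : ℂ} : z ∈ LH ↔ z.re ≤ 0 := Iff.rfl

theorem LH_convex : Convex ℝ LH := convex_halfSpace_re_le 0

/-- admissible maps -/
structure Adm (a : ℂ) (h : ℂ → ℂ) : Prop where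
  cont : Continuous h
  fix : ∀ w, 1 ≤ ‖w‖ → h w = w
  lt : ∀ w, ‖w‖ < 1 → ‖h w‖ < 1
  ne : ∀ w, w ≠ a → h w ≠ a

theorem Adm.le {a : ℂ} {h : ℂ → ℂ} (H : Adm a h) {w : ℂ} (hw : ‖w‖ ≤ 1) : ‖h w‖ ≤ 1 := by
  rcases eq_or_lt_of_le hw with h | h
  · rw [H.fix w h.ge, h]
  · exact (H.lt w h).le

theorem Adm.id (a : ℂ) : Adm a id := ⟨continuous_id, fun _ _ => rfl, fun _ h => h, fun _ h => h⟩

theorem Adm.comp {a : ℂ} {h k : ℂ → ℂ} (H : Adm a h) (K : Adm a k) : Adm a (h ∘ k) :=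
  ⟨H.cont.comp K.cont, fun w hw => by simp [K.fix w hw, H.fix w hw],
    fun w hw => H.lt _ (K.lt _ hw), fun w hw => H.ne _ (K.ne _ hw)⟩

theorem Adm.iter {a : ℂ} {h : ℂ → ℂ} (H : Adm a h) (n : ℕ) : Adm a (h^[n]) := by
  induction n with
  | zero => exact Adm.id a
  | succ n ih => rw [Function.iterate_succ]; exact ih.comp H

theorem HH.adm {g : ℂ ≃ₜ ℂ} (hg : HH g) {a : ℂ} (hga : g a = a) : Adm a g :=
  ⟨g.continuous, hg, fun _ => hg.lt, fun w hw h => hw (g.injective (h.trans hga.symm))⟩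

/-- lift to the half plane -/
structure KLift (a : ℂ) (h : ℂ → ℂ) (K : ℂ → ℂ) : Prop where
  cont : ContinuousOn K LH
  eq : ∀ z ∈ LH, exp (K z) = Mob a (h (Ea a z))
  zero : K 0 = 0

section
variable {a : ℂ}

theorem ea_contOn (ha0 : a ≠ 0) (ha : ‖a‖ < 1) : ContinuousOn (Ea a) LH := fun z hz =>
  (ea_diff ha0 ha hz).continuousAt.continuousWithinAt

theorem cin_contOn (ha0 : a ≠ 0) (ha : ‖a‖ < 1) : ContinuousOn (Cin a) LH := fun z hz =>
  (cin_diff ha0 ha hz).continuousAt.continuousWithinAt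

theorem klift_exists (ha0 : a ≠ 0) (ha : ‖a‖ < 1) {h : ℂ → ℂ} (H : Adm a h) : ∃ K, KLift a h K := by
  have h0 : (0 : ℂ) ∈ LH := by simp [LH]
  obtain ⟨K, hK, hK0, hKe⟩ := logLift (S := LH) (x0 := (0 : ℂ)) (F := fun z => Mob a (h (Ea a z)))
    (LH_convex.starConvex h0) h0
    ((mob_cont ha).comp (H.cont.comp_continuousOn (ea_contOn ha0 ha))
      (fun z hz => by simpa using H.le (ea_norm_le ha0 ha hz)))
    (fun z hz hh => H.ne _ (ea_ne ha0 ha hz)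
      ((mob_eq_zero ha (H.le (ea_norm_le ha0 ha hz))).1 hh)) 0
    (by
      rw [H.fix _ (ea_norm_eq ha0 ha (by simp)).ge, mob_ea ha0 ha (by simp)])
  exact ⟨K, hK, hKe, hK0⟩

theorem klift_re_le (ha0 : a ≠ 0) (ha : ‖a‖ < 1) {h K : ℂ → ℂ} (H : Adm a h) (hK : KLift a h K) {z : ℂ} (hz : z.re ≤ 0) :
    (K z).re ≤ 0 := by
  have h1 := hK.eq z hz
  have h2 := mob_norm_le ha (H.le (ea_norm_le ha0 ha hz))
  rw [← h1, norm_exp] at h2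
  exact Real.exp_le_one_iff.1 h2

theorem klift_re_lt (ha0 : a ≠ 0) (ha : ‖a‖ < 1) {h K : ℂ → ℂ} (H : Adm a h) (hK : KLift a h K) {z : ℂ} (hz : z.re < 0) :
    (K z).re < 0 := by
  have h1 := hK.eq z hz.le
  have h2 := mob_norm_lt ha (H.lt _ (ea_norm_lt ha0 ha hz))
  rw [← h1, norm_exp] at h2
  exact Real.exp_lt_one_iff.1 h2

theorem ea_klift (ha0 : a ≠ 0) (ha : ‖a‖ < 1) {h K : ℂ → ℂ} (H : Adm a h) (hK : KLift a h K) {z : ℂ} (hz : z.re ≤ 0) :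
    Ea a (K z) = h (Ea a z) := by
  rw [Ea, hK.eq z hz, mob_inv ha (H.le (ea_norm_le ha0 ha hz))]

theorem klift_unique (ha0 : a ≠ 0) (ha : ‖a‖ < 1) {h K K' : ℂ → ℂ} (hK : KLift a h K) (hK' : KLift a h K') :
    ∀ z ∈ LH, K z = K' z :=
  logUnique LH_convex.isPreconnected hK.cont hK'.cont
    (fun z hz => by rw [hK.eq z hz, hK'.eq z hz]) (x0 := 0) (by simp [LH]) (by rw [hK.zero, hK'.zero])

theorem klift_bdry (ha0 : a ≠ 0) (ha : ‖a‖ < 1) {h K : ℂ → ℂ} (H : Adm a h) (hK : KLift a h K) {z : ℂ} (hz : z.re = 0) :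
    K z = z := by
  have hc : Convex ℝ {z : ℂ | z.re = 0} := convex_hyperplane (f := Complex.re) ⟨add_re, by simp⟩ 0
  refine logUnique hc.isPreconnected (l1 := K) (l2 := fun z => z)
    (hK.cont.mono fun z hz => ?_) continuousOn_id
    (fun z hz => ?_) (x0 := 0) (by simp) (by simp [hK.zero]) z hz
  · have : z.re = 0 := hz
    exact this.le
  · have : z.re = 0 := hz
    rw [hK.eq z this.le, H.fix _ (ea_norm_eq ha0 ha this).ge, mob_ea ha0 ha this.le]

theorem klift_id (ha0 : a ≠ 0) (ha : ‖a‖ < 1) : KLift a id id := ⟨continuousOn_id, fun z hz => (mob_ea ha0 ha hz).symm, rfl⟩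

theorem klift_comp (ha0 : a ≠ 0) (ha : ‖a‖ < 1) {h K h' K' : ℂ → ℂ} (H' : Adm a h') (hK : KLift a h K)
    (hK' : KLift a h' K') : KLift a (h ∘ h') (K ∘ K') := by
  refine ⟨hK.cont.comp hK'.cont fun z hz => klift_re_le ha0 ha H' hK' hz, fun z hz => ?_, ?_⟩
  · simp only [Function.comp]
    rw [hK.eq _ (klift_re_le ha0 ha H' hK' hz), ea_klift ha0 ha H' hK' hz]
  · simp [hK.zero, hK'.zero]

theorem klift_iter (ha0 : a ≠ 0) (ha : ‖a‖ < 1) {h K : ℂ → ℂ} (H : Adm a h) (hK : KLift a h K) (n : ℕ) :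
    KLift a (h^[n]) (K^[n]) := by
  induction n with
  | zero => exact klift_id ha0 ha
  | succ n ih =>
    rw [Function.iterate_succ, Function.iterate_succ]
    exact klift_comp ha0 ha H ih hK

theorem klift_period (ha0 : a ≠ 0) (ha : ‖a‖ < 1) {h K : ℂ → ℂ} (H : Adm a h) (hK : KLift a h K) (m : ℤ) {z : ℂ}
    (hz : z.re ≤ 0) : K (z + m * (2 * Real.pi * I)) = K z + m * (2 * Real.pi * I) := by
  set T : ℂ := m * (2 * Real.pi * I) with hT
  have hTr : T.re = 0 := by simp [hT]
  have hTe : ∀ w, exp (w + T) = exp w := fun w => by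
    rw [exp_add, hT, exp_int_mul_two_pi_mul_I, mul_one]
  have h1 : KLift a h (fun z => K (z + T) - T) := by
    refine ⟨?_, fun z hz => ?_, ?_⟩
    · refine ContinuousOn.sub (hK.cont.comp (by fun_prop) fun z hz => ?_) continuousOn_const
      rw [mem_LH] at *
      simpa [hTr] using hz
    · have : z + T ∈ LH := by rw [mem_LH] at *; simpa [hTr] using hz
      have h3 : exp (K (z + T) - T) = exp (K (z + T)) := by
        rw [← hTe (K (z + T) - T), sub_add_cancel]
      rw [h3, hK.eq _ this]
      congr 2
      rw [Ea, hTe, ← Ea]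
    · simp only [zero_add]
      rw [klift_bdry ha0 ha H hK hTr, sub_self]
  have := klift_unique ha0 ha h1 hK z hz
  linear_combination this

/-- the lift in the disc -/
noncomputable def Gf (a : ℂ) (K : ℂ → ℂ) (u : ℂ) : ℂ :=
  if ‖u‖ < 1 then Cin a (K (Cay a u)) else u

theorem gf_in (K : ℂ → ℂ) {u : ℂ} (hu : ‖u‖ < 1) : Gf a K u = Cin a (K (Cay a u)) := if_pos hu

theorem gf_out (K : ℂ → ℂ) {u : ℂ} (hu : 1 ≤ ‖u‖) : Gf a K u = u := if_neg (not_lt.2 hu)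

theorem gf_le (ha0 : a ≠ 0) (ha : ‖a‖ < 1) {h K : ℂ → ℂ} (H : Adm a h) (hK : KLift a h K) {u : ℂ} (hu : ‖u‖ ≤ 1) (hu1 : u ≠ 1) :
    Gf a K u = Cin a (K (Cay a u)) := by
  rcases eq_or_lt_of_le hu with h | h
  · rw [gf_out _ h.ge, klift_bdry ha0 ha H hK (cay_re_zero ha0 ha h hu1), cin_cay ha0 ha hu1]
  · exact gf_in _ h

theorem gf_lt (ha0 : a ≠ 0) (ha : ‖a‖ < 1) {h K : ℂ → ℂ} (H : Adm a h) (hK : KLift a h K) {u : ℂ} (hu : ‖u‖ < 1) :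
    ‖Gf a K u‖ < 1 := by
  rw [gf_in _ hu]
  exact cin_norm_lt ha0 ha (klift_re_lt ha0 ha H hK (cay_re_neg ha0 ha hu))

theorem cay_gf (ha0 : a ≠ 0) (ha : ‖a‖ < 1) {h K : ℂ → ℂ} (H : Adm a h) (hK : KLift a h K) {u : ℂ} (hu : ‖u‖ < 1) :
    Cay a (Gf a K u) = K (Cay a u) := by
  rw [gf_in _ hu, cay_cin ha0 ha]
  exact klift_re_le ha0 ha H hK (cay_re_neg ha0 ha hu).le

theorem pa_gf (ha0 : a ≠ 0) (ha : ‖a‖ < 1) {h K : ℂ → ℂ} (H : Adm a h) (hK : KLift a h K) {u : ℂ} (hu : ‖u‖ < 1) :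
    Pa a (Gf a K u) = h (Pa a u) := by
  rw [Pa, cay_gf ha0 ha H hK hu, ea_klift ha0 ha H hK (cay_re_neg ha0 ha hu).le, ← Pa]

theorem gf_comp (ha0 : a ≠ 0) (ha : ‖a‖ < 1) {h K h' K' : ℂ → ℂ} (H : Adm a h') (hK : KLift a h' K') (u : ℂ) :
    Gf a K (Gf a K' u) = Gf a (K ∘ K') u := by
  rcases lt_or_ge ‖u‖ 1 with hu | hu
  · rw [gf_in _ (gf_lt ha0 ha H hK hu), cay_gf ha0 ha H hK hu, gf_in _ hu]; rfl
  · rw [gf_out _ hu, gf_out _ hu, gf_out _ hu]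

theorem gf_iter (ha0 : a ≠ 0) (ha : ‖a‖ < 1) {h K : ℂ → ℂ} (H : Adm a h) (hK : KLift a h K) (n : ℕ) (u : ℂ) :
    (Gf a K)^[n] u = Gf a (K^[n]) u := by
  induction n generalizing u with
  | zero =>
    rcases lt_or_ge ‖u‖ 1 with hu | hu
    · rw [gf_in _ hu]; simp [cin_cay ha0 ha (ne_one_of_lt hu)]
    · rw [gf_out _ hu]; rfl
  | succ n ih =>
    rw [Function.iterate_succ, Function.iterate_succ, Function.comp, ih]
    exact gf_comp ha0 ha (h := h) H hK u

theorem gf_cont (ha0 : a ≠ 0) (ha : ‖a‖ < 1) {h K h' K' : ℂ → ℂ} (H : Adm a h) (hK : KLift a h K) (H' : Adm a h')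
    (hK' : KLift a h' K') (hinv : ∀ z ∈ LH, K' (K z) = z) : Continuous (Gf a K) := by
  set c := (cz a).re with hc
  have hcneg : c < 0 := cz_re ha0 ha
  have h1 : ContinuousOn (Gf a K) (closedBall 0 1) := by
    intro u hu
    have hu' : ‖u‖ ≤ 1 := by simpa using hu
    by_cases hu1 : u = 1
    · subst hu1
      rw [Metric.continuousWithinAt_iff]
      intro ε hε
      -- bound
      set X := 2 * (-c) / ε + ‖cz a‖ with hX
      have hcomp : IsCompact (closedBall (0 : ℂ) X ∩ LH) :=
        (isCompact_closedBall _ _).inter_right (isClosed_le continuous_re continuous_const)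
      obtain ⟨M, hM⟩ := (hcomp.image_of_continuousOn
        (hK'.cont.mono inter_subset_right)).isBounded.exists_norm_le
      have hM0 : 0 ≤ M := (norm_nonneg _).trans (hM (K' 0) ⟨0, ⟨by
        simp only [mem_closedBall, dist_self]
        have : 0 ≤ 2 * (-c) / ε := by apply div_nonneg <;> linarith
        positivity, by simp [LH]⟩, rfl⟩)
      have hz0 : 0 < ‖cz a‖ := by
        rw [norm_pos_iff]; intro h; rw [hc, h] at hcneg; simp at hcneg
      have hB : 0 < M + ‖cz a‖ := by linarith
      refine ⟨2 * (-c) / (M + ‖cz a‖), by apply div_pos <;> linarith, fun v hv hd => ?_⟩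
      have hv' : ‖v‖ ≤ 1 := by simpa using hv
      have hg1 : Gf a K 1 = 1 := gf_out _ (by simp)
      rw [hg1]
      by_cases hv1 : v = 1
      · rw [hv1, hg1, dist_self]; exact hε
      rw [gf_le ha0 ha H hK hv' hv1, dist_eq, cin_sub_one ha0 ha (klift_re_le ha0 ha H hK
        (cay_re_le ha0 ha hv' hv1)), norm_div, norm_real, Real.norm_eq_abs, abs_of_pos (by linarith)]
      have hzr := cay_re_le ha0 ha hv' hv1
      set z := Cay a v with hz
      have hvz : v = Cin a z := (cin_cay ha0 ha hv1).symm
      have hKz := klift_re_le ha0 ha H hK hzr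
      have hzM : M < ‖z‖ := by
        by_contra hcon
        push Not at hcon
        rw [dist_eq, hvz, cin_sub_one ha0 ha hzr, norm_div, norm_real, Real.norm_eq_abs,
          abs_of_pos (by linarith)] at hd
        have h3 : ‖z + conj (cz a)‖ ≤ M + ‖cz a‖ :=
          (norm_add_le _ _).trans (by rw [RCLike.norm_conj]; linarith)
        have h4 : 0 < ‖z + conj (cz a)‖ := norm_pos_iff.2 (cin_den ha0 ha hzr)
        have : 2 * (-c) / (M + ‖cz a‖) ≤ -2 * c / ‖z + conj (cz a)‖ := by
          rw [show -2 * c = 2 * (-c) by ring]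
          apply div_le_div_of_nonneg_left _ h4 h3
          linarith
        linarith
      have hKX : X < ‖K z‖ := by
        by_contra hcon
        push Not at hcon
        have := hM (K' (K z)) ⟨K z, ⟨by simpa using hcon, hKz⟩, rfl⟩
        rw [hinv z hzr] at this
        linarith
      have h5 : 2 * (-c) / ε < ‖K z + conj (cz a)‖ := by
        have : ‖K z‖ ≤ ‖K z + conj (cz a)‖ + ‖cz a‖ := by
          have := norm_sub_le (K z + conj (cz a)) (conj (cz a))
          rwa [add_sub_cancel_right, RCLike.norm_conj] at this
        linarith
      have h6 : 0 < ‖K z + conj (cz a)‖ := norm_pos_iff.2 (cin_den ha0 ha hKz)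
      rw [div_lt_iff₀ h6]
      rw [div_lt_iff₀ hε] at h5
      linarith
    · have h2 : ContinuousWithinAt (fun u => Cin a (K (Cay a u))) (closedBall 0 1 ∩ {1}ᶜ) u := by
        refine ContinuousWithinAt.comp (f := fun u => K (Cay a u)) (t := LH) ((cin_contOn ha0 ha) _ (klift_re_le ha0 ha H hK
          (cay_re_le ha0 ha hu' hu1))) ?_ ?_
        · refine ContinuousWithinAt.comp (t := LH) (hK.cont _ (cay_re_le ha0 ha hu' hu1))
            (cay_diff hu1).continuousAt.continuousWithinAt ?_
          intro v hv
          exact cay_re_le ha0 ha (by simpa using hv.1) hv.2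
        · intro v hv
          exact klift_re_le ha0 ha H hK (cay_re_le ha0 ha (by simpa using hv.1) hv.2)
      have h3 : ContinuousWithinAt (Gf a K) (closedBall 0 1 ∩ {1}ᶜ) u :=
        h2.congr (fun v hv => gf_le ha0 ha H hK (by simpa using hv.1) hv.2)
          (gf_le ha0 ha H hK hu' hu1)
      exact (continuousWithinAt_inter (isOpen_compl_singleton.mem_nhds hu1)).1 h3
  have h2 : ContinuousOn (Gf a K) {u | 1 ≤ ‖u‖} :=
    continuousOn_id.congr fun u hu => gf_out _ hu
  rw [← continuousOn_univ]
  have h3 := h1.union_of_isClosed h2 isClosed_closedBall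
    (isClosed_le continuous_const continuous_norm)
  refine h3.mono fun u _ => ?_
  rcases le_total ‖u‖ 1 with h | h
  · left; simpa using h
  · right; exact h

theorem mob_lip (ha0 : a ≠ 0) (ha : ‖a‖ < 1) {w w' : ℂ} (hw : ‖w‖ ≤ 1) (hw' : ‖w'‖ ≤ 1) :
    ‖Mob a w - Mob a w'‖ ≤ ‖w - w'‖ / (1 - ‖a‖) ^ 2 := by
  rw [mob_sub ha hw hw', norm_div, norm_mul, norm_mul]
  have h1 : ‖1 - conj a * a‖ ≤ 1 := by
    have : conj a * a = ((‖a‖ ^ 2 : ℝ) : ℂ) := by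
      rw [mul_comm, mul_conj, normSq_eq_norm_sq]
    rw [this, ← ofReal_one, ← ofReal_sub, norm_real, Real.norm_eq_abs, abs_le]
    constructor <;> nlinarith [norm_nonneg a]
  have h2 : ∀ w : ℂ, ‖w‖ ≤ 1 → 1 - ‖a‖ ≤ ‖1 - conj a * w‖ := fun w hw => by
    have h3 := norm_sub_norm_le 1 (conj a * w)
    rw [norm_mul, RCLike.norm_conj, norm_one] at h3
    nlinarith [norm_nonneg a, norm_nonneg w]
  have h3 : 0 < 1 - ‖a‖ := by linarith
  have h4 : (1 - ‖a‖) ^ 2 ≤ ‖1 - conj a * w‖ * ‖1 - conj a * w'‖ := by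
    rw [sq]; exact mul_le_mul (h2 w hw) (h2 w' hw') h3.le (h3.le.trans (h2 w hw))
  apply div_le_div₀ (norm_nonneg _) _ (by positivity) h4
  nlinarith [norm_nonneg (w - w')]

theorem lift_close (ha0 : a ≠ 0) (ha : ‖a‖ < 1) {e : ℝ} (he : 0 < e) : ∃ ε > 0, ∀ h K, Adm a h → KLift a h K →
    (∀ w, ‖h w - w‖ < ε) → ∀ u, ‖Gf a K u - u‖ < e := by
  set c := -(cz a).re with hc
  have hcp : 0 < c := by have := cz_re ha0 ha; linarith
  set X := 2 + 4 * c / e with hX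
  have hX2 : 0 < 4 * c / e := by positivity
  obtain ⟨δ, hδ0, hδ1, hδ2⟩ : ∃ δ : ℝ, 0 < δ ∧ δ ≤ 1 / 2 ∧ 2 * δ / c < e := by
    refine ⟨min (1 / 2) (c * e / 4), by positivity, min_le_left _ _, ?_⟩
    rw [div_lt_iff₀ hcp]
    have := min_le_right (1 / 2) (c * e / 4)
    nlinarith [mul_pos hcp he]
  have h3 : 0 < 1 - ‖a‖ := by linarith
  have hexpX : 0 < Real.exp (-X) := Real.exp_pos _
  refine ⟨δ / 2 * Real.exp (-X) * (1 - ‖a‖) ^ 2, by positivity, fun h K H hK hcl u => ?_⟩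
  rcases lt_or_ge ‖u‖ 1 with hu | hu
  swap
  · rw [gf_out _ hu, sub_self, norm_zero]; exact he
  have hexp : ∀ z : ℂ, z.re ≤ 0 → ‖exp (K z) - exp z‖ ≤ δ / 2 * Real.exp (-X) := fun z hz => by
    rw [hK.eq z hz, ← mob_ea ha0 ha hz]
    refine (mob_lip ha0 ha (H.le (ea_norm_le ha0 ha hz)) (ea_norm_le ha0 ha hz)).trans ?_
    rw [div_le_iff₀ (by positivity)]
    exact (hcl _).le
  have hzr := cay_re_neg ha0 ha hu
  rw [gf_in _ hu]
  nth_rw 2 [← cin_cay ha0 ha (ne_one_of_lt hu)]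
  set z := Cay a u with hz
  have hKr := klift_re_le ha0 ha H hK hzr.le
  rcases le_or_gt (-X) z.re with hzX | hzX
  · -- near region
    set S : Set ℂ := {z | -X ≤ z.re} ∩ LH with hS
    have hSc : Convex ℝ S := (convex_halfSpace_re_ge _).inter LH_convex
    have hW : ∀ z ∈ S, ‖exp (K z - z) - 1‖ ≤ δ / 2 := by
      rintro z ⟨hz1, hz2⟩
      have hz1' : -X ≤ z.re := hz1
      have h4 : exp (K z - z) - 1 = (exp (K z) - exp z) * exp (-z) := by
        rw [sub_mul, ← exp_add, ← exp_add]; simp [sub_eq_add_neg]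
      rw [h4, norm_mul, norm_exp, neg_re]
      have h5 : Real.exp (-z.re) ≤ Real.exp X := Real.exp_le_exp.2 (by linarith)
      calc _ ≤ δ / 2 * Real.exp (-X) * Real.exp X :=
            mul_le_mul (hexp z hz2) h5 (Real.exp_pos _).le (by positivity)
        _ = δ / 2 := by rw [mul_assoc, ← Real.exp_add]; simp
    have hslit : ∀ z ∈ S, exp (K z - z) ∈ slitPlane := fun z hz => by
      left
      have h4 := (abs_re_le_norm _).trans (hW z hz)
      have h6 := abs_le.1 h4
      rw [sub_re, one_re] at h6
      linarith [h6.1]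
    have hcs : ContinuousOn (fun z => K z - z) S :=
      (hK.cont.mono inter_subset_right).sub continuousOn_id
    have hL := logUnique hSc.isPreconnected (l1 := fun z => K z - z)
      (l2 := fun z => log (exp (K z - z))) hcs
      (fun z hz => ((hcs.cexp) z hz).clog (hslit z hz))
      (fun z hz => by rw [exp_log (exp_ne_zero _)]) (x0 := 0)
      (by constructor <;> simp [LH]; positivity) (by simp [hK.zero])
    have hzS : z ∈ S := ⟨hzX, hzr.le⟩
    have h7 : ‖K z - z‖ ≤ δ := by
      have h8 := hL z hzS
      rw [h8]
      have h9 := Complex.norm_log_one_add_half_le_self (z := exp (K z - z) - 1)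
        ((hW z hzS).trans (by linarith))
      rw [add_sub_cancel] at h9
      linarith [hW z hzS]
    rw [cin_sub ha0 ha hKr hzr.le, norm_div, norm_mul, norm_mul, norm_real, Real.norm_eq_abs,
      abs_of_neg (by linarith)]
    have h10 := cin_den_ge ha0 ha hKr
    have h11 := cin_den_ge ha0 ha hzr.le
    have h12 : c * c ≤ ‖K z + conj (cz a)‖ * ‖z + conj (cz a)‖ :=
      mul_le_mul (by linarith) (by linarith) hcp.le (norm_nonneg _)
    calc _ ≤ 2 * c * δ / (c * c) := by
          apply div_le_div₀ (by positivity) _ (by positivity) h12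
          have : -(2 * (cz a).re) = 2 * c := by rw [hc]; ring
          rw [this]
          gcongr
      _ = 2 * δ / c := by field_simp
      _ < e := hδ2
  · have h4 : (K z).re ≤ -X + 1 := by
      have h5 : ‖exp (K z)‖ ≤ 2 * Real.exp (-X) := by
        have h6 := hexp z hzr.le
        have h7 : ‖exp z‖ ≤ Real.exp (-X) := by
          rw [norm_exp]; exact Real.exp_le_exp.2 hzX.le
        have h8 := norm_add_le (exp (K z) - exp z) (exp z)
        rw [sub_add_cancel] at h8
        nlinarith
      have h6 : (2 : ℝ) ≤ Real.exp 1 := by linarith [Real.add_one_le_exp (1 : ℝ)]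
      rw [norm_exp] at h5
      have h7 : Real.exp (K z).re ≤ Real.exp (-X + 1) := by
        rw [Real.exp_add]; nlinarith
      exact Real.exp_le_exp.1 h7
    have h5 : ∀ v : ℂ, v.re ≤ -X + 1 → ‖Cin a v - 1‖ ≤ 2 * c / (X - 1) := fun v hv => by
      have hv0 : v.re ≤ 0 := by linarith
      rw [cin_sub_one ha0 ha hv0, norm_div, norm_real, Real.norm_eq_abs, abs_of_pos (by linarith)]
      have h6 := cin_den_ge ha0 ha hv0
      rw [show -2 * (cz a).re = 2 * c by rw [hc]; ring]
      apply div_le_div_of_nonneg_left (by positivity) (by linarith) (by linarith)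
    have h6 : Cin a (K z) - Cin a z = (Cin a (K z) - 1) - (Cin a z - 1) := by ring
    rw [h6]
    have h7 := h5 _ h4
    have h8 := h5 z (by linarith)
    have h9 : 2 * c / (X - 1) + 2 * c / (X - 1) < e := by
      rw [← add_div, div_lt_iff₀ (by linarith), hX]
      have : e * (2 + 4 * c / e - 1) = e + 4 * c := by field_simp; ring
      linarith
    linarith [norm_sub_le (Cin a (K z) - 1) (Cin a z - 1)]

theorem lift_exists (ha0 : a ≠ 0) (ha : ‖a‖ < 1) {g : ℂ ≃ₜ ℂ} (hg : HH g) (hga : g a = a) (hrec : Rec g) :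
    ∃ G : ℂ ≃ₜ ℂ, HH G ∧ (∀ u, ‖u‖ < 1 → Pa a (G u) = g (Pa a u)) ∧ Rec G ∧
      ∀ u, ‖u‖ < 1 → g (Pa a u) = Pa a u → G u = u := by
  have H := hg.adm hga
  have H' := hg.symm.adm (a := a) (by rw [Homeomorph.symm_apply_eq, hga])
  obtain ⟨K, hK⟩ := klift_exists ha0 ha H
  obtain ⟨K', hK'⟩ := klift_exists ha0 ha H'
  have h1 : ∀ z ∈ LH, K' (K z) = z := by
    have := klift_comp ha0 ha H hK' hK
    have h2 : (g.symm : ℂ → ℂ) ∘ g = id := by ext; simp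
    rw [h2] at this
    exact klift_unique ha0 ha this (klift_id ha0 ha)
  have h1' : ∀ z ∈ LH, K (K' z) = z := by
    have := klift_comp ha0 ha H' hK hK'
    have h2 : (g : ℂ → ℂ) ∘ g.symm = id := by ext; simp
    rw [h2] at this
    exact klift_unique ha0 ha this (klift_id ha0 ha)
  have hlinv : ∀ {K K' : ℂ → ℂ} {h : ℂ → ℂ} (H : Adm a h) (hK : KLift a h K)
      (h1 : ∀ z ∈ LH, K' (K z) = z) (u : ℂ), Gf a K' (Gf a K u) = u := by
    intro K K' h H hK h1 u
    rcases lt_or_ge ‖u‖ 1 with hu | hu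
    · rw [gf_in _ (gf_lt ha0 ha H hK hu), cay_gf ha0 ha H hK hu, h1 _ (cay_re_neg ha0 ha hu).le,
        cin_cay ha0 ha (ne_one_of_lt hu)]
    · rw [gf_out _ hu, gf_out _ hu]
  let G : ℂ ≃ₜ ℂ :=
    { toFun := Gf a K
      invFun := Gf a K'
      left_inv := hlinv H hK h1
      right_inv := hlinv H' hK' h1'
      continuous_toFun := gf_cont ha0 ha H hK H' hK' h1
      continuous_invFun := gf_cont ha0 ha H' hK' H hK h1' }
  have hG : ∀ u, G u = Gf a K u := fun u => rfl
  have hGr : Rec G := by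
    intro e he
    obtain ⟨ε, hε, hcl⟩ := lift_close ha0 ha he
    obtain ⟨N, hN, hNε⟩ := hrec ε hε
    refine ⟨N, hN, fun u => ?_⟩
    have : (G : ℂ → ℂ)^[N] u = Gf a (K^[N]) u := gf_iter ha0 ha H hK N u
    rw [this]
    exact hcl _ _ (H.iter N) (klift_iter ha0 ha H hK N) hNε u
  refine ⟨G, fun u hu => gf_out _ hu, fun u hu => pa_gf ha0 ha H hK hu, hGr, fun u hu hfix => ?_⟩
  have hzr := cay_re_neg ha0 ha hu
  have hcu := cin_cay ha0 ha (ne_one_of_lt hu)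
  have hKe : exp (K (Cay a u)) = exp (Cay a u) := by
    rw [hK.eq _ hzr.le, ← Pa, hfix, mob_pa ha0 ha hu.le (ne_one_of_lt hu)]
  obtain ⟨m, hm⟩ := exp_eq_exp_iff_exists_int.1 hKe
  set z := Cay a u with hz
  by_cases hm0 : m = 0
  · rw [hG, gf_in _ hu, ← hz, hm, hm0]; simpa using hcu
  exfalso
  have hit : ∀ N : ℕ, K^[N] z = z + ((m * N : ℤ) : ℂ) * (2 * Real.pi * I) := by
    intro N
    induction N with
    | zero => simp
    | succ N ih =>
      rw [Function.iterate_succ_apply', ih, klift_period ha0 ha H hK _ hzr.le, hm]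
      push_cast; ring
  set c := -(cz a).re with hc
  have hcp : 0 < c := by have := cz_re ha0 ha; linarith
  set B := ‖z + conj (cz a)‖ with hB
  have hBp : 0 < B := norm_pos_iff.2 (cin_den ha0 ha hzr.le)
  have hpi := Real.pi_pos
  obtain ⟨N, hN, hNe⟩ := hGr (4 * Real.pi * c / ((B + 2 * Real.pi) * B)) (by positivity)
  have h2 := hNe u
  have h3 : (G : ℂ → ℂ)^[N] u = Gf a (K^[N]) u := gf_iter ha0 ha H hK N u
  rw [h3, gf_in _ hu, ← hz, hit] at h2
  rw [← hcu] at h2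
  set k : ℤ := m * N with hk
  have hk1 : (1 : ℝ) ≤ |(k : ℝ)| := by
    have : k ≠ 0 := mul_ne_zero hm0 (by exact_mod_cast (by omega : N ≠ 0))
    exact_mod_cast Int.one_le_abs this
  have hkr : ((k : ℂ) * (2 * Real.pi * I)).re = 0 := by simp
  have hkn : ‖(k : ℂ) * (2 * Real.pi * I)‖ = 2 * Real.pi * |(k : ℝ)| := by
    simp [abs_of_pos hpi]; ring
  have h4 : (z + (k : ℂ) * (2 * Real.pi * I)).re ≤ 0 := by rw [add_re, hkr]; linarith
  rw [cin_sub ha0 ha h4 hzr.le, add_sub_cancel_left, norm_div, norm_mul, hkn, norm_mul, norm_real,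
    Real.norm_eq_abs, abs_of_neg (by linarith), ← hB] at h2
  have h5 : ‖z + k * (2 * Real.pi * I) + conj (cz a)‖ ≤ B + 2 * Real.pi * |(k : ℝ)| := by
    rw [← hkn, hB]
    have : z + k * (2 * Real.pi * I) + conj (cz a) = z + conj (cz a) + k * (2 * Real.pi * I) := by
      ring
    rw [this]; exact norm_add_le _ _
  have h6 : 0 < ‖z + k * (2 * Real.pi * I) + conj (cz a)‖ := norm_pos_iff.2 (cin_den ha0 ha h4)
  rw [div_lt_div_iff₀ (by positivity) (by positivity)] at h2
  rw [show -(2 * (cz a).re) = 2 * c by rw [hc]; ring] at h2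
  have h7 : 4 * Real.pi * c * (‖z + k * (2 * Real.pi * I) + conj (cz a)‖ * B) ≤
      4 * Real.pi * c * ((B + 2 * Real.pi * |(k : ℝ)|) * B) := by gcongr
  have h8 : 4 * Real.pi * c * ((B + 2 * Real.pi * |(k : ℝ)|) * B) ≤
      4 * Real.pi * c * (|(k : ℝ)| * (B + 2 * Real.pi) * B) := by
    gcongr
    nlinarith
  nlinarith

end

end DR

namespace DR
set_option linter.unusedSectionVars false
set_option linter.unusedVariables false
open Set Complex ComplexConjugate

/-! ### Path tools -/

theorem joined_fun {F : Set ℂ} {x y : ℂ} (h : JoinedIn F x y) :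
    ∃ k : ℝ → ℂ, Continuous k ∧ k 0 = x ∧ k 1 = y ∧ ∀ t, k t ∈ F := by
  refine ⟨h.somePath.extend, h.somePath.continuous_extend, by simp, by simp, fun t => ?_⟩
  exact h.somePath_mem _

theorem fun_joined {F : Set ℂ} {k : ℝ → ℂ} (hk : ContinuousOn k (Icc 0 1))
    (hF : ∀ t ∈ Icc (0 : ℝ) 1, k t ∈ F) {s t : ℝ} (hs : s ∈ Icc (0 : ℝ) 1) (ht : t ∈ Icc (0 : ℝ) 1) :
    JoinedIn F (k s) (k t) := by
  have hm : ∀ x ∈ Icc (0 : ℝ) 1, s + x * (t - s) ∈ Icc (0 : ℝ) 1 := fun x hx => by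
    obtain ⟨h1, h2⟩ := hx
    obtain ⟨h3, h4⟩ := hs
    obtain ⟨h5, h6⟩ := ht
    constructor <;> nlinarith
  refine JoinedIn.ofLine (f := fun x => k (s + x * (t - s))) (hk.comp (by fun_prop) hm)
    (by simp) (by simp) ?_
  rintro _ ⟨x, hx, rfl⟩
  exact hF _ (hm x hx)

theorem joined_sub {F : Set ℂ} {x y : ℂ} (h : JoinedIn F x y) :
    JoinedIn {z | JoinedIn F x z} x y := by
  obtain ⟨k, hk, h0, h1, hF⟩ := joined_fun h
  have := fun_joined (F := {z | JoinedIn F x z}) hk.continuousOn (fun t ht => by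
    have := fun_joined (F := F) hk.continuousOn (fun t _ => hF t) (left_mem_Icc.2 zero_le_one) ht
    rw [h0] at this
    exact this) (left_mem_Icc.2 zero_le_one) (right_mem_Icc.2 zero_le_one)
  rwa [h0, h1] at this

theorem avoid_half {W : Set ℂ} {a x : ℂ} {e : ℝ} (he : 0 < e) (hx : e < ‖x - a‖) {k : ℝ → ℂ}
    (hk : Continuous k) (h0 : k 0 = x) (hW : ∀ t, k t ∈ W) {t0 : ℝ} (ht0 : t0 ∈ Icc (0 : ℝ) 1)
    (ht : ‖k t0 - a‖ ≤ e) : ∃ p ∈ sphere a e, JoinedIn (W \ {a}) x p := by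
  set T : Set ℝ := Icc (0 : ℝ) 1 ∩ {t | ‖k t - a‖ ≤ e} with hT
  have hTc : IsCompact T := isCompact_Icc.inter_right (isClosed_le (by fun_prop) continuous_const)
  obtain ⟨t1, ht1, hmin⟩ := hTc.exists_isLeast ⟨t0, ht0, ht⟩
  have h1 : e ∈ (fun t => ‖k t - a‖) '' Icc 0 t1 :=
    intermediate_value_Icc' ht1.1.1 (by fun_prop) ⟨ht1.2, by simpa [h0] using hx.le⟩
  obtain ⟨t2, ht2, ht2e⟩ := h1
  have ht2e' : ‖k t2 - a‖ = e := ht2e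
  have h3 : t1 ≤ t2 := hmin ⟨⟨ht2.1, ht2.2.trans ht1.1.2⟩, ht2e'.le⟩
  have h4 : t2 = t1 := le_antisymm ht2.2 h3
  subst h4
  refine ⟨k t2, by simpa [dist_eq] using ht2e, ?_⟩
  have := fun_joined (F := W \ {a}) (k := fun s => k (s * t2)) (by fun_prop) (fun s hs => ?_)
    (left_mem_Icc.2 zero_le_one) (right_mem_Icc.2 zero_le_one)
  · simpa [h0] using this
  · refine ⟨hW _, fun hh => ?_⟩
    have hh' : k (s * t2) = a := hh
    have h5 : t2 ≤ s * t2 := hmin ⟨⟨mul_nonneg hs.1 ht1.1.1, by nlinarith [hs.1, hs.2, ht1.1.1, ht1.1.2]⟩, by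
      simp [hh', he.le]⟩
    have h6 : s * t2 = t2 := le_antisymm (by nlinarith [hs.1, hs.2, ht1.1.1]) h5
    rw [← h6, hh', sub_self, norm_zero] at ht2e'
    linarith

theorem avoid {W : Set ℂ} (hW : IsOpen W) {a x y : ℂ} (hx : x ≠ a) (hy : y ≠ a)
    (h : JoinedIn W x y) : JoinedIn (W \ {a}) x y := by
  obtain ⟨k, hk, h0, h1, hF⟩ := joined_fun h
  by_cases hex : ∃ t ∈ Icc (0 : ℝ) 1, k t = a
  · obtain ⟨t0, ht0, ht0a⟩ := hex
    obtain ⟨e0, he0, hball⟩ := Metric.nhds_basis_closedBall.mem_iff.1 (hW.mem_nhds (ht0a ▸ hF t0))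
    have hx' : 0 < ‖x - a‖ := norm_pos_iff.2 (sub_ne_zero.2 hx)
    have hy' : 0 < ‖y - a‖ := norm_pos_iff.2 (sub_ne_zero.2 hy)
    obtain ⟨e, he, hee0, hex, hey⟩ : ∃ e : ℝ, 0 < e ∧ e ≤ e0 ∧ e < ‖x - a‖ ∧ e < ‖y - a‖ := by
      refine ⟨min e0 (min (‖x - a‖ / 2) (‖y - a‖ / 2)), by positivity, min_le_left _ _, ?_, ?_⟩
      · have := (min_le_right e0 (min (‖x - a‖ / 2) (‖y - a‖ / 2))).trans (min_le_left _ _); linarith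
      · have := (min_le_right e0 (min (‖x - a‖ / 2) (‖y - a‖ / 2))).trans (min_le_right _ _); linarith
    obtain ⟨p, hp, hjp⟩ := avoid_half he hex hk h0 hF ht0 (by simp [ht0a, he.le])
    obtain ⟨q, hq, hjq⟩ := avoid_half (k := fun t => k (1 - t)) (t0 := 1 - t0) he hey (by fun_prop)
      (by simpa using h1) (fun t => hF _) ⟨by linarith [ht0.2], by linarith [ht0.1]⟩
      (by simp [ht0a, he.le])
    have hs : JoinedIn (W \ {a}) p q := by
      refine ((isPathConnected_sphere (by simp) a he.le).joinedIn p hp q hq).mono fun z hz => ⟨?_, ?_⟩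
      · exact hball (sphere_subset_closedBall.trans (closedBall_subset_closedBall hee0) hz)
      · rintro rfl
        simp at hz; linarith
    exact hjp.trans (hs.trans hjq.symm)
  · push Not at hex
    have := fun_joined (F := W \ {a}) hk.continuousOn (fun t ht => ⟨hF t, hex t ht⟩)
      (left_mem_Icc.2 zero_le_one) (right_mem_Icc.2 zero_le_one)
    rwa [h0, h1] at this

/-- avoid a point, moving the end point inside an open set -/
theorem avoid_open {W : Set ℂ} (hW : IsOpen W) {a x y : ℂ} (hx : x ≠ a) (h : JoinedIn W x y)
    {O : Set ℂ} (hO : IsOpen O) (hyO : y ∈ O) : ∃ y' ∈ O, JoinedIn (W \ {a}) x y' := by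
  by_cases hy : y = a
  · obtain ⟨e, he, hb⟩ := Metric.isOpen_iff.1 (hW.inter hO) y ⟨h.target_mem, hyO⟩
    have hz : y + (e / 2 : ℝ) ∈ ball y e := by
      simp [dist_eq, abs_of_pos he]; linarith
    have hj : JoinedIn W y (y + (e / 2 : ℝ)) :=
      ((isPathConnected_ball he).joinedIn y (mem_ball_self he) _ hz).mono
        (hb.trans inter_subset_left)
    refine ⟨_, (hb hz).2, avoid hW hx ?_ (h.trans hj)⟩
    rw [hy]
    intro h
    have h2 : ((e / 2 : ℝ) : ℂ) = 0 := by linear_combination h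
    rw [ofReal_eq_zero] at h2
    linarith
  · exact ⟨y, hyO, avoid hW hx hy h⟩

/-! ### Lifting through the covering -/
section
variable {a : ℂ}

theorem paLift (ha0 : a ≠ 0) (ha : ‖a‖ < 1) {E : Type*} [NormedAddCommGroup E] [NormedSpace ℝ E] {S : Set E} {x0 : E}
    (hS : StarConvex ℝ x0 S) (hx : x0 ∈ S) {F : E → ℂ} (hF : ContinuousOn F S)
    (h1 : ∀ x ∈ S, ‖F x‖ ≤ 1) (h0 : ∀ x ∈ S, F x ≠ a) {u0 : ℂ} (hu0 : ‖u0‖ < 1)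
    (hF0 : F x0 = Pa a u0) :
    ∃ l : E → ℂ, ContinuousOn l S ∧ l x0 = Cay a u0 ∧ (∀ x ∈ S, exp (l x) = Mob a (F x)) ∧
      (∀ x ∈ S, (l x).re ≤ 0) ∧ ContinuousOn (fun x => Cin a (l x)) S ∧ Cin a (l x0) = u0 ∧
      (∀ x ∈ S, ‖Cin a (l x)‖ ≤ 1) ∧ (∀ x ∈ S, Cin a (l x) ≠ 1) ∧
      (∀ x ∈ S, Pa a (Cin a (l x)) = F x) ∧ (∀ x ∈ S, ‖F x‖ < 1 → ‖Cin a (l x)‖ < 1) ∧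
      ∀ x ∈ S, ‖F x‖ = 1 → ‖Cin a (l x)‖ = 1 := by
  obtain ⟨l, hl, hl0, hle⟩ := logLift hS hx (F := fun x => Mob a (F x))
    ((mob_cont ha).comp hF fun x hx => by simpa using h1 x hx)
    (fun x hx hh => h0 x hx ((mob_eq_zero ha (h1 x hx)).1 hh)) (Cay a u0)
    (by rw [hF0, mob_pa ha0 ha hu0.le (ne_one_of_lt hu0)])
  have hre : ∀ x ∈ S, (l x).re ≤ 0 := fun x hx => by
    have h2 := mob_norm_le ha (h1 x hx)
    rw [← hle x hx, norm_exp] at h2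
    exact Real.exp_le_one_iff.1 h2
  refine ⟨l, hl, hl0, hle, hre, (cin_contOn ha0 ha).comp hl hre, ?_, fun x hx =>
    cin_norm_le ha0 ha (hre x hx), fun x hx => cin_ne_one ha0 ha (hre x hx), fun x hx => ?_,
    fun x hx h => ?_, fun x hx h => ?_⟩
  · rw [hl0, cin_cay ha0 ha (ne_one_of_lt hu0)]
  · rw [Pa, cay_cin ha0 ha (hre x hx), Ea, hle x hx, mob_inv ha (h1 x hx)]
  · apply cin_norm_lt ha0 ha
    have h2 := mob_norm_lt ha h
    rw [← hle x hx, norm_exp] at h2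
    exact Real.exp_lt_one_iff.1 h2
  · apply cin_norm_eq ha0 ha
    have h2 := mob_norm_eq ha h
    rw [← hle x hx, norm_exp] at h2
    exact (Real.exp_eq_one_iff _).1 h2

theorem cay_contOn_ball (ha0 : a ≠ 0) (ha : ‖a‖ < 1) : ContinuousOn (Cay a) (ball 0 1) := fun u hu =>
  (cay_diff (ne_one_of_lt (by simpa using hu))).continuousAt.continuousWithinAt

theorem paUnique (ha0 : a ≠ 0) (ha : ‖a‖ < 1) {X : Type*} [TopologicalSpace X] {S : Set X} (hS : IsPreconnected S)
    {α β : X → ℂ} (hα : ContinuousOn α S) (hβ : ContinuousOn β S) (h1 : ∀ x ∈ S, ‖α x‖ < 1)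
    (h2 : ∀ x ∈ S, ‖β x‖ < 1) (he : ∀ x ∈ S, Pa a (α x) = Pa a (β x)) {x0 : X} (hx : x0 ∈ S)
    (h0 : α x0 = β x0) : ∀ x ∈ S, α x = β x := by
  have := logUnique hS (l1 := fun x => Cay a (α x)) (l2 := fun x => Cay a (β x))
    ((cay_contOn_ball ha0 ha).comp hα fun x hx => by simpa using h1 x hx)
    ((cay_contOn_ball ha0 ha).comp hβ fun x hx => by simpa using h2 x hx)
    (fun x hx => by
      rw [← mob_pa ha0 ha (h1 x hx).le (ne_one_of_lt (h1 x hx)), he x hx,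
        mob_pa ha0 ha (h2 x hx).le (ne_one_of_lt (h2 x hx))]) hx (by rw [h0])
  intro x hx
  rw [← cin_cay ha0 ha (ne_one_of_lt (h1 x hx)), this x hx, cin_cay ha0 ha (ne_one_of_lt (h2 x hx))]

theorem paLift_joined (ha0 : a ≠ 0) (ha : ‖a‖ < 1) {A : Set ℂ} (hA : A ⊆ ball 0 1) (hAa : a ∉ A) {u0 w : ℂ} (hu0 : ‖u0‖ < 1)
    (h : JoinedIn A (Pa a u0) w) :
    ∃ u, Pa a u = w ∧ JoinedIn (ball 0 1 ∩ Pa a ⁻¹' A) u0 u := by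
  obtain ⟨k, hk, h0, h1, hF⟩ := joined_fun h
  have hlt : ∀ t, ‖k t‖ < 1 := fun t => by simpa using hA (hF t)
  obtain ⟨l, -, -, -, -, hc, hl0, -, -, hP, hlt', -⟩ := paLift ha0 ha (S := Icc (0 : ℝ) 1) (x0 := 0)
    ((convex_Icc 0 1).starConvex (by simp)) (by simp) hk.continuousOn (fun t _ => (hlt t).le)
    (fun t _ h => hAa (h ▸ hF t)) hu0 h0
  refine ⟨Cin a (l 1), by rw [hP 1 (by simp), h1], ?_⟩
  have := fun_joined (F := ball 0 1 ∩ Pa a ⁻¹' A) hc (fun t ht => ⟨by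
    simpa using hlt' t ht (hlt t), by
    rw [mem_preimage, hP t ht]; exact hF t⟩) (left_mem_Icc.2 zero_le_one) (right_mem_Icc.2 zero_le_one)
  rwa [hl0] at this

/-- the covering map from the punctured disc: near the puncture the lift goes to the boundary -/
theorem paLift_far (ha0 : a ≠ 0) (ha : ‖a‖ < 1) {A : Set ℂ} (hA : A ⊆ ball 0 1) {u0 w : ℂ} (hu0 : ‖u0‖ < 1) {ρ : ℝ} (hρ : ρ < 1)
    (hw : ρ < ‖w‖) (h : JoinedIn A (Pa a u0) w) :
    ∃ u, ρ < ‖u‖ ∧ JoinedIn (ball 0 1 ∩ Pa a ⁻¹' A) u0 u := by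
  obtain ⟨k, hk, h0, h1, hF⟩ := joined_fun h
  have hlt : ∀ t, ‖k t‖ < 1 := fun t => by simpa using hA (hF t)
  by_cases hex : ∃ t ∈ Icc (0 : ℝ) 1, k t = a
  swap
  · push Not at hex
    have hj : JoinedIn (A \ {a}) (Pa a u0) w := by
      have := fun_joined (F := A \ {a}) hk.continuousOn (fun t ht => ⟨hF t, hex t ht⟩)
        (left_mem_Icc.2 zero_le_one) (right_mem_Icc.2 zero_le_one)
      rwa [h0, h1] at this
    obtain ⟨u, hu, hju⟩ := paLift_joined ha0 ha (sdiff_subset.trans hA) (by simp) hu0 hj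
    refine ⟨u, ?_, hju.mono fun z hz => ⟨hz.1, hz.2.1⟩⟩
    have := pa_norm_le_norm ha0 ha (u := u) (by simpa using hju.target_mem.1)
    rw [hu] at this
    linarith
  obtain ⟨t0, ht0, ht0a⟩ := hex
  set T : Set ℝ := Icc (0 : ℝ) 1 ∩ k ⁻¹' {a} with hT
  have hTc : IsCompact T := isCompact_Icc.inter_right (isClosed_singleton.preimage hk)
  obtain ⟨t1, ht1, hmin⟩ := hTc.exists_isLeast ⟨t0, ht0, ht0a⟩
  have hk1 : k t1 = a := ht1.2
  have ht1p : 0 < t1 := by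
    rcases eq_or_lt_of_le ht1.1.1 with h | h
    · rw [← h, h0] at hk1
      exact absurd hk1 (pa_ne ha0 ha hu0.le (ne_one_of_lt hu0))
    · exact h
  obtain ⟨l, hl, -, hle, hre, hc, hl0, -, -, hP, hlt', -⟩ := paLift ha0 ha (S := Ico (0 : ℝ) t1)
    (x0 := 0)
    ((convex_Ico 0 t1).starConvex (by simpa using ht1p)) (by simpa using ht1p) hk.continuousOn
    (fun t _ => (hlt t).le)
    (fun t ht h => absurd (hmin ⟨⟨ht.1, ht.2.le.trans ht1.1.2⟩, h⟩) (not_le.2 ht.2)) hu0 h0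
  -- find a far point
  obtain ⟨t2, ht2, hfar⟩ : ∃ t ∈ Ico 0 t1, ρ < ‖Cin a (l t)‖ := by
    set c := -(cz a).re with hc'
    have hcp : 0 < c := by have := cz_re ha0 ha; linarith
    set X := 2 * c / (1 - ρ) with hX
    have hXp : 0 < X := by apply div_pos <;> linarith
    have hcont : ContinuousAt (fun t => ‖Mob a (k t)‖) t1 :=
      ((mob_diff ha (hlt t1).le).continuousAt.comp hk.continuousAt).norm
    have hz : ‖Mob a (k t1)‖ < Real.exp (-X) := by
      rw [(mob_eq_zero ha (hlt t1).le).2 hk1, norm_zero]; exact Real.exp_pos _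
    have hev := hcont.eventually (gt_mem_nhds hz)
    obtain ⟨δ, hδ, hball⟩ := Metric.eventually_nhds_iff.1 hev
    refine ⟨max (t1 - δ / 2) 0, ⟨le_max_right _ _, max_lt (by linarith) ht1p⟩, ?_⟩
    set t := max (t1 - δ / 2) 0 with ht
    have htt : t ∈ Ico 0 t1 := ⟨le_max_right _ _, max_lt (by linarith) ht1p⟩
    have h4 : ‖Mob a (k t)‖ < Real.exp (-X) := hball (by
      rw [Real.dist_eq, abs_sub_lt_iff]
      have := le_max_left (t1 - δ / 2) 0
      constructor <;> linarith [htt.2])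
    rw [← hle t htt, norm_exp, Real.exp_lt_exp] at h4
    have h5 := cin_den_ge ha0 ha (hre t htt)
    have h6 : ‖Cin a (l t) - 1‖ < 1 - ρ := by
      rw [cin_sub_one ha0 ha (hre t htt), norm_div, norm_real, Real.norm_eq_abs,
        abs_of_pos (by linarith), div_lt_iff₀ (by linarith)]
      have h7 : X < ‖l t + conj (cz a)‖ := by linarith
      rw [hX, div_lt_iff₀ (by linarith)] at h7
      linarith
    have h8 := norm_sub_norm_le 1 (1 - Cin a (l t))
    rw [sub_sub_cancel, norm_one, norm_sub_rev] at h8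
    linarith
  refine ⟨_, hfar, ?_⟩
  have hm : ∀ s ∈ Icc (0 : ℝ) 1, s * t2 ∈ Ico 0 t1 := fun s hs =>
    ⟨mul_nonneg hs.1 ht2.1, lt_of_le_of_lt (by nlinarith [hs.1, hs.2, ht2.1]) ht2.2⟩
  have := fun_joined (F := ball 0 1 ∩ Pa a ⁻¹' A) (k := fun s => Cin a (l (s * t2)))
    (hc.comp (f := fun s => s * t2) (by fun_prop) hm) (fun s hs => ⟨by
    simpa using hlt' _ (hm s hs) (hlt _), by
    rw [mem_preimage, hP _ (hm s hs)]; exact hF _⟩) (left_mem_Icc.2 zero_le_one)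
    (right_mem_Icc.2 zero_le_one)
  simpa [hl0] using this

theorem paLift_holo (ha0 : a ≠ 0) (ha : ‖a‖ < 1) {w0 ρ : _} (hρ : 0 < ρ) {s : ℂ → ℂ} (hs : DifferentiableOn ℂ s (ball w0 ρ))
    (h1 : ∀ w ∈ ball w0 ρ, ‖s w‖ < 1) (h0 : ∀ w ∈ ball w0 ρ, s w ≠ a) {u0 : ℂ} (hu0 : ‖u0‖ < 1)
    (hs0 : s w0 = Pa a u0) : ∃ s' : ℂ → ℂ, DifferentiableOn ℂ s' (ball w0 ρ) ∧
      (∀ w ∈ ball w0 ρ, ‖s' w‖ < 1) ∧ (∀ w ∈ ball w0 ρ, Pa a (s' w) = s w) ∧ s' w0 = u0 := by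
  obtain ⟨l, hl, -, hle, hre, hc, hl0, -, -, hP, hlt', -⟩ := paLift ha0 ha (S := ball w0 ρ)
    (x0 := w0) ((convex_ball w0 ρ).starConvex (mem_ball_self hρ)) (mem_ball_self hρ) hs.continuousOn
    (fun w hw => (h1 w hw).le) h0 hu0 hs0
  have hd : DifferentiableOn ℂ l (ball w0 ρ) := log_holo isOpen_ball
    (F := fun w => Mob a (s w)) (fun w hw => ((mob_diff ha (h1 w hw).le).comp_differentiableWithinAt w
      (hs w hw))) hl hle
  exact ⟨fun w => Cin a (l w), fun w hw => (cin_diff ha0 ha (hre w hw)).comp_differentiableWithinAt w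
    (hd w hw), fun w hw => hlt' w hw (h1 w hw), hP, hl0⟩

end

end DR

namespace DR
set_option linter.unusedSectionVars false
set_option linter.unusedVariables false
open Set Complex ComplexConjugate

theorem one_sub_slit {z : ℂ} (hz : ‖z‖ < 1) : 1 - z ∈ slitPlane := by
  left
  have := (re_le_norm z)
  rw [sub_re, one_re]
  linarith

theorem pieceLog {a : ℂ} (ha : ‖a‖ < 1) {Om k : ℝ → ℂ} (hO : ContinuousOn Om (Icc 0 1))
    (hk : Continuous k) (hk0 : k 0 = a)
    (hne : ∀ t ∈ Icc (0 : ℝ) 1, ∀ s ∈ Icc (0 : ℝ) 1, Om t ≠ k s)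
    (hO1 : ∀ t ∈ Icc (0 : ℝ) 1, ‖Om t‖ < 1) (hfar : ∀ t ∈ Icc (0 : ℝ) 1, ‖Om t‖ < ‖k 1‖) :
    ∃ D : ℝ → ℂ, ContinuousOn D (Icc 0 1) ∧
      (∀ s ∈ Icc (0 : ℝ) 1, exp (D s) = (Om 1 - k s) / (Om 0 - k s)) ∧
      D 1 = log (1 - Om 1 / k 1) - log (1 - Om 0 / k 1) ∧
      ∀ l : ℝ → ℂ, ContinuousOn l (Icc 0 1) → (∀ t ∈ Icc (0 : ℝ) 1, exp (l t) = Mob a (Om t)) →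
        D 0 = l 1 - l 0 + (log (1 - conj a * Om 1) - log (1 - conj a * Om 0)) := by
  have m0 : (0 : ℝ) ∈ Icc (0 : ℝ) 1 := by simp
  have m1 : (1 : ℝ) ∈ Icc (0 : ℝ) 1 := by simp
  have hpre : IsPreconnected (Icc (0 : ℝ) 1) := isPreconnected_Icc
  set S : Set (ℝ × ℝ) := Icc 0 1 ×ˢ Icc 0 1 with hS
  have hSc : Convex ℝ S := (convex_Icc 0 1).prod (convex_Icc 0 1)
  have hF0 : ∀ p ∈ S, Om p.1 - k p.2 ≠ 0 := fun p hp => sub_ne_zero.2 (hne _ hp.1 _ hp.2)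
  obtain ⟨L, hL, -, hLe⟩ := logLift (S := S) (x0 := ((0 : ℝ), (0 : ℝ)))
    (hSc.starConvex ⟨m0, m0⟩) ⟨m0, m0⟩ (F := fun p => Om p.1 - k p.2)
    ((hO.comp continuousOn_fst fun p hp => hp.1).sub (by fun_prop)) hF0
    (log (Om 0 - k 0)) (exp_log (hF0 (0, 0) ⟨m0, m0⟩))
  have hrow : ∀ t ∈ Icc (0 : ℝ) 1, ContinuousOn (fun s => L (t, s)) (Icc 0 1) := fun t ht =>
    hL.comp (by fun_prop) fun s hs => ⟨ht, hs⟩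
  have hcol : ∀ s ∈ Icc (0 : ℝ) 1, ContinuousOn (fun t => L (t, s)) (Icc 0 1) := fun s hs =>
    hL.comp (by fun_prop) fun t ht => ⟨ht, hs⟩
  have hk1 : k 1 ≠ 0 := by
    rw [← norm_pos_iff]; exact (norm_nonneg _).trans_lt (hfar 0 m0)
  refine ⟨fun s => L (1, s) - L (0, s), (hrow 1 m1).sub (hrow 0 m0), fun s hs => ?_, ?_,
    fun l hl hle => ?_⟩
  · rw [exp_sub, hLe (1, s) ⟨m1, hs⟩, hLe (0, s) ⟨m0, hs⟩]
  · have hsl : ∀ t ∈ Icc (0 : ℝ) 1, 1 - Om t / k 1 ∈ slitPlane := fun t ht => by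
      apply one_sub_slit
      rw [norm_div, div_lt_one (norm_pos_iff.2 hk1)]
      exact hfar t ht
    obtain ⟨m, hm⟩ := logConst hpre (l1 := fun t => L (t, 1))
      (l2 := fun t => log (-k 1) + log (1 - Om t / k 1)) (hcol 1 m1)
      (continuousOn_const.add (ContinuousOn.clog (continuousOn_const.sub (hO.div_const _)) hsl))
      (fun t ht => by
        rw [hLe (t, 1) ⟨ht, m1⟩, exp_add, exp_log (neg_ne_zero.2 hk1),
          exp_log (slitPlane_ne_zero (hsl t ht))]
        field_simp
        ring)
    show L (1, 1) - L (0, 1) = _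
    rw [show L (1, 1) = _ from hm 1 m1, show L (0, 1) = _ from hm 0 m0]
    ring
  · have hsl : ∀ t ∈ Icc (0 : ℝ) 1, 1 - conj a * Om t ∈ slitPlane := fun t ht => by
      apply one_sub_slit
      rw [norm_mul, RCLike.norm_conj]
      nlinarith [norm_nonneg a, norm_nonneg (Om t), hO1 t ht]
    obtain ⟨m, hm⟩ := logConst hpre (l1 := fun t => L (t, 0))
      (l2 := fun t => l t + log (1 - conj a * Om t)) (hcol 0 m0)
      (hl.add (ContinuousOn.clog (continuousOn_const.sub (continuousOn_const.mul hO)) hsl))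
      (fun t ht => by
        rw [hLe (t, 0) ⟨ht, m0⟩, exp_add, hle t ht,
          exp_log (slitPlane_ne_zero (hsl t ht)), Mob,
          div_mul_cancel₀ _ (mob_den ha (hO1 t ht).le), hk0])
    show L (1, 0) - L (0, 0) = _
    rw [show L (1, 0) = _ from hm 1 m1, show L (0, 0) = _ from hm 0 m0]
    ring

/-- a loop made of three pieces which can be separated from `a` has winding number zero -/
theorem winding3 {a : ℂ} (ha : ‖a‖ < 1) {k : ℝ → ℂ} (hk : Continuous k) (hk0 : k 0 = a)
    (Om : Fin 3 → ℝ → ℂ) (hO : ∀ i, ContinuousOn (Om i) (Icc 0 1))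
    (hne : ∀ i, ∀ t ∈ Icc (0 : ℝ) 1, ∀ s ∈ Icc (0 : ℝ) 1, Om i t ≠ k s)
    (hO1 : ∀ i, ∀ t ∈ Icc (0 : ℝ) 1, ‖Om i t‖ < 1)
    (hfar : ∀ i, ∀ t ∈ Icc (0 : ℝ) 1, ‖Om i t‖ < ‖k 1‖)
    (e1 : Om 0 0 = Om 2 0) (e2 : Om 0 1 = Om 1 0) (e3 : Om 1 1 = Om 2 1)
    (l : Fin 3 → ℝ → ℂ) (hl : ∀ i, ContinuousOn (l i) (Icc 0 1))
    (hle : ∀ i, ∀ t ∈ Icc (0 : ℝ) 1, exp (l i t) = Mob a (Om i t)) :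
    l 0 1 - l 0 0 + (l 1 1 - l 1 0) = l 2 1 - l 2 0 := by
  have m0 : (0 : ℝ) ∈ Icc (0 : ℝ) 1 := by simp
  have m1 : (1 : ℝ) ∈ Icc (0 : ℝ) 1 := by simp
  choose D hD hDe hD1 hD0 using fun i => pieceLog ha (hO i) hk hk0 (hne i) (hO1 i) (hfar i)
  obtain ⟨m, hm⟩ := logConst (isPreconnected_Icc (a := (0 : ℝ)) (b := 1))
    (l1 := fun s => D 0 s + D 1 s) (l2 := fun s => D 2 s) ((hD 0).add (hD 1)) (hD 2)
    (fun s hs => by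
      rw [exp_add, hDe 0 s hs, hDe 1 s hs, hDe 2 s hs, ← e1, ← e2, ← e3]
      have h1 : Om 0 0 - k s ≠ 0 := sub_ne_zero.2 (hne 0 0 m0 s hs)
      have h2 : Om 0 1 - k s ≠ 0 := sub_ne_zero.2 (hne 0 1 m1 s hs)
      field_simp)
  have h1 := hm 1 m1
  have h0 := hm 0 m0
  simp only [hD1] at h1
  simp only [fun i => hD0 i (l i) (hl i) (hle i)] at h0
  rw [e1, e2, e3] at h1 h0
  linear_combination h0 - h1

end DR

namespace DR
set_option linter.unusedSectionVars false
set_option linter.unusedVariables false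
open Set Complex ComplexConjugate

/-! ### Stages -/

/-- half strips -/
def Vs (σ ρ : ℝ) : Set ℂ := {w | -ρ < σ * w.re ∧ |w.im| < ρ}

theorem vs_open (σ ρ : ℝ) : IsOpen (Vs σ ρ) :=
  (isOpen_lt (f := fun _ : ℂ => -ρ) (g := fun w => σ * w.re) continuous_const (by fun_prop)).inter
    (isOpen_lt (f := fun w : ℂ => |w.im|) (g := fun _ => ρ) (by fun_prop) continuous_const)

theorem vs_zero {σ ρ : ℝ} (hρ : 0 < ρ) : (0 : ℂ) ∈ Vs σ ρ := by
  constructor <;> simp [hρ]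

theorem vs_star {σ ρ : ℝ} (hρ : 0 < ρ) {w : ℂ} (hw : w ∈ Vs σ ρ) {t : ℝ} (h0 : 0 ≤ t) (h1 : t ≤ 1) :
    (t : ℂ) * w ∈ Vs σ ρ := by
  obtain ⟨h2, h3⟩ := hw
  constructor
  · rw [re_ofReal_mul, show σ * (t * w.re) = t * (σ * w.re) by ring]
    rcases eq_or_lt_of_le h0 with rfl | h
    · simpa using hρ
    · nlinarith
  · rw [im_ofReal_mul, abs_mul, abs_of_nonneg h0]
    nlinarith [abs_nonneg w.im]

theorem vs_near {σ ρ : ℝ} (hσ : σ = 1 ∨ σ = -1) {w w' : ℂ} (hw : w ∈ Vs σ ρ) (h : ‖w' - w‖ < ρ) :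
    w' ∈ Vs σ (2 * ρ) := by
  obtain ⟨h2, h3⟩ := hw
  have h4 := (abs_re_le_norm (w' - w)).trans_lt h
  have h5 := (abs_im_le_norm (w' - w)).trans_lt h
  rw [sub_re, abs_lt] at h4
  rw [sub_im, abs_lt] at h5
  rw [abs_lt] at h3
  constructor
  · rcases hσ with rfl | rfl <;> linarith
  · rw [abs_lt]; constructor <;> linarith

theorem vs_inter {ρ : ℝ} {w : ℂ} (h1 : w ∈ Vs 1 (ρ / 2)) (h2 : w ∈ Vs (-1) (ρ / 2)) : ‖w‖ < ρ := by
  have := norm_le_abs_re_add_abs_im w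
  have h3 : |w.re| < ρ / 2 := by
    rw [abs_lt]; constructor <;> linarith [h1.1, h2.1]
  linarith [h1.2]

/-- data of the base map -/
structure BaseD (f : ℂ ≃ₜ ℂ) (r : ℝ) (n : ℕ) : Prop where
  out : ∀ w, 1 / 2 ≤ ‖w‖ → f w = w
  r0 : 0 < r
  r1 : r < 1 / 2
  nf : ∀ w, ‖w‖ < r → f w ≠ w
  cl : ∀ w, ‖f^[n] w - w‖ < r / 4
  recu : Rec f

theorem BaseD.hh {f : ℂ ≃ₜ ℂ} {r n} (B : BaseD f r n) : HH f := fun w hw => B.out w (by linarith)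

theorem BaseD.n0 {f : ℂ ≃ₜ ℂ} {r n} (B : BaseD f r n) : ‖f^[n] 0‖ < r / 4 := by simpa using B.cl 0

/-- component of the preimage of `V` -/
def Hat (π : ℂ → ℂ) (V : Set ℂ) : Set ℂ := {u | JoinedIn (ball 0 1 ∩ π ⁻¹' V) 0 u}

theorem hat_sub {π : ℂ → ℂ} {V : Set ℂ} : Hat π V ⊆ ball 0 1 ∩ π ⁻¹' V := fun u hu => hu.target_mem

/-- a branched cover on which `f` has been lifted -/
structure Stage (f : ℂ ≃ₜ ℂ) (r : ℝ) (n : ℕ) (π : ℂ → ℂ) (g : ℂ ≃ₜ ℂ) : Prop where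
  hg : HH g
  recu : Rec g
  diff : DifferentiableOn ℂ π (ball 0 1)
  lt : ∀ u, ‖u‖ < 1 → ‖π u‖ < 1
  zero : π 0 = 0
  semi : ∀ u, ‖u‖ < 1 → π (g u) = f (π u)
  fix : ∀ u, ‖u‖ < 1 → f (π u) = π u → g u = u
  ul : ∀ (S : Set ℝ), IsPreconnected S → ∀ α β : ℝ → ℂ, ContinuousOn α S → ContinuousOn β S →
    (∀ x ∈ S, ‖α x‖ < 1) → (∀ x ∈ S, ‖β x‖ < 1) → (∀ x ∈ S, π (α x) = π (β x)) →
    ∀ x0 ∈ S, α x0 = β x0 → ∀ x ∈ S, α x = β x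
  bl : ∀ w0 ρ, 0 < ρ → ball w0 ρ ⊆ ball 0 1 → (∀ w ∈ ball w0 ρ, f w ≠ w) → ∀ u0, ‖u0‖ < 1 →
    π u0 = w0 → ∃ s : ℂ → ℂ, DifferentiableOn ℂ s (ball w0 ρ) ∧ (∀ w ∈ ball w0 ρ, ‖s w‖ < 1) ∧
      (∀ w ∈ ball w0 ρ, π (s w) = w) ∧ s w0 = u0
  right : ∃ s : ℂ → ℂ, DifferentiableOn ℂ s (ball 0 r) ∧ (∀ w ∈ ball 0 r, ‖s w‖ < 1) ∧
      (∀ w ∈ ball 0 r, π (s w) = w) ∧ s 0 = 0 ∧ g^[n] 0 = s (f^[n] 0)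
  E : ∀ σ : ℝ, σ = 1 ∨ σ = -1 → ∀ b, ‖b‖ < 1 → b ∉ Hat π (Vs σ (r / 2)) → ∀ ρ < 1,
    ∃ b', ρ < ‖b'‖ ∧ JoinedIn (ball 0 1 \ Hat π (Vs σ (r / 2))) b b'
  X : ∀ σ : ℝ, σ = 1 ∨ σ = -1 → ∀ ρ < 1, ∃ u ∈ Hat π (Vs σ (r / 2)), ρ < ‖u‖
  X' : ∀ σ : ℝ, σ = 1 ∨ σ = -1 → ∃ u ∈ Hat π (Vs σ (r / 4)), 1 / 2 < ‖π u‖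

section
variable {f : ℂ ≃ₜ ℂ} {r : ℝ} {n : ℕ}

theorem hat_id {σ ρ : ℝ} (hρ : 0 < ρ) {u : ℂ} (hu : ‖u‖ < 1) (h : u ∈ Vs σ ρ) :
    u ∈ Hat id (Vs σ ρ) := by
  have := fun_joined (F := ball 0 1 ∩ id ⁻¹' Vs σ ρ) (k := fun t => (t : ℂ) * u)
    (by fun_prop) (fun t ht => ⟨by
      rw [mem_ball_zero_iff, norm_mul, norm_real, Real.norm_of_nonneg ht.1]
      nlinarith [norm_nonneg u, ht.1, ht.2], vs_star hρ h ht.1 ht.2⟩)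
    (left_mem_Icc.2 zero_le_one) (right_mem_Icc.2 zero_le_one)
  simpa [Hat] using this

theorem sigma_mem {σ ρ x : ℝ} (hσ : σ = 1 ∨ σ = -1) (hρ : 0 < ρ) (hx : 0 ≤ x) :
    ((σ * x : ℝ) : ℂ) ∈ Vs σ ρ ∧ ‖((σ * x : ℝ) : ℂ)‖ = x := by
  have : ‖((σ * x : ℝ) : ℂ)‖ = x := by
    rw [norm_real]
    rcases hσ with rfl | rfl <;> simp [hx]
  refine ⟨⟨?_, ?_⟩, this⟩
  · rw [ofReal_re]
    rcases hσ with rfl | rfl <;> linarith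
  · rw [ofReal_im]; simpa using hρ

theorem BaseD.stage (B : BaseD f r n) : Stage f r n id f where
  hg := B.hh
  recu := B.recu
  diff := differentiableOn_id
  lt u hu := hu
  zero := rfl
  semi u hu := rfl
  fix u hu h := h
  ul S hS α β hα hβ h1 h2 he x0 hx h0 x hx' := he x hx'
  bl w0 ρ hρ hb hnf u0 hu0 h0 := ⟨id, differentiableOn_id, fun w hw => by simpa using hb hw,
    fun w hw => rfl, h0.symm⟩
  right := ⟨id, differentiableOn_id, fun w hw => by
    have : ‖w‖ < r := by simpa using hw
    have := B.r1
    simp only [id]; linarith, fun w hw => rfl, rfl, rfl⟩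
  E σ hσ b hb hV ρ hρ := by
    have hr := B.r0
    have hbV : b ∉ Vs σ (r / 2) := fun h => hV (hat_id (by linarith) hb h)
    have hb0 : 0 < ‖b‖ := norm_pos_iff.2 fun h => hbV (h ▸ vs_zero (by linarith))
    set x := max ‖b‖ ((ρ + 1) / 2) with hx
    have hx1 : x < 1 := max_lt hb (by linarith)
    have hxb : ‖b‖ ≤ x := le_max_left _ _
    have hxρ : ρ < x := lt_of_lt_of_le (by linarith) (le_max_right _ _)
    have hq : 1 ≤ x / ‖b‖ := by rwa [one_le_div hb0]
    have key : ∀ τ : ℝ, 1 ≤ τ → τ ≤ x / ‖b‖ → (τ : ℂ) * b ∈ ball 0 1 \ Hat id (Vs σ (r / 2)) := by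
      intro τ h1 h2
      refine ⟨?_, fun h => hbV ?_⟩
      · rw [mem_ball_zero_iff, norm_mul, norm_real, Real.norm_of_nonneg (by linarith)]
        rw [le_div_iff₀ hb0] at h2
        linarith
      · have := vs_star (by linarith) (hat_sub h).2 (t := τ⁻¹) (by positivity)
          (inv_le_one_of_one_le₀ h1)
        rwa [ofReal_inv, inv_mul_cancel_left₀] at this
        exact_mod_cast (by linarith : τ ≠ 0)
    have := fun_joined (F := ball 0 1 \ Hat id (Vs σ (r / 2)))
      (k := fun t => ((1 + t * (x / ‖b‖ - 1) : ℝ) : ℂ) * b)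
      (by fun_prop) (fun t ht => key _ (by nlinarith [ht.1]) (by nlinarith [ht.2]))
      (left_mem_Icc.2 zero_le_one) (right_mem_Icc.2 zero_le_one)
    refine ⟨((x / ‖b‖ : ℝ) : ℂ) * b, ?_, by simpa using this⟩
    rw [norm_mul, norm_real, Real.norm_of_nonneg (by linarith), div_mul_cancel₀ _ hb0.ne']
    exact hxρ
  X σ hσ ρ hρ := by
    have hr := B.r0
    have h0 : 0 ≤ max 0 ((ρ + 1) / 2) := le_max_left _ _
    obtain ⟨h1, h2⟩ := sigma_mem hσ (show 0 < r / 2 by linarith) h0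
    exact ⟨_, hat_id (by linarith) (by rw [h2]; exact max_lt one_pos (by linarith)) h1, by
      rw [h2]; exact lt_of_lt_of_le (by linarith) (le_max_right _ _)⟩
  X' σ hσ := by
    have hr := B.r0
    obtain ⟨h1, h2⟩ := sigma_mem hσ (show 0 < r / 4 by linarith) (show (0 : ℝ) ≤ 3 / 4 by norm_num)
    exact ⟨_, hat_id (by linarith) (by rw [h2]; norm_num) h1, by rw [id, h2]; norm_num⟩

variable {π : ℂ → ℂ} {g : ℂ ≃ₜ ℂ}

theorem Stage.iter (T : Stage f r n π g) (k : ℕ) {u : ℂ} (hu : ‖u‖ < 1) :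
    ‖g^[k] u‖ < 1 ∧ π (g^[k] u) = f^[k] (π u) := by
  induction k with
  | zero => exact ⟨hu, rfl⟩
  | succ k ih =>
    rw [Function.iterate_succ_apply', Function.iterate_succ_apply']
    exact ⟨T.hg.lt ih.1, by rw [T.semi _ ih.1, ih.2]⟩

theorem Stage.fixpi (T : Stage f r n π g) {a : ℂ} (ha : ‖a‖ < 1) (hga : g a = a) : f (π a) = π a := by
  rw [← T.semi a ha, hga]

theorem Stage.ne_zero (B : BaseD f r n) (T : Stage f r n π g) {a : ℂ} (ha : ‖a‖ < 1) (hga : g a = a) :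
    a ≠ 0 := fun h => by
  have := T.fixpi ha hga
  rw [h, T.zero] at this
  exact B.nf 0 (by simpa using B.r0) this

theorem Stage.open_pre (T : Stage f r n π g) {V : Set ℂ} (hV : IsOpen V) :
    IsOpen (ball 0 1 ∩ π ⁻¹' V) := T.diff.continuousOn.isOpen_inter_preimage isOpen_ball hV

theorem iter_fix {g : ℂ → ℂ} {x : ℂ} (h : g x = x) (n : ℕ) : g^[n] x = x :=
  Function.iterate_fixed h n

theorem pa_ball {a : ℂ} (ha0 : a ≠ 0) (ha : ‖a‖ < 1) {u : ℂ} (hu : u ∈ ball (0 : ℂ) 1) :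
    Pa a u ∈ ball (0 : ℂ) 1 := by
  rw [mem_ball_zero_iff] at *
  exact pa_norm_lt ha0 ha hu

theorem hat_pa {a : ℂ} (ha0 : a ≠ 0) (ha : ‖a‖ < 1) {V : Set ℂ} {u : ℂ}
    (hu : u ∈ Hat (π ∘ Pa a) V) : Pa a u ∈ Hat π V := by
  have := JoinedIn.map_continuousOn hu (f := Pa a)
    ((pa_diffOn ha0 ha).continuousOn.mono inter_subset_left)
  rw [pa_zero ha0 ha] at this
  refine this.mono ?_
  rintro _ ⟨v, hv, rfl⟩
  exact ⟨pa_ball ha0 ha hv.1, hv.2⟩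


/-- passing to the universal cover of the disc minus a fixed point -/
theorem Stage.step (B : BaseD f r n) (T : Stage f r n π g) {a : ℂ} (ha : ‖a‖ < 1) (hga : g a = a) :
    ∃ G : ℂ ≃ₜ ℂ, Stage f r n (π ∘ Pa a) G ∧ ∀ u, ‖u‖ < 1 → Pa a (G u) = g (Pa a u) := by
  have ha0 := T.ne_zero B ha hga
  have hpa := T.fixpi ha hga
  have hr := B.r0
  obtain ⟨G, hG, hsemi, hrec, hfix⟩ := lift_exists ha0 ha T.hg hga T.recu
  have hit : ∀ k u, ‖u‖ < 1 → ‖G^[k] u‖ < 1 ∧ Pa a (G^[k] u) = g^[k] (Pa a u) := by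
    intro k u hu
    induction k with
    | zero => exact ⟨hu, rfl⟩
    | succ k ih =>
      rw [Function.iterate_succ_apply', Function.iterate_succ_apply']
      exact ⟨hG.lt ih.1, by rw [hsemi _ ih.1, ih.2]⟩
  have hp0 : Pa a 0 = 0 := pa_zero ha0 ha
  refine ⟨G, ?_, hsemi⟩
  constructor
  · exact hG
  · exact hrec
  · exact T.diff.comp (pa_diffOn ha0 ha) fun u hu => pa_ball ha0 ha hu
  · exact fun u hu => T.lt _ (pa_norm_lt ha0 ha hu)
  · simp [hp0, T.zero]
  · intro u hu
    simp only [Function.comp]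
    rw [hsemi u hu, T.semi _ (pa_norm_lt ha0 ha hu)]
  · exact fun u hu h => hfix u hu (T.fix _ (pa_norm_lt ha0 ha hu) h)
  · intro S hS α β hα hβ h1 h2 he x0 hx h0
    have hc := (pa_diffOn ha0 ha).continuousOn
    refine paUnique ha0 ha hS hα hβ h1 h2 (T.ul S hS (fun x => Pa a (α x)) (fun x => Pa a (β x))
      (hc.comp hα fun x hx => by simpa using h1 x hx) (hc.comp hβ fun x hx => by simpa using h2 x hx)
      (fun x hx => pa_norm_lt ha0 ha (h1 x hx)) (fun x hx => pa_norm_lt ha0 ha (h2 x hx)) he x0 hx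
      (by rw [h0])) hx h0
  · intro w0 ρ hρ hb hnf u0 hu0 h0
    obtain ⟨s, hs, hs1, hs2, hs3⟩ := T.bl w0 ρ hρ hb hnf (Pa a u0) (pa_norm_lt ha0 ha hu0) h0
    obtain ⟨s', h1, h2, h3, h4⟩ := paLift_holo ha0 ha hρ hs hs1 (fun w hw h => hnf w hw (by
      rw [← hs2 w hw, h, hpa])) hu0 hs3
    exact ⟨s', h1, h2, fun w hw => by rw [Function.comp, h3 w hw, hs2 w hw], h4⟩
  · obtain ⟨s, hs, hs1, hs2, hs3, hs4⟩ := T.right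
    obtain ⟨s', h1, h2, h3, h4⟩ := paLift_holo ha0 ha hr hs hs1 (fun w hw h => B.nf w (by simpa using hw) (by
      rw [← hs2 w hw, h, hpa])) (u0 := 0) (by simp) (by rw [hs3, hp0])
    refine ⟨s', h1, h2, fun w hw => by rw [Function.comp, h3 w hw, hs2 w hw], h4, ?_⟩
    obtain ⟨σ, hσ, hσa⟩ : ∃ σ : ℝ, (σ = 1 ∨ σ = -1) ∧ π a ∉ Vs σ (r / 2) := by
      by_contra! hcon
      exact B.nf _ (vs_inter (hcon 1 (Or.inl rfl)) (hcon (-1) (Or.inr rfl))) hpa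
    set W := ball (0 : ℂ) 1 ∩ π ⁻¹' Vs σ (r / 2) with hW
    set W0 := ball (0 : ℂ) 1 ∩ π ⁻¹' Vs σ (r / 4) with hW0
    have hV0V : Vs σ (r / 4) ⊆ Vs σ (r / 2) := fun w hw => ⟨by linarith [hw.1], by linarith [hw.2]⟩
    obtain ⟨o, ho, ho2⟩ := T.X' σ hσ
    obtain ⟨c, hc, hc0, hc1, hcm⟩ := joined_fun ho
    have hc1' : ∀ t, ‖c t‖ < 1 := fun t => by simpa using (hcm t).1
    have haW : a ∉ W := fun h => hσa h.2
    have hca : ∀ t, c t ≠ a := fun t h => haW (h ▸ ⟨(hcm t).1, hV0V (hcm t).2⟩)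
    have ho1 : ‖o‖ < 1 := by simpa using (hat_sub ho).1
    have hgo : g o = o := T.fix o ho1 (B.out _ ho2.le)
    have m0 : (0 : ℝ) ∈ Icc (0 : ℝ) 1 := by simp
    have m1 : (1 : ℝ) ∈ Icc (0 : ℝ) 1 := by simp
    have hHc : ∀ t, g^[n] (c t) ∈ W := fun t => by
      obtain ⟨h5, h6⟩ := T.iter n (hc1' t)
      refine ⟨by simpa using h5, ?_⟩
      rw [mem_preimage, h6, show r / 2 = 2 * (r / 4) by ring]
      exact vs_near hσ (hcm t).2 (B.cl _)
    have hgc : Continuous (g^[n]) := g.continuous.iterate n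
    have hn0 := B.n0
    have hsm : ∀ t ∈ Icc (0 : ℝ) 1, (t : ℂ) * f^[n] 0 ∈ ball (0 : ℂ) r := fun t ht => by
      rw [mem_ball_zero_iff, norm_mul, norm_real, Real.norm_of_nonneg ht.1]
      nlinarith [norm_nonneg (f^[n] 0), ht.1, ht.2]
    have hst : ContinuousOn (fun t : ℝ => (t : ℂ) * f^[n] 0) (Icc 0 1) := by fun_prop
    have hsW : ∀ t ∈ Icc (0 : ℝ) 1, s ((t : ℂ) * f^[n] 0) ∈ W := fun t ht => by
      refine ⟨by simpa using hs1 _ (hsm t ht), ?_⟩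
      rw [mem_preimage, hs2 _ (hsm t ht)]
      refine vs_star (by linarith) ?_ ht.1 ht.2
      rw [show r / 2 = 2 * (r / 4) by ring]
      exact vs_near hσ (vs_zero (by linarith)) (B.cl _)
    set Om : Fin 3 → ℝ → ℂ := ![fun t => s ((t : ℂ) * f^[n] 0), fun t => g^[n] (c t), c] with hOm
    have hOc : ∀ i, ContinuousOn (Om i) (Icc 0 1) := by
      intro i
      fin_cases i
      · exact hs.continuousOn.comp hst hsm
      · exact (hgc.comp hc).continuousOn
      · exact hc.continuousOn
    have hOV : ∀ i, ∀ t ∈ Icc (0 : ℝ) 1, Om i t ∈ Hat π (Vs σ (r / 2)) := by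
      intro i t ht
      fin_cases i
      · have := fun_joined (hOc 0) hsW m0 ht
        have h6 : Om 0 0 = 0 := by simp [hOm, hs3]
        rwa [h6] at this
      · have h5 := fun_joined (hOc 1) (fun t _ => hHc t) m1 ht
        have h6 : Om 1 1 = o := by
          show g^[n] (c 1) = o
          rw [hc1, iter_fix hgo]
        rw [h6] at h5
        exact JoinedIn.trans (ho.mono fun z hz => ⟨hz.1, hV0V hz.2⟩) h5
      · have h5 := fun_joined (hOc 2) (F := W) (fun t _ => ⟨(hcm t).1, hV0V (hcm t).2⟩) m0 ht
        have h6 : Om 2 0 = 0 := hc0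
        rwa [h6] at h5
    have hO1 : ∀ i, ∀ t ∈ Icc (0 : ℝ) 1, ‖Om i t‖ < 1 := fun i t ht => by
      simpa using (hat_sub (hOV i t ht)).1
    have hmx : ∀ i, ∃ ρ < 1, ∀ t ∈ Icc (0 : ℝ) 1, ‖Om i t‖ ≤ ρ := fun i => by
      obtain ⟨x, hx, hxm⟩ := (isCompact_Icc (a := (0 : ℝ)) (b := 1)).exists_isMaxOn ⟨0, m0⟩ (hOc i).norm
      exact ⟨_, hO1 i x hx, fun t ht => hxm ht⟩
    choose ρ hρ1 hρ using hmx
    obtain ⟨a', ha', hja⟩ := T.E σ hσ a ha (fun h => haW (hat_sub h)) (max (max (ρ 0) (ρ 1)) (ρ 2))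
      (max_lt (max_lt (hρ1 0) (hρ1 1)) (hρ1 2))
    obtain ⟨k, hk, hk0, hk1, hkm⟩ := joined_fun hja
    have hfar : ∀ i, ∀ t ∈ Icc (0 : ℝ) 1, ‖Om i t‖ < ‖k 1‖ := by
      intro i t ht
      rw [hk1]
      refine ((hρ i t ht).trans ?_).trans_lt ha'
      fin_cases i
      · exact (le_max_left _ _).trans (le_max_left _ _)
      · exact (le_max_right _ _).trans (le_max_left _ _)
      · exact le_max_right _ _
    obtain ⟨l, hl, hl0, hle, hlre, hlc, hlz, hl1, hlne, hlP, hllt, -⟩ := paLift ha0 ha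
      ((convex_Icc (0 : ℝ) 1).starConvex m0) m0 hc.continuousOn (fun t _ => (hc1' t).le)
      (fun t _ => hca t) (u0 := 0) (by simp) (by rw [hc0, hp0])
    have hcl : ∀ t ∈ Icc (0 : ℝ) 1, ‖Cin a (l t)‖ < 1 := fun t ht => hllt t ht (hc1' t)
    have hGc : Continuous (G^[n]) := G.continuous.iterate n
    have hcay := cay_contOn_ball ha0 ha
    have hmobcay : ∀ u, ‖u‖ < 1 → exp (Cay a u) = Mob a (Pa a u) := fun u hu =>
      (mob_pa ha0 ha hu.le (ne_one_of_lt hu)).symm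
    have hw := winding3 ha hk hk0 Om hOc
      (fun i t ht x hx h => (hkm x).2 (h ▸ hOV i t ht)) hO1 hfar
      (by simp [hOm, hs3, hc0]) (by simp [hOm, hs4, hc0]) (by
        show g^[n] (c 1) = c 1
        rw [hc1, iter_fix hgo])
      ![fun t => Cay a (s' ((t : ℂ) * f^[n] 0)), fun t => Cay a (G^[n] (Cin a (l t))),
        fun t => Cay a (Cin a (l t))]
      (by
        intro i
        fin_cases i
        · exact hcay.comp (h1.continuousOn.comp hst hsm) fun t ht => by simpa using h2 _ (hsm t ht)
        · exact hcay.comp (hGc.comp_continuousOn hlc) fun t ht => by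
            simpa using (hit n _ (hcl t ht)).1
        · exact hcay.comp hlc fun t ht => by simpa using hcl t ht)
      (by
        intro i t ht
        fin_cases i
        · show exp (Cay a (s' ((t : ℂ) * f^[n] 0))) = Mob a (s ((t : ℂ) * f^[n] 0))
          rw [hmobcay _ (h2 _ (hsm t ht)), h3 _ (hsm t ht)]
        · show exp (Cay a (G^[n] (Cin a (l t)))) = Mob a (g^[n] (c t))
          obtain ⟨h5, h6⟩ := hit n _ (hcl t ht)
          rw [hmobcay _ h5, h6, hlP t ht]
        · show exp (Cay a (Cin a (l t))) = Mob a (c t)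
          rw [hmobcay _ (hcl t ht), hlP t ht])
    have hGl : G^[n] (Cin a (l 1)) = Cin a (l 1) :=
      iter_fix (hfix _ (hcl 1 m1) (by rw [hlP 1 m1, hc1, hgo])) n
    simp [hGl, hlz, h4] at hw
    have h7 : Cay a (s' (f^[n] 0)) = Cay a (G^[n] 0) := by linear_combination hw
    have h8 : ‖s' (f^[n] 0)‖ < 1 := h2 _ (by simpa using hn0.trans (by linarith))
    have h9 := congrArg (Cin a) h7
    rw [cin_cay ha0 ha (ne_one_of_lt h8), cin_cay ha0 ha (ne_one_of_lt (hit n 0 (by simp)).1)] at h9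
    exact h9.symm
  · intro σ hσ b hb hbV ρ hρ
    by_cases hPb : Pa a b ∈ Hat π (Vs σ (r / 2))
    · obtain ⟨w, hw, hwρ⟩ := T.X σ hσ ρ hρ
      have hj : JoinedIn (ball 0 1 ∩ π ⁻¹' Vs σ (r / 2)) (Pa a b) w := hPb.symm.trans hw
      obtain ⟨u, hu, hu2⟩ := paLift_far ha0 ha inter_subset_left hb hρ hwρ hj
      refine ⟨u, hu, (joined_sub hu2).mono fun z hz => ⟨hz.target_mem.1, fun hzh => hbV ?_⟩⟩
      exact JoinedIn.trans hzh (hz.symm.mono fun y hy => ⟨hy.1, hy.2.2⟩)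
    · obtain ⟨w, hw, hj⟩ := T.E σ hσ (Pa a b) (pa_norm_lt ha0 ha hb) hPb ρ hρ
      obtain ⟨u, hu, hu2⟩ := paLift_far ha0 ha sdiff_subset hb hρ hw hj
      exact ⟨u, hu, hu2.mono fun z hz => ⟨hz.1, fun h => hz.2.2 (hat_pa ha0 ha h)⟩⟩
  · intro σ hσ ρ hρ
    obtain ⟨w, hw, hwρ⟩ := T.X σ hσ ρ hρ
    obtain ⟨u, hu, hu2⟩ := paLift_far ha0 ha inter_subset_left (u0 := 0) (by simp) hρ hwρ (by rw [hp0]; exact hw)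
    exact ⟨u, hu2.mono fun y hy => ⟨hy.1, hy.2.2⟩, hu⟩
  · intro σ hσ
    obtain ⟨o, ho, ho2⟩ := T.X' σ hσ
    have hO : IsOpen (ball 0 1 ∩ π ⁻¹' {w | 1 / 2 < ‖w‖}) :=
      T.open_pre (isOpen_lt continuous_const continuous_norm)
    obtain ⟨y, hy, hj⟩ := avoid_open (T.open_pre (vs_open σ (r / 4))) ha0.symm ho hO ⟨(hat_sub ho).1, ho2⟩
    obtain ⟨u, hu, hu2⟩ := paLift_joined ha0 ha (A := (ball 0 1 ∩ π ⁻¹' Vs σ (r / 4)) \ {a})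
      (sdiff_subset.trans inter_subset_left) (fun h => h.2 rfl)
      (u0 := 0) (by simp) (by rw [hp0]; exact hj)
    refine ⟨u, hu2.mono fun z hz => ⟨hz.1, hz.2.1.2⟩, ?_⟩
    rw [Function.comp, hu]
    exact hy.2

end
end DR

namespace DR
set_option linter.unusedSectionVars false
set_option linter.unusedVariables false
open Set Complex ComplexConjugate

/-! ### Arms -/

/-- arc from the origin to the boundary free of fixed points -/
structure Arm (g : ℂ ≃ₜ ℂ) (β : ℝ → ℂ) : Prop where
  cont : ContinuousOn β (Icc 0 1)
  zero : β 0 = 0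
  lt : ∀ t ∈ Ico (0 : ℝ) 1, ‖β t‖ < 1
  ne : ∀ t ∈ Ico (0 : ℝ) 1, g (β t) ≠ β t
  fin : ‖β 1‖ = 1

theorem Arm.le {g : ℂ ≃ₜ ℂ} {β : ℝ → ℂ} (A : Arm g β) {t : ℝ} (ht : t ∈ Icc (0 : ℝ) 1) : ‖β t‖ ≤ 1 := by
  rcases eq_or_lt_of_le ht.2 with rfl | h
  · exact A.fin.le
  · exact (A.lt t ⟨ht.1, h⟩).le

theorem Arm.eq_one {g : ℂ ≃ₜ ℂ} {β : ℝ → ℂ} (A : Arm g β) {t : ℝ} (ht : t ∈ Icc (0 : ℝ) 1)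
    (h1 : 1 ≤ ‖β t‖) : t = 1 := by
  by_contra h
  exact (A.lt t ⟨ht.1, lt_of_le_of_ne ht.2 h⟩).not_ge h1

theorem pa_real {a : ℂ} (ha0 : a ≠ 0) (ha : ‖a‖ < 1) {t : ℝ} (h0 : 0 ≤ t) (h1 : t < 1) :
    ‖Pa a t‖ < ‖a‖ := by
  have hz : (1 : ℂ) - t ≠ 0 := by
    rw [← ofReal_one, ← ofReal_sub]; exact_mod_cast (sub_pos.2 h1).ne'
  have hC : Cay a t = cz a + ((2 * (cz a).re * t / (1 - t) : ℝ) : ℂ) := by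
    have h2 : conj (cz a) = 2 * (cz a).re - cz a := by
      rw [eq_sub_iff_add_eq, add_comm, add_conj]; push_cast; ring
    rw [Cay, h2]
    push_cast
    field_simp
    ring
  have hc : (cz a).re < 0 := cz_re ha0 ha
  set x := 2 * (cz a).re * t / (1 - t) with hx
  have hx0 : x ≤ 0 := div_nonpos_of_nonpos_of_nonneg (by nlinarith) (by linarith)
  have hy0 := Real.exp_pos x
  have hy1 := Real.exp_le_one_iff.2 hx0
  set y := Real.exp x with hy
  have hP : Pa a t = a * ((1 - y) / (1 - ‖a‖ ^ 2 * y) : ℝ) := by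
    rw [Pa, Ea, hC, Complex.exp_add, exp_cz ha0 ha, ← ofReal_exp, ← hy, Mob, map_neg]
    have h3 : conj a * a = ((‖a‖ ^ 2 : ℝ) : ℂ) := by rw [mul_comm, mul_conj, normSq_eq_norm_sq]
    have h4 : 1 - -conj a * (-a * (y : ℂ)) = ((1 - ‖a‖ ^ 2 * y : ℝ) : ℂ) := by
      push_cast
      rw [show (‖a‖ : ℂ) ^ 2 = conj a * a by rw [h3]; push_cast; rfl]
      ring
    rw [h4, ofReal_div]
    push_cast
    ring
  have ha1 := norm_pos_iff.2 ha0
  have ha2 : ‖a‖ ^ 2 < 1 := by nlinarith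
  have hd : 1 - y < 1 - ‖a‖ ^ 2 * y := by nlinarith
  rw [hP, norm_mul, norm_real, Real.norm_of_nonneg (div_nonneg (by linarith) (by linarith))]
  have : (1 - y) / (1 - ‖a‖ ^ 2 * y) < 1 := by
    rw [div_lt_one (by linarith)]; exact hd
  nlinarith

section
variable {f : ℂ ≃ₜ ℂ} {r : ℝ} {n : ℕ} {π : ℂ → ℂ} {g G : ℂ ≃ₜ ℂ} {a : ℂ} {β : ℝ → ℂ}

theorem arm_lift (ha0 : a ≠ 0) (ha : ‖a‖ < 1) (hga : g a = a)
    (hG : ∀ u, ‖u‖ < 1 → Pa a (G u) = g (Pa a u)) (A : Arm g β) :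
    ∃ β', Arm G β' ∧ (∀ t ∈ Icc (0 : ℝ) 1, Pa a (β' t) = β t) ∧
      (∀ t ∈ Icc (0 : ℝ) 1, β' t ≠ 1) := by
  have m0 : (0 : ℝ) ∈ Icc (0 : ℝ) 1 := by simp
  have m1 : (1 : ℝ) ∈ Icc (0 : ℝ) 1 := by simp
  obtain ⟨l, hl, hl0, hle, hlre, hlc, hlz, hl1, hlne, hlP, hllt, hlf⟩ := paLift ha0 ha
    ((convex_Icc (0 : ℝ) 1).starConvex m0) m0 A.cont (fun t ht => A.le ht)
    (fun t ht h => by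
      have h1 : t ∈ Ico (0 : ℝ) 1 := ⟨ht.1, lt_of_le_of_ne ht.2 fun h2 => by
        have := A.fin
        rw [h2] at h
        rw [h] at this
        exact ha.ne this⟩
      exact A.ne t h1 (by rw [h, hga])) (u0 := 0) (by simp) (by rw [A.zero, pa_zero ha0 ha])
  have hlt : ∀ t ∈ Ico (0 : ℝ) 1, ‖Cin a (l t)‖ < 1 := fun t ht =>
    hllt t (Ico_subset_Icc_self ht) (A.lt t ht)
  refine ⟨fun t => Cin a (l t), ⟨hlc, hlz, hlt, fun t ht h => A.ne t ht ?_, hlf 1 m1 A.fin⟩, hlP, hlne⟩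
  rw [← hlP t (Ico_subset_Icc_self ht), ← hG _ (hlt t ht), h]

theorem arm_new (ha0 : a ≠ 0) (ha : ‖a‖ < 1) (hnear : ∀ w, ‖w‖ < ‖a‖ → g w ≠ w)
    (hG : ∀ u, ‖u‖ < 1 → Pa a (G u) = g (Pa a u)) : Arm G (fun t => (t : ℂ)) := by
  have hlt : ∀ t ∈ Ico (0 : ℝ) 1, ‖(t : ℂ)‖ < 1 := fun t ht => by
    rw [norm_real, Real.norm_of_nonneg ht.1]; exact ht.2
  refine ⟨by fun_prop, by simp, hlt, fun t ht h => ?_, by simp⟩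
  exact hnear _ (pa_real ha0 ha ht.1 ht.2) (by rw [← hG _ (hlt t ht), h])

theorem Stage.nearest (B : BaseD f r n) (T : Stage f r n π g) :
    ∃ a, ‖a‖ < 1 ∧ g a = a ∧ ∀ w, ‖w‖ < ‖a‖ → g w ≠ w := by
  obtain ⟨u, hu, hu2⟩ := T.X' 1 (Or.inl rfl)
  have hu1 : ‖u‖ < 1 := by simpa using (hat_sub hu).1
  have hgu : g u = u := T.fix u hu1 (B.out _ hu2.le)
  obtain ⟨a, ha, hmin⟩ := ((isCompact_closedBall (0 : ℂ) ‖u‖).inter_right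
    (isClosed_eq g.continuous continuous_id)).exists_isMinOn ⟨u, by simp, hgu⟩ continuous_norm.continuousOn
  have hau : ‖a‖ ≤ ‖u‖ := by simpa using ha.1
  refine ⟨a, hau.trans_lt hu1, ha.2, fun w hw h => ?_⟩
  have := hmin (show w ∈ _ from ⟨by simpa using (hw.le.trans hau), h⟩)
  exact absurd hw (not_lt.2 this)

/-- stage with three arms -/
structure TS (f : ℂ ≃ₜ ℂ) (r : ℝ) (n : ℕ) (e : Fin 3 → ℝ → ℂ) (η : ℝ) (π : ℂ → ℂ) (g : ℂ ≃ₜ ℂ)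
    (β : Fin 3 → ℝ → ℂ) : Prop where
  st : Stage f r n π g
  arm : ∀ m, Arm g (β m)
  eta : ∀ l m, l ≠ m → ∀ t ∈ Icc (0 : ℝ) 1, ∀ s ∈ Icc (0 : ℝ) 1, g (β l t) = β m s →
    t ≤ 1 - η ∧ s ≤ 1 - η
  pr : ∀ m, ∀ t ∈ Ico (0 : ℝ) 1, π (β m t) = e m t

theorem TS.step (B : BaseD f r n) {e : Fin 3 → ℝ → ℂ} {η : ℝ} {β : Fin 3 → ℝ → ℂ}
    (T : TS f r n e η π g β) (ha : ‖a‖ < 1) (hga : g a = a) :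
    ∃ G β', TS f r n e η (π ∘ Pa a) G β' := by
  have ha0 := T.st.ne_zero B ha hga
  obtain ⟨G, hG, hs⟩ := T.st.step B ha hga
  choose β' hA hP h1 using fun m => arm_lift ha0 ha hga hs (T.arm m)
  refine ⟨G, β', hG, hA, fun l m hlm t ht s hs' h => T.eta l m hlm t ht s hs' ?_, fun m t ht => by
    rw [Function.comp, hP m t (Ico_subset_Icc_self ht), T.pr m t ht]⟩
  rw [← hP l t ht, ← hP m s hs', ← h]
  rcases lt_or_ge ‖β' l t‖ 1 with h2 | h2
  · exact (hs _ h2).symm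
  · rw [hG.hg _ h2, hP l t ht, T.st.hg]
    rw [(hA l).eq_one ht h2, (T.arm l).fin]

theorem TS.init (B : BaseD f r n) : ∃ e η π g β, 0 < η ∧ η ≤ 1 ∧ TS f r n e η π g β := by
  have m1 : (1 : ℝ) ∈ Icc (0 : ℝ) 1 := by simp
  obtain ⟨π, g, β, T, hA, hne⟩ : ∃ π g, ∃ β : Fin 3 → ℝ → ℂ, Stage f r n π g ∧ (∀ m, Arm g (β m)) ∧
      ∀ l m, l ≠ m → β l 1 ≠ β m 1 := by
    obtain ⟨a, ha, hga, hnear⟩ := B.stage.nearest B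
    have ha0 := B.stage.ne_zero B ha hga
    obtain ⟨G, T, hG⟩ := B.stage.step B ha hga
    have A := arm_new ha0 ha hnear hG
    obtain ⟨a', ha', hga', hnear'⟩ := T.nearest B
    have ha0' := T.ne_zero B ha' hga'
    obtain ⟨G', T', hG'⟩ := T.step B ha' hga'
    have A' := arm_new ha0' ha' hnear' hG'
    obtain ⟨β1, B1, P1, N1⟩ := arm_lift ha0' ha' hga' hG' A
    obtain ⟨a'', ha'', hga'', hnear''⟩ := T'.nearest B
    have ha0'' := T'.ne_zero B ha'' hga''
    obtain ⟨G'', T'', hG''⟩ := T'.step B ha'' hga''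
    have A'' := arm_new ha0'' ha'' hnear'' hG''
    obtain ⟨β2, B2, P2, N2⟩ := arm_lift ha0'' ha'' hga'' hG'' A'
    obtain ⟨β3, B3, P3, N3⟩ := arm_lift ha0'' ha'' hga'' hG'' B1
    have h23 : β2 1 ≠ β3 1 := fun h => N1 1 m1 (by
      rw [← P3 1 m1, ← h, P2 1 m1]; simp)
    have h2 := N2 1 m1
    have h3 := N3 1 m1
    refine ⟨_, G'', ![fun t => (t : ℂ), β2, β3], T'', ?_, ?_⟩
    · intro m
      fin_cases m
      · exact A''
      · exact B2
      · exact B3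
    · intro l m hlm
      fin_cases l <;> fin_cases m
      · exact absurd rfl hlm
      · simpa using h2.symm
      · simpa using h3.symm
      · simpa using h2
      · exact absurd rfl hlm
      · simpa using h23
      · simpa using h3
      · simpa using h23.symm
      · exact absurd rfl hlm
  have key : ∀ l m, l ≠ m → ∃ η > (0 : ℝ), ∀ t ∈ Icc (0 : ℝ) 1, ∀ s ∈ Icc (0 : ℝ) 1,
      g (β l t) = β m s → t ≤ 1 - η ∧ s ≤ 1 - η := by
    intro l m hlm
    set S : Set (ℝ × ℝ) := Icc 0 1 ×ˢ Icc 0 1 with hS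
    have hc1 : ContinuousOn (fun p : ℝ × ℝ => g (β l p.1)) S :=
      g.continuous.comp_continuousOn ((hA l).cont.comp continuousOn_fst fun p hp => hp.1)
    have hc2 : ContinuousOn (fun p : ℝ × ℝ => β m p.2) S :=
      (hA m).cont.comp continuousOn_snd fun p hp => hp.2
    have hScl : IsClosed S := isClosed_Icc.prod isClosed_Icc
    have hSco : IsCompact S := isCompact_Icc.prod isCompact_Icc
    have hK : IsCompact (S ∩ (fun p : ℝ × ℝ => g (β l p.1) - β m p.2) ⁻¹' {0}) :=
      hSco.of_isClosed_subset ((hc1.sub hc2).preimage_isClosed_of_isClosed hScl isClosed_singleton)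
        inter_subset_left
    have hpos : ∀ p ∈ S ∩ (fun p : ℝ × ℝ => g (β l p.1) - β m p.2) ⁻¹' {0},
        0 < min (1 - p.1) (1 - p.2) := by
      rintro ⟨t, s⟩ ⟨⟨ht, hs⟩, h⟩
      have h : g (β l t) = β m s := sub_eq_zero.1 h
      have ht : t ∈ Icc (0 : ℝ) 1 := ht
      have hs : s ∈ Icc (0 : ℝ) 1 := hs
      have key2 : 1 ≤ ‖β l t‖ → False := fun h1 => by
        rw [T.hg _ h1] at h
        have h2 := (hA m).eq_one hs (h ▸ h1)
        have h3 := (hA l).eq_one ht h1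
        rw [h2, h3] at h
        exact hne l m hlm h
      have ht1 : t ≠ 1 := by
        rintro rfl
        exact key2 (hA l).fin.ge
      have hs1 : s ≠ 1 := by
        rintro rfl
        refine key2 (not_lt.1 fun h4 => ?_)
        have := T.hg.lt h4
        rw [h, (hA m).fin] at this
        exact lt_irrefl _ this
      exact lt_min (sub_pos.2 (lt_of_le_of_ne ht.2 ht1)) (sub_pos.2 (lt_of_le_of_ne hs.2 hs1))
    obtain ⟨η, hη, hη2⟩ := hK.exists_forall_le' (f := fun p : ℝ × ℝ => min (1 - p.1) (1 - p.2))
      (by fun_prop) hpos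
    refine ⟨η, hη, fun t ht s hs h => ?_⟩
    have := hη2 (t, s) ⟨⟨ht, hs⟩, sub_eq_zero.2 h⟩
    exact ⟨by linarith [this.trans (min_le_left _ _)], by linarith [this.trans (min_le_right _ _)]⟩
  have key' : ∀ l m, ∃ η > (0 : ℝ), l ≠ m → ∀ t ∈ Icc (0 : ℝ) 1, ∀ s ∈ Icc (0 : ℝ) 1,
      g (β l t) = β m s → t ≤ 1 - η ∧ s ≤ 1 - η := fun l m => by
    by_cases h : l = m
    · exact ⟨1, one_pos, fun h' => absurd h h'⟩
    · obtain ⟨η, h1, h2⟩ := key l m h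
      exact ⟨η, h1, fun _ => h2⟩
  choose η hη0 hη using key'
  obtain ⟨p, -, hp⟩ := Finset.exists_min_image (Finset.univ : Finset (Fin 3 × Fin 3))
    (fun p => η p.1 p.2) ⟨(0, 0), Finset.mem_univ _⟩
  refine ⟨fun m t => π (β m t), min (η p.1 p.2) 1, π, g, β, lt_min (hη0 _ _) one_pos,
    min_le_right _ _, T, hA, fun l m hlm t ht s hs h => ?_, fun m t ht => rfl⟩
  have h1 := hη l m hlm t ht s hs h
  have h2 := hp (l, m) (Finset.mem_univ _)
  have h3 := (min_le_left (η p.1 p.2) 1).trans h2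
  simp only at h3
  constructor <;> linarith [h1.1, h1.2]

end
end DR

namespace DR
set_option linter.unusedSectionVars false
set_option linter.unusedVariables false
open Set Complex ComplexConjugate

/-! ### Uniform bounds -/

theorem sp_half {s : ℂ → ℂ} {w0 w : ℂ} {ρ : ℝ} (hρ : 0 < ρ) (hs : DifferentiableOn ℂ s (ball w0 ρ))
    (h1 : ∀ w ∈ ball w0 ρ, ‖s w‖ < 1) (hw : ‖w - w0‖ ≤ ρ / 2) :
    1 / 8 * (1 - ‖s w0‖ ^ 2) ≤ 1 - ‖s w‖ ^ 2 := by
  have hw0 : w0 ∈ ball w0 ρ := mem_ball_self hρ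
  have hwb : w ∈ ball w0 ρ := by rw [mem_ball_iff_norm]; linarith
  have hb := h1 w0 hw0
  have hz := h1 w hwb
  have hM0 : Mob (s w0) (s w0) = 0 := by simp [Mob]
  have hd : DifferentiableOn ℂ (fun w => Mob (s w0) (s w)) (ball w0 ρ) := fun v hv =>
    (mob_diff hb (h1 v hv).le).comp_differentiableWithinAt v (hs v hv)
  have h2 := Complex.dist_le_div_mul_dist_of_mapsTo_ball (R₂ := 1) hd (fun v hv => by
    simp only [hM0]
    rw [mem_closedBall_zero_iff]
    exact (mob_norm_lt hb (h1 v hv)).le) hwb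
  simp only [hM0, dist_zero_right, dist_eq_norm, sub_zero] at h2
  have h3 : ‖Mob (s w0) (s w)‖ ≤ 1 / 2 := by
    refine h2.trans ?_
    rw [div_mul_eq_mul_div, one_mul, div_le_iff₀ hρ]
    linarith
  have h4 := mob_normSq hb hz.le
  set b := s w0
  set z := s w
  set D := ‖1 - conj b * z‖ with hD
  have hD1 : 1 - ‖b‖ ≤ D := by
    have := norm_sub_norm_le (1 : ℂ) (conj b * z)
    rw [norm_one, norm_mul, RCLike.norm_conj] at this
    nlinarith [norm_nonneg b, norm_nonneg z]
  have hDp : 0 < D := by linarith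
  have hb0 := norm_nonneg b
  have hz0 := norm_nonneg z
  have h5 : 3 / 4 ≤ (1 - ‖b‖ ^ 2) * (1 - ‖z‖ ^ 2) / D ^ 2 := by
    rw [← h4]; nlinarith [norm_nonneg (Mob b z)]
  rw [le_div_iff₀ (by positivity)] at h5
  have h6 : (1 - ‖b‖) ^ 2 ≤ D ^ 2 := by nlinarith
  have h7 : 0 < 1 - ‖b‖ := by linarith
  have h8 : 3 / 4 * (1 - ‖b‖) ≤ (1 + ‖b‖) * (1 - ‖z‖ ^ 2) := by
    refine le_of_mul_le_mul_left ?_ h7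
    nlinarith
  have h9 : 0 ≤ 1 - ‖z‖ ^ 2 := by nlinarith
  nlinarith

/-- open disc minus the fixed points -/
def OO (f : ℂ ≃ₜ ℂ) : Set ℂ := ball 0 1 ∩ {w | f w ≠ w}

theorem oo_open (f : ℂ ≃ₜ ℂ) : IsOpen (OO f) :=
  isOpen_ball.inter (isOpen_ne_fun f.continuous continuous_id)

section
variable {f : ℂ ≃ₜ ℂ} {r : ℝ} {n : ℕ} {π : ℂ → ℂ} {g : ℂ ≃ₜ ℂ}

theorem Stage.oo (T : Stage f r n π g) {u : ℂ} (hu : ‖u‖ < 1) (h : g u ≠ u) : π u ∈ OO f :=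
  ⟨by simpa using T.lt u hu, fun h' => h (T.fix u hu h')⟩

theorem Stage.norm_le (T : Stage f r n π g) {u : ℂ} (hu : ‖u‖ < 1) : ‖π u‖ ≤ ‖u‖ :=
  Complex.norm_le_norm_of_mapsTo_ball T.diff (fun v hv => by
    rw [mem_ball_zero_iff] at hv
    simpa using (T.lt v hv).le) T.zero hu

theorem Stage.chain (T : Stage f r n π g) {v : ℝ → ℂ} {d : ℝ} {N : ℕ} (hd : 0 < d) (hN : 0 < N)
    (hv : ContinuousOn v (Icc 0 1)) (hv1 : ∀ t ∈ Icc (0 : ℝ) 1, ‖v t‖ < 1)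
    (hb : ∀ t ∈ Icc (0 : ℝ) 1, ball (π (v t)) d ⊆ OO f)
    (hst : ∀ t ∈ Icc (0 : ℝ) 1, ∀ t' ∈ Icc (0 : ℝ) 1, |t - t'| ≤ 1 / N → ‖π (v t) - π (v t')‖ ≤ d / 2) :
    ∀ t ∈ Icc (0 : ℝ) 1, (1 / 8) ^ N * (1 - ‖v 0‖ ^ 2) ≤ 1 - ‖v t‖ ^ 2 := by
  have hN' : (0 : ℝ) < N := by exact_mod_cast hN
  have step : ∀ x ∈ Icc (0 : ℝ) 1, ∀ t ∈ Icc (0 : ℝ) 1, x ≤ t → t - x ≤ 1 / N →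
      1 / 8 * (1 - ‖v x‖ ^ 2) ≤ 1 - ‖v t‖ ^ 2 := by
    intro x hx t ht hxt htx
    obtain ⟨s, hs, hs1, hs2, hs3⟩ := T.bl (π (v x)) d hd ((hb x hx).trans inter_subset_left)
      (fun w hw => (hb x hx hw).2) (v x) (hv1 x hx) rfl
    have hsub : Icc x t ⊆ Icc 0 1 := Icc_subset_Icc hx.1 ht.2
    have hcl : ∀ y ∈ Icc x t, ‖π (v y) - π (v x)‖ ≤ d / 2 := fun y hy =>
      hst y (hsub hy) x hx (by rw [abs_of_nonneg (by linarith [hy.1])]; linarith [hy.2])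
    have hmem : ∀ y ∈ Icc x t, π (v y) ∈ ball (π (v x)) d := fun y hy => by
      rw [mem_ball_iff_norm]; linarith [hcl y hy]
    have hpc : ContinuousOn (fun y => π (v y)) (Icc x t) :=
      T.diff.continuousOn.comp (hv.mono hsub) fun y hy => by simpa using hv1 y (hsub hy)
    have := T.ul (Icc x t) isPreconnected_Icc (fun y => s (π (v y))) v
      (hs.continuousOn.comp hpc hmem) (hv.mono hsub) (fun y hy => hs1 _ (hmem y hy))
      (fun y hy => hv1 y (hsub hy)) (fun y hy => hs2 _ (hmem y hy)) x (left_mem_Icc.2 hxt) hs3 t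
      (right_mem_Icc.2 hxt)
    have h := sp_half hd hs hs1 (hcl t (right_mem_Icc.2 hxt))
    rwa [this, hs3] at h
  have h0 : 0 ≤ 1 - ‖v 0‖ ^ 2 := by
    have := hv1 0 (by simp); nlinarith [norm_nonneg (v 0)]
  have ind : ∀ k : ℕ, k ≤ N → ∀ t ∈ Icc (0 : ℝ) 1, t ≤ k / N →
      (1 / 8) ^ k * (1 - ‖v 0‖ ^ 2) ≤ 1 - ‖v t‖ ^ 2 := by
    intro k
    induction k with
    | zero =>
      intro _ t ht h
      have : t = 0 := le_antisymm (by simpa using h) ht.1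
      simp [this]
    | succ k ih =>
      intro hk t ht h
      have ih := ih (by omega)
      have hkN : (k : ℝ) / N ≤ 1 := by
        rw [div_le_one hN']; exact_mod_cast (by omega : k ≤ N)
      have hp : (0 : ℝ) ≤ (1 / 8) ^ k := by positivity
      rcases le_total t (k / N) with h2 | h2
      · have := ih t ht h2
        rw [pow_succ]
        nlinarith [mul_nonneg hp h0]
      · have h3 := ih (k / N) ⟨by positivity, hkN⟩ le_rfl
        have h4 := step (k / N) ⟨by positivity, hkN⟩ t ht h2 (by
          push_cast at h
          rw [add_div] at h
          linarith)
        rw [pow_succ]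
        nlinarith
  intro t ht
  exact ind N le_rfl t ht (by rw [div_self hN'.ne']; exact ht.2)

theorem exists_N {δ : ℝ} (hδ : 0 < δ) : ∃ N : ℕ, 0 < N ∧ 1 / (N : ℝ) < δ := by
  obtain ⟨N, hN⟩ := exists_nat_one_div_lt hδ
  exact ⟨N + 1, by omega, by exact_mod_cast hN⟩

/-- lifts of a fixed curve stay in a compact set -/
theorem chainU {p : ℝ → ℂ} (hp : ContinuousOn p (Icc 0 1)) (hO : ∀ t ∈ Icc (0 : ℝ) 1, p t ∈ OO f) :
    ∃ c > (0 : ℝ), c ≤ 1 ∧ ∀ π g, Stage f r n π g → ∀ v : ℝ → ℂ, ContinuousOn v (Icc 0 1) →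
      (∀ t ∈ Icc (0 : ℝ) 1, ‖v t‖ < 1) → (∀ t ∈ Icc (0 : ℝ) 1, π (v t) = p t) →
      ∀ t ∈ Icc (0 : ℝ) 1, c * (1 - ‖v 0‖ ^ 2) ≤ 1 - ‖v t‖ ^ 2 := by
  obtain ⟨d, hd, hdO⟩ := (isCompact_Icc.image_of_continuousOn hp).exists_thickening_subset_open
    (oo_open f) (image_subset_iff.2 hO)
  obtain ⟨δ, hδ, hu⟩ := Metric.uniformContinuousOn_iff.1
    (isCompact_Icc.uniformContinuousOn_of_continuous hp) (d / 2) (by linarith)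
  obtain ⟨N, hN, hNδ⟩ := exists_N hδ
  refine ⟨(1 / 8) ^ N, by positivity, pow_le_one₀ (by norm_num) (by norm_num),
    fun π g T v hv hv1 hpv => T.chain hd hN hv hv1 ?_ ?_⟩
  · intro t ht
    rw [hpv t ht]
    exact (ball_subset_thickening (mem_image_of_mem p ht) d).trans hdO
  · intro t ht t' ht' h
    rw [hpv t ht, hpv t' ht', ← dist_eq_norm]
    exact (hu t ht t' ht' (by rw [Real.dist_eq]; linarith)).le

theorem norm_of_sq {z : ℂ} {κ : ℝ} (hκ1 : κ ≤ 1) (h : κ ≤ 1 - ‖z‖ ^ 2) : ‖z‖ ≤ 1 - κ / 2 := by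
  nlinarith [norm_nonneg z, sq_nonneg (‖z‖ - (1 - κ / 2)), sq_nonneg κ]

theorem TS.U2 {e : Fin 3 → ℝ → ℂ} {η : ℝ} (hη : 0 < η) (hη1 : η ≤ 1) {β : Fin 3 → ℝ → ℂ}
    (T : TS f r n e η π g β) : ∃ ρ0, 0 ≤ ρ0 ∧ ρ0 < 1 ∧ ∀ π g β, TS f r n e η π g β →
      ∀ m, ∀ t ∈ Icc (0 : ℝ) 1, t ≤ 1 - η → ‖β m t‖ ≤ ρ0 := by
  have hm : ∀ t ∈ Icc (0 : ℝ) 1, t * (1 - η) ∈ Ico (0 : ℝ) 1 := fun t ht =>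
    ⟨mul_nonneg ht.1 (by linarith), by nlinarith [ht.1, ht.2]⟩
  have hlt : ∀ {π g β}, TS f r n e η π g β → ∀ m, ContinuousOn (fun t => β m (t * (1 - η))) (Icc 0 1) ∧
      ∀ t ∈ Icc (0 : ℝ) 1, ‖β m (t * (1 - η))‖ < 1 := fun T m =>
    ⟨(T.arm m).cont.comp (by fun_prop) fun t ht => Ico_subset_Icc_self (hm t ht),
      fun t ht => (T.arm m).lt _ (hm t ht)⟩
  have key : ∀ m, ∃ c > (0 : ℝ), c ≤ 1 ∧ ∀ π g, Stage f r n π g → ∀ v : ℝ → ℂ, ContinuousOn v (Icc 0 1) →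
      (∀ t ∈ Icc (0 : ℝ) 1, ‖v t‖ < 1) → (∀ t ∈ Icc (0 : ℝ) 1, π (v t) = e m (t * (1 - η))) →
      ∀ t ∈ Icc (0 : ℝ) 1, c * (1 - ‖v 0‖ ^ 2) ≤ 1 - ‖v t‖ ^ 2 := by
    intro m
    refine chainU ?_ ?_
    · refine ContinuousOn.congr (T.st.diff.continuousOn.comp (hlt T m).1 fun t ht => ?_) fun t ht =>
        (T.pr m _ (hm t ht)).symm
      simpa using (hlt T m).2 t ht
    · intro t ht
      rw [← T.pr m _ (hm t ht)]
      exact T.st.oo ((hlt T m).2 t ht) ((T.arm m).ne _ (hm t ht))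
  choose c hc hc1 hcc using key
  obtain ⟨p, -, hp⟩ := Finset.exists_min_image (Finset.univ : Finset (Fin 3)) c ⟨0, Finset.mem_univ _⟩
  refine ⟨1 - c p / 2, by linarith [hc1 p], by linarith [hc p], fun π g β T m t ht h => ?_⟩
  obtain ⟨x, hx, hxt⟩ : ∃ x ∈ Icc (0 : ℝ) 1, x * (1 - η) = t := by
    rcases eq_or_lt_of_le (sub_nonneg.2 hη1) with h0 | h0
    · exact ⟨0, by simp, by have := ht.1; simp; linarith⟩
    · exact ⟨t / (1 - η), ⟨div_nonneg ht.1 h0.le, by rwa [div_le_one h0]⟩, div_mul_cancel₀ _ h0.ne'⟩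
  have h1 := hcc m π g T.st _ (hlt T m).1 (hlt T m).2 (fun t ht => T.pr m _ (hm t ht)) x hx
  simp only [zero_mul, (T.arm m).zero, hxt, norm_zero] at h1
  have h2 := norm_of_sq (hc1 m) (by linarith : c m ≤ 1 - ‖β m t‖ ^ 2)
  linarith [hp m (Finset.mem_univ _)]

theorem U1 (B : BaseD f r n) {ρ : ℝ} (hρ0 : 0 ≤ ρ) (hρ : ρ < 1) : ∃ c > (0 : ℝ), ∀ π g, Stage f r n π g →
    (∀ w, ‖w‖ < (1 + ρ) / 2 → g w ≠ w) → ∀ u, ‖u‖ ≤ ρ → ball (π u) c ⊆ OO f := by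
  set R := (1 + ρ) / 2 with hR
  have hRp : 0 < R := by rw [hR]; linarith
  have hR1 : R < 1 := by rw [hR]; linarith
  have hρR : ρ < R := by rw [hR]; linarith
  have hr := B.r0
  have hr1 := B.r1
  set τ := ρ / R with hτ
  have hτ0 : 0 ≤ τ := by positivity
  have hτ1 : τ < 1 := by rw [hτ, div_lt_one hRp]; exact hρR
  set c := Real.exp (Real.log r / (1 - τ) ^ 2) * (1 - ρ) with hc
  have hcp : 0 < c := mul_pos (Real.exp_pos _) (by linarith)
  refine ⟨min c (1 - ρ), lt_min hcp (by linarith), fun π g T hfree u hu w hw => ?_⟩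
  have hπu : ‖π u‖ ≤ ρ := (T.norm_le (by linarith)).trans hu
  have hw1 : ‖w - π u‖ < c := (mem_ball_iff_norm.1 hw).trans_le (min_le_left _ _)
  have hw2 : ‖w - π u‖ < 1 - ρ := (mem_ball_iff_norm.1 hw).trans_le (min_le_right _ _)
  have hwn : ‖w‖ < 1 := by
    have := norm_le_norm_add_norm_sub' w (π u)
    linarith
  refine ⟨by simpa using hwn, fun hfw => ?_⟩
  have hwr : r ≤ ‖w‖ := not_lt.1 fun h => B.nf w h hfw
  have hw0 : w ≠ 0 := norm_pos_iff.1 (by linarith)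
  have hsub : ball (0 : ℂ) R ⊆ ball 0 1 := ball_subset_ball hR1.le
  obtain ⟨s, hs, hs1, hs2, hs3⟩ := paLift_holo hw0 hwn hRp (w0 := 0) (T.diff.mono hsub)
    (fun v hv => T.lt v (by simpa using hsub hv))
    (fun v hv h => hfree v (by simpa using hv) (T.fix v (by simpa using hsub hv) (by rw [h]; exact hfw)))
    (u0 := 0) (by simp) (by rw [T.zero, pa_zero hw0 hwn])
  have huR : u ∈ ball (0 : ℂ) R := by rw [mem_ball_zero_iff]; linarith
  have hsu : ‖s u‖ ≤ τ := by
    have := Complex.dist_le_div_mul_dist_of_mapsTo_ball (R₂ := 1) hs (fun v hv => by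
      rw [hs3, mem_closedBall_zero_iff]; exact (hs1 v hv).le) huR
    rw [hs3, dist_zero_right, dist_zero_right, one_div, inv_mul_eq_div] at this
    exact this.trans (div_le_div_of_nonneg_right hu hRp.le)
  have hsu1 : ‖s u‖ < 1 := by linarith
  have hne1 := ne_one_of_lt hsu1
  have hM : ‖Mob w (π u)‖ = Real.exp (Cay w (s u)).re := by
    rw [← hs2 u huR, mob_pa hw0 hwn hsu1.le hne1, norm_exp]
  have h1s : 1 - τ ≤ ‖1 - s u‖ := by
    have := norm_sub_norm_le (1 : ℂ) (s u)
    rw [norm_one] at this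
    linarith
  have hlog : Real.log r ≤ (cz w).re := by
    rw [cz, log_re, norm_neg]; exact Real.log_le_log hr hwr
  have hlog0 : Real.log r < 0 := Real.log_neg hr (by linarith)
  have hcz := cz_re hw0 hwn
  have hre : Real.log r / (1 - τ) ^ 2 ≤ (Cay w (s u)).re := by
    rw [cay_re hw0 hwn hne1, div_le_div_iff₀ (by nlinarith) (by nlinarith)]
    have e1 : (1 - τ) ^ 2 ≤ ‖1 - s u‖ ^ 2 := by nlinarith
    have e2 : 0 ≤ 1 - ‖s u‖ ^ 2 := by nlinarith [norm_nonneg (s u)]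
    have e3 : 1 - ‖s u‖ ^ 2 ≤ 1 := by nlinarith [norm_nonneg (s u)]
    have e4 : Real.log r ≤ (cz w).re * (1 - ‖s u‖ ^ 2) := by nlinarith
    have e5 : 0 < (1 - τ) ^ 2 := by nlinarith
    nlinarith
  have hmod : Real.exp (Real.log r / (1 - τ) ^ 2) ≤ ‖Mob w (π u)‖ := by
    rw [hM]; exact Real.exp_le_exp.2 hre
  have hden : 1 - ρ ≤ ‖1 - conj w * π u‖ := by
    have := norm_sub_norm_le (1 : ℂ) (conj w * π u)
    rw [norm_one, norm_mul, RCLike.norm_conj] at this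
    nlinarith [norm_nonneg w, norm_nonneg (π u)]
  have heq : ‖w - π u‖ = ‖Mob w (π u)‖ * ‖1 - conj w * π u‖ := by
    rw [← norm_mul, Mob, div_mul_cancel₀ _ (mob_den hwn (T.lt u (by linarith)).le), norm_sub_rev]
  have : c ≤ ‖w - π u‖ := by
    rw [heq, hc]
    exact mul_le_mul hmod hden (by linarith) (norm_nonneg _)
  linarith

end
end DR

namespace DR
set_option linter.unusedSectionVars false
set_option linter.unusedVariables false
open Set Complex ComplexConjugate

/-! ### The main contradiction -/

theorem HH.unif {g : ℂ ≃ₜ ℂ} (hg : HH g) : UniformContinuous g := by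
  have h1 : HasCompactSupport (fun w => g w - w) :=
    HasCompactSupport.intro (isCompact_closedBall (0 : ℂ) 1) fun w hw => by
      rw [hg w (by simpa using (not_le.1 (fun h => hw (by simpa using h))).le), sub_self]
  have h2 := h1.uniformContinuous_of_continuous (g.continuous.sub continuous_id)
  have h3 := h2.add uniformContinuous_id
  have : (g : ℂ → ℂ) = fun w => (g w - w) + id w := by ext w; simp
  rw [this]; exact h3

section
variable {f : ℂ ≃ₜ ℂ} {r : ℝ} {n : ℕ} {π : ℂ → ℂ} {g : ℂ ≃ₜ ℂ}

theorem Stage.lip (T : Stage f r n π g) {ρ : ℝ} (hρ : ρ < 1) {a b : ℂ} (ha : ‖a‖ ≤ ρ)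
    (hab : ‖b - a‖ < 1 - ρ) : ‖π b - π a‖ ≤ 2 / (1 - ρ) * ‖b - a‖ := by
  have hsub : ball a (1 - ρ) ⊆ ball 0 1 := fun v hv => by
    rw [mem_ball_iff_norm] at hv
    rw [mem_ball_zero_iff]
    have := norm_le_norm_add_norm_sub' v a
    linarith
  have h := Complex.dist_le_div_mul_dist_of_mapsTo_ball (R₂ := 2) (T.diff.mono hsub) (fun v hv => by
    rw [mem_closedBall_iff_norm]
    have h1 := T.lt v (by simpa using hsub hv)
    have h2 := T.lt a (by linarith)
    linarith [norm_sub_le (π v) (π a)]) (mem_ball_iff_norm.2 hab)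
  simpa [dist_eq_norm] using h

theorem U3 (B : BaseD f r n) {ρ0 ρ : ℝ} (h0 : 0 ≤ ρ0) (h01 : ρ0 ≤ ρ) (hρ : ρ < 1) :
    ∃ ρ', ρ ≤ ρ' ∧ ρ' < 1 ∧ ∀ π g, Stage f r n π g → (∀ w, ‖w‖ < (1 + ρ) / 2 → g w ≠ w) →
      (∃ q, ‖q‖ ≤ ρ0 ∧ ‖g q‖ ≤ ρ0) → ∀ u, ‖u‖ ≤ ρ → ‖g u‖ ≤ ρ' := by
  obtain ⟨d1, hd1, hU⟩ := U1 B (h0.trans h01) hρ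
  obtain ⟨d, hd, hds⟩ := Metric.uniformContinuous_iff.1 B.hh.symm.unif d1 hd1
  obtain ⟨δ, hδ, hδf⟩ := Metric.uniformContinuous_iff.1 B.hh.unif (d / 2) (by linarith)
  have hρ' : 0 < 1 - ρ := by linarith
  obtain ⟨N, hN, hN1⟩ := exists_N (δ := min ((1 - ρ) / 2) (δ * (1 - ρ) / 4))
    (lt_min (by linarith) (by positivity))
  have hNa := hN1.trans_le (min_le_left _ _)
  have hNb := hN1.trans_le (min_le_right _ _)
  have hp1 : ((1 : ℝ) / 8) ^ N ≤ 1 := pow_le_one₀ (by norm_num) (by norm_num)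
  have hp0 : (0 : ℝ) < (1 / 8) ^ N := by positivity
  set κ := ((1 : ℝ) / 8) ^ N * (1 - ρ0 ^ 2) with hκ
  have hρ02 : 0 < 1 - ρ0 ^ 2 := by nlinarith
  have hκ0 : 0 < κ := by positivity
  have hκ1 : κ ≤ 1 := by nlinarith [sq_nonneg ρ0]
  refine ⟨max ρ (1 - κ / 2), le_max_left _ _, max_lt hρ (by linarith), fun π g T hfree ⟨q, hq, hgq⟩ u hu => ?_⟩
  set γ : ℝ → ℂ := fun t => q + (t : ℂ) * (u - q) with hγ
  have hγ1 : ∀ t ∈ Icc (0 : ℝ) 1, ‖γ t‖ ≤ ρ := by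
    intro t ht
    have e : γ t = ((1 - t : ℝ) : ℂ) * q + (t : ℂ) * u := by simp only [hγ]; push_cast; ring
    have := norm_add_le (((1 - t : ℝ) : ℂ) * q) ((t : ℂ) * u)
    rw [← e, norm_mul, norm_mul, norm_real, norm_real, Real.norm_of_nonneg ht.1,
      Real.norm_of_nonneg (by linarith [ht.2])] at this
    nlinarith [ht.1, ht.2]
  have hγ2 : ∀ t ∈ Icc (0 : ℝ) 1, ‖γ t‖ < 1 := fun t ht => (hγ1 t ht).trans_lt hρ
  have hγc : Continuous γ := by simp only [hγ]; fun_prop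
  have hπ : ∀ t ∈ Icc (0 : ℝ) 1, π (g (γ t)) = f (π (γ t)) := fun t ht => T.semi _ (hγ2 t ht)
  have hch := T.chain (v := fun t => g (γ t)) hd hN (g.continuous.comp hγc).continuousOn
    (fun t ht => T.hg.lt (hγ2 t ht)) (fun t ht w hw => by
      rw [hπ t ht] at hw
      have h1 := hds hw
      rw [Homeomorph.symm_apply_apply] at h1
      have h2 := hU π g T hfree (γ t) (hγ1 t ht) (mem_ball.2 h1)
      have h3 : ‖f.symm w‖ < 1 := by simpa using h2.1
      refine ⟨by simpa using B.hh.lt h3, fun h => h2.2 ?_⟩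
      simp only [Homeomorph.apply_symm_apply]
      rw [Homeomorph.eq_symm_apply, h]) (fun t ht t' ht' htt => by
      rw [hπ t ht, hπ t' ht', ← dist_eq_norm]
      refine (hδf ?_).le
      rw [dist_eq_norm]
      have e1 : ‖γ t - γ t'‖ ≤ 2 * (1 / N) := by
        have : γ t - γ t' = ((t - t' : ℝ) : ℂ) * (u - q) := by simp only [hγ]; push_cast; ring
        rw [this, norm_mul, norm_real, Real.norm_eq_abs]
        have : ‖u - q‖ ≤ 2 := by linarith [norm_sub_le u q]
        have h3 : (0 : ℝ) ≤ 1 / N := by positivity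
        nlinarith [norm_nonneg (u - q), abs_nonneg (t - t')]
      have e2 := T.lip hρ (hγ1 t' ht') (b := γ t) (by linarith)
      refine e2.trans_lt ?_
      rw [div_mul_eq_mul_div, div_lt_iff₀ hρ']
      linarith) 1 (by simp)
  have hg0 : γ 0 = q := by simp [hγ]
  have hg1 : γ 1 = u := by simp [hγ]
  simp only [hg0, hg1] at hch
  refine (norm_of_sq hκ1 ?_).trans (le_max_right _ _)
  have : ‖g q‖ ^ 2 ≤ ρ0 ^ 2 := by nlinarith [norm_nonneg (g q)]
  nlinarith

theorem U4 (B : BaseD f r n) {ρ0 : ℝ} (h0 : 0 ≤ ρ0) (h01 : ρ0 < 1) (k : ℕ) :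
    ∃ ρ', ρ0 ≤ ρ' ∧ ρ' < 1 ∧ ∀ π g, Stage f r n π g → (∀ w, ‖w‖ < (1 + ρ') / 2 → g w ≠ w) →
      (∃ q, ‖q‖ ≤ ρ0 ∧ ‖g q‖ ≤ ρ0) → ∀ i ≤ k, ∀ p, ‖p‖ ≤ ρ0 → ‖g^[i] p‖ ≤ ρ' := by
  induction k with
  | zero =>
    refine ⟨ρ0, le_rfl, h01, fun π g T hf hq i hi p hp => ?_⟩
    obtain rfl : i = 0 := by omega
    exact hp
  | succ k ih =>
    obtain ⟨ρ, h1, h2, h3⟩ := ih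
    obtain ⟨ρ', h4, h5, h6⟩ := U3 B h0 h1 h2
    refine ⟨ρ', h1.trans h4, h5, fun π g T hf hq i hi p hp => ?_⟩
    have hf' : ∀ w, ‖w‖ < (1 + ρ) / 2 → g w ≠ w := fun w hw => hf w (by linarith)
    have h7 := h3 π g T hf' hq
    rcases Nat.lt_or_ge k i with h | h
    · obtain rfl : i = k + 1 := by omega
      rw [Function.iterate_succ_apply']
      exact h6 π g T hf' hq _ (h7 k le_rfl p hp)
    · exact (h7 i h p hp).trans h4

theorem Stage.deriv_ge (B : BaseD f r n) (T : Stage f r n π g) : r ≤ ‖deriv π 0‖ := by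
  obtain ⟨s, hs, hs1, hs2, hs3, -⟩ := T.right
  have hr := B.r0
  have hds : HasDerivAt s (deriv s 0) 0 :=
    (hs.differentiableAt (isOpen_ball.mem_nhds (mem_ball_self hr))).hasDerivAt
  have hdp : HasDerivAt π (deriv π 0) (s 0) := by
    rw [hs3]
    exact (T.diff.differentiableAt (isOpen_ball.mem_nhds (mem_ball_self one_pos))).hasDerivAt
  have h1 := hdp.comp 0 hds
  have h2 : HasDerivAt (π ∘ s) 1 0 := by
    refine (hasDerivAt_id (0 : ℂ)).congr_of_eventuallyEq ?_
    filter_upwards [isOpen_ball.mem_nhds (mem_ball_self hr)] with w hw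
    exact hs2 w hw
  have h3 := h1.unique h2
  have h4 := Complex.norm_deriv_le_div_of_mapsTo_ball (R₂ := 1) hs (fun w hw => by
    rw [hs3, mem_closedBall_zero_iff]; exact (hs1 w hw).le) hr
  have h5 : ‖deriv π 0‖ * ‖deriv s 0‖ = 1 := by rw [← norm_mul, h3, norm_one]
  rw [le_div_iff₀ hr] at h4
  have := norm_nonneg (deriv π 0)
  nlinarith

theorem Stage.deriv_step (T : Stage f r n π g) {a : ℂ} (ha0 : a ≠ 0) (ha : ‖a‖ < 1) :
    ‖deriv (π ∘ Pa a) 0‖ = ‖deriv π 0‖ * (2 * ‖a‖ * (-Real.log ‖a‖) / (1 - ‖a‖ ^ 2)) := by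
  rw [← pa_deriv_zero ha0 ha, ← norm_mul]
  have hdp : DifferentiableAt ℂ π (Pa a 0) := by
    rw [pa_zero ha0 ha]
    exact T.diff.differentiableAt (isOpen_ball.mem_nhds (mem_ball_self one_pos))
  have hda : DifferentiableAt ℂ (Pa a) 0 :=
    (pa_diffOn ha0 ha).differentiableAt (isOpen_ball.mem_nhds (mem_ball_self one_pos))
  rw [deriv_comp 0 hdp hda, pa_zero ha0 ha]

theorem cfun_bound {R : ℝ} (hr : 0 < r) (hR : R < 1) : ∃ M, 0 ≤ M ∧ M < 1 ∧ ∀ x ∈ Icc r R,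
    2 * x * (-Real.log x) / (1 - x ^ 2) ≤ M := by
  rcases (Icc r R).eq_empty_or_nonempty with h | h
  · exact ⟨0, le_rfl, one_pos, by simp [h]⟩
  have hc : ContinuousOn (fun x : ℝ => 2 * x * (-Real.log x) / (1 - x ^ 2)) (Icc r R) := by
    refine ContinuousOn.div (ContinuousOn.mul (by fun_prop) (ContinuousOn.neg
      (Real.continuousOn_log.mono fun x hx => ?_))) (by fun_prop) fun x hx => ?_
    · simp; linarith [hx.1]
    · nlinarith [hx.1, hx.2]
  obtain ⟨x, hx, hmax⟩ := isCompact_Icc.exists_isMaxOn h hc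
  refine ⟨max 0 (2 * x * (-Real.log x) / (1 - x ^ 2)), le_max_left _ _,
    max_lt one_pos (cfun_lt_one (by linarith [hx.1]) (by linarith [hx.2])), fun y hy =>
    (hmax hy).trans (le_max_right _ _)⟩

theorem koebe (B : BaseD f r n) {e : Fin 3 → ℝ → ℂ} {η R : ℝ} {β : Fin 3 → ℝ → ℂ} (hR : R < 1)
    (T : TS f r n e η π g β) :
    ∃ π g β, TS f r n e η π g β ∧ ∀ w, ‖w‖ < R → g w ≠ w := by
  by_contra hcon
  push Not at hcon
  obtain ⟨M, hM0, hM1, hM⟩ := cfun_bound B.r0 hR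
  have hstep : ∀ k : ℕ, ∃ π' g' β', TS f r n e η π' g' β' ∧ ‖deriv π' 0‖ ≤ M ^ k * ‖deriv π 0‖ := by
    intro k
    induction k with
    | zero => exact ⟨π, g, β, T, by simp⟩
    | succ k ih =>
      obtain ⟨π', g', β', T', hk⟩ := ih
      obtain ⟨a, ha, hga, hmin⟩ := T'.st.nearest B
      obtain ⟨w, hw, hgw⟩ := hcon π' g' β' T'
      have haR : ‖a‖ ≤ R := by
        by_contra h
        exact hmin w (hw.trans (not_le.1 h)) hgw
      have ha0 := T'.st.ne_zero B ha hga
      have har : r ≤ ‖a‖ := by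
        by_contra h
        push Not at h
        have h1 := T'.st.norm_le ha
        refine B.nf (π' a) (by linarith) ?_
        rw [← T'.st.semi a ha, hga]
      obtain ⟨G, β'', T''⟩ := T'.step B ha hga
      refine ⟨_, G, β'', T'', ?_⟩
      rw [T'.st.deriv_step ha0 ha, pow_succ]
      calc _ ≤ M ^ k * ‖deriv π 0‖ * M := by
            refine mul_le_mul hk (hM _ ⟨har, haR⟩) ?_ (by positivity)
            have := norm_nonneg a
            have h2 := Real.log_nonpos this ha.le
            exact div_nonneg (mul_nonneg (by positivity) (by linarith)) (by nlinarith)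
        _ = _ := by ring
  have hlim : Tendsto (fun k : ℕ => M ^ k * ‖deriv π 0‖) atTop (𝓝 (0 * ‖deriv π 0‖)) :=
    (tendsto_pow_atTop_nhds_zero_of_lt_one hM0 hM1).mul_const _
  rw [zero_mul] at hlim
  obtain ⟨k, hk⟩ := (hlim.eventually_lt_const B.r0).exists
  obtain ⟨π', g', β', T', h⟩ := hstep k
  linarith [T'.st.deriv_ge B]

theorem main_contra (B : BaseD f r n) {ε : ℝ} (hε : 0 < ε) (hε1 : ε ≤ 1)
    (hfree : ∀ p, ‖p‖ < ε → ε ≤ ‖f p‖) (hn : 2 ≤ n) (hret : ‖f^[n] 0‖ < r * ε) : False := by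
  have hr := B.r0
  obtain ⟨e, η, π, g, β, hη, hη1, T⟩ := TS.init B
  obtain ⟨ρ0, h0, h1, hU2⟩ := T.U2 hη hη1
  obtain ⟨ρ', h2, h3, hU4⟩ := U4 B h0 h1 n
  obtain ⟨π, g, β, T, hfix⟩ := koebe B (R := (1 + ρ') / 2) (by linarith) T
  obtain ⟨l, m, hlm, t, ht, s, hs, hts⟩ := triod g.continuous T.st.hg (fun w hw => T.st.hg.le hw) β 0
    (fun m => (T.arm m).cont) (fun m t ht => (T.arm m).le ht) (fun m => (T.arm m).zero)
    (fun m => (T.arm m).fin)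
  obtain ⟨h4, h5⟩ := T.eta l m hlm t ht s hs hts
  have hq := hU2 π g β T l t ht h4
  have hgq : ‖g (β l t)‖ ≤ ρ0 := by rw [hts]; exact hU2 π g β T m s hs h5
  refine toolB g T.st.hg (ε := ε) (ρ0 := ρ0) (R := (1 + ρ') / 2) hε (by linarith) (by linarith) hfix ?_
    (β l t) hq hgq n hn ?_ ?_
  · intro p hp
    have hp1 : ‖p‖ < 1 := by linarith
    have e1 := T.st.norm_le hp1
    have e2 := T.st.norm_le (T.st.hg.lt hp1)
    rw [T.st.semi p hp1] at e2
    exact (hfree _ (e1.trans_lt hp)).trans e2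
  · obtain ⟨s, hs, hs1, hs2, hs3, hs4⟩ := T.st.right
    rw [hs4]
    have hb : f^[n] 0 ∈ ball (0 : ℂ) r := by rw [mem_ball_zero_iff]; nlinarith
    have h := Complex.dist_le_div_mul_dist_of_mapsTo_ball (R₂ := 1) hs (fun w hw => by
      rw [hs3, mem_closedBall_zero_iff]; exact (hs1 w hw).le) hb
    rw [hs3, dist_zero_right, dist_zero_right] at h
    refine h.trans_lt ?_
    rw [div_mul_eq_mul_div, one_mul, div_lt_iff₀ hr]
    linarith
  · intro i hi p hp
    have := hU4 π g T.st hfix ⟨_, hq, hgq⟩ i hi p hp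
    linarith

end
end DR

namespace DR
set_option linter.unusedSectionVars false
set_option linter.unusedVariables false
open Set Complex ComplexConjugate

/-! ### Reduction to the plane -/

/-- the Euclidean plane -/
abbrev E2 := EuclideanSpace ℝ (Fin 2)

noncomputable def retr (X : E2) : Disc2 := ⟨(max 1 ‖X‖)⁻¹ • X, by
  have h : 0 < max 1 ‖X‖ := lt_of_lt_of_le one_pos (le_max_left _ _)
  rw [mem_closedBall_zero_iff, norm_smul, norm_inv, Real.norm_of_nonneg h.le, inv_mul_le_one₀ h]
  exact le_max_right _ _⟩

theorem retr_cont : Continuous retr := by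
  refine Continuous.subtype_mk ?_ _
  refine Continuous.smul (Continuous.inv₀ (continuous_const.max continuous_norm) fun X => ?_) continuous_id
  exact (lt_of_lt_of_le one_pos (le_max_left _ _)).ne'

theorem retr_in (X : Disc2) : retr X = X := by
  have h : ‖(X : E2)‖ ≤ 1 := mem_closedBall_zero_iff.1 X.2
  ext1
  simp [retr, max_eq_left h]

theorem retr_out {X : E2} (h : 1 ≤ ‖X‖) : ‖(retr X : E2)‖ = 1 := by
  simp only [retr, max_eq_right h, norm_smul, norm_inv, norm_norm]
  exact inv_mul_cancel₀ (by linarith)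

noncomputable def extf (f : Disc2 ≃ₜ Disc2) (X : E2) : E2 := f (retr X) + X - retr X

theorem extf_cont (f : Disc2 ≃ₜ Disc2) : Continuous (extf f) := by
  have := retr_cont
  unfold extf
  have h1 : Continuous fun X => ((f (retr X) : Disc2) : E2) :=
    continuous_subtype_val.comp (f.continuous.comp this)
  have h2 : Continuous fun X => ((retr X : Disc2) : E2) := continuous_subtype_val.comp this
  exact (h1.add continuous_id).sub h2

theorem extf_in (f : Disc2 ≃ₜ Disc2) (X : Disc2) : extf f X = f X := by
  simp [extf, retr_in]

theorem extf_out {f : Disc2 ≃ₜ Disc2} (hbd : ∀ x : Disc2, ‖(x : E2)‖ = 1 → f x = x) {X : E2}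
    (h : 1 ≤ ‖X‖) : extf f X = X := by
  simp [extf, hbd _ (retr_out h)]

theorem extf_inv {f g : Disc2 ≃ₜ Disc2} (hf : ∀ x : Disc2, ‖(x : E2)‖ = 1 → f x = x)
    (hg : ∀ x : Disc2, ‖(x : E2)‖ = 1 → g x = x) (hfg : ∀ x, f (g x) = x) (X : E2) :
    extf f (extf g X) = X := by
  rcases le_total 1 ‖X‖ with h | h
  · rw [extf_out hg h, extf_out hf h]
  · lift X to Disc2 using (by simpa using h)
    rw [extf_in, extf_in, hfg]

theorem extf_iter (f : Disc2 ≃ₜ Disc2) (n : ℕ) (X : Disc2) : (extf f)^[n] X = f^[n] X := by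
  induction n with
  | zero => rfl
  | succ n ih => rw [Function.iterate_succ_apply', Function.iterate_succ_apply', ih, extf_in]

noncomputable def extH (f : Disc2 ≃ₜ Disc2) (hbd : ∀ x : Disc2, ‖(x : E2)‖ = 1 → f x = x) : E2 ≃ₜ E2 where
  toFun := extf f
  invFun := extf f.symm
  left_inv X := extf_inv (fun x hx => by rw [Homeomorph.symm_apply_eq, hbd x hx]) hbd (by simp) X
  right_inv X := extf_inv hbd (fun x hx => by rw [Homeomorph.symm_apply_eq, hbd x hx]) (by simp) X
  continuous_toFun := extf_cont f
  continuous_invFun := extf_cont f.symm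

noncomputable def LL (x : E2) : ℂ ≃ₜ E2 where
  toFun w := x + (4 : ℝ) • Complex.orthonormalBasisOneI.repr w
  invFun X := Complex.orthonormalBasisOneI.repr.symm ((1 / 4 : ℝ) • (X - x))
  left_inv w := by simp [smul_smul]
  right_inv X := by
    beta_reduce
    rw [LinearIsometryEquiv.apply_symm_apply, smul_smul]
    norm_num
  continuous_toFun := by fun_prop
  continuous_invFun := by fun_prop

theorem ll_sub (x : E2) (v w : ℂ) : ‖LL x v - LL x w‖ = 4 * ‖v - w‖ := by
  have : LL x v - LL x w = (4 : ℝ) • Complex.orthonormalBasisOneI.repr (v - w) := by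
    simp [LL, smul_sub]
  rw [this, norm_smul, LinearIsometryEquiv.norm_map]; norm_num

theorem ll_zero (x : E2) : LL x 0 = x := by simp [LL]

theorem reduction (f : Disc2 ≃ₜ Disc2) (hrec : IsRecurrent (f : Disc2 → Disc2))
    (hbd : ∀ x : Disc2, ‖(x : E2)‖ = 1 → f x = x) (x : Disc2) : f x = x := by
  by_contra hne
  set L := LL (x : E2) with hL
  set F : ℂ ≃ₜ ℂ := (L.trans (extH f hbd)).trans L.symm with hF
  have hx1 : ‖(x : E2)‖ ≤ 1 := mem_closedBall_zero_iff.1 x.2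
  have hsemi : Function.Semiconj L F (extf f) := fun w => by
    simp [hF, extH]
  have hit : ∀ k w, L (F^[k] w) = (extf f)^[k] (L w) := fun k w => (hsemi.iterate_right k) w
  have hout : ∀ w, 1 / 2 ≤ ‖w‖ → F w = w := fun w hw => by
    apply L.injective
    rw [hsemi w]
    apply extf_out hbd
    have h1 := ll_sub (x : E2) w 0
    rw [ll_zero, sub_zero] at h1
    have h2 := norm_sub_le (LL (x : E2) w) x
    linarith
  have hF0 : F 0 ≠ 0 := fun h => hne <| by
    have := hsemi 0
    rw [h, hL, ll_zero, extf_in] at this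
    exact (Subtype.ext this).symm
  have hclose : ∀ ε > 0, ∃ N, 2 ≤ N ∧ ∀ w, ‖F^[N] w - w‖ < ε := by
    intro ε hε
    obtain ⟨k, hk, hε'⟩ := hrec
    obtain ⟨j, hj1, hj2⟩ := ((hε' ε hε).and (hk.eventually_ge_atTop 2)).exists
    refine ⟨k j, hj2, fun w => ?_⟩
    have h1 := ll_sub (x : E2) (F^[k j] w) w
    rw [← hL, hit] at h1
    suffices h : ‖(extf f)^[k j] (L w) - L w‖ < ε by linarith [norm_nonneg (F^[k j] w - w)]
    rcases le_total 1 ‖L w‖ with h | h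
    · rw [Function.iterate_fixed (extf_out hbd h), sub_self, norm_zero]; exact hε
    · have hm : L w ∈ Disc2 := by simpa using h
      have h2 := extf_iter f (k j) ⟨L w, hm⟩
      simp only at h2
      rw [h2]
      have h3 := hj1 ⟨L w, hm⟩
      rwa [Subtype.dist_eq, dist_eq_norm] at h3
  obtain ⟨r1, hr1, hr⟩ := Metric.eventually_nhds_iff.1
    ((isOpen_ne_fun F.continuous continuous_id).mem_nhds hF0)
  have hFp : 0 < ‖F 0‖ := norm_pos_iff.2 hF0
  obtain ⟨r2, hr2, hrr⟩ := Metric.continuousAt_iff.1 (F.continuous.continuousAt (x := 0)) (‖F 0‖ / 2)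
    (by linarith)
  set r := min r1 (1 / 4) with hrdef
  set ε := min r2 (min (‖F 0‖ / 2) 1) with hεdef
  have hr0 : 0 < r := lt_min hr1 (by norm_num)
  have hε0 : 0 < ε := lt_min hr2 (lt_min (by linarith) one_pos)
  obtain ⟨n, hn, hcl⟩ := hclose (min (r / 4) (r * ε)) (lt_min (by linarith) (by positivity))
  have B : BaseD F r n :=
    { out := hout
      r0 := hr0
      r1 := (min_le_right _ _).trans_lt (by norm_num)
      nf := fun w hw => hr (by rw [dist_zero_right]; exact hw.trans_le (min_le_left _ _))
      cl := fun w => (hcl w).trans_le (min_le_left _ _)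
      recu := fun ε hε => by
        obtain ⟨N, hN, h⟩ := hclose ε hε
        exact ⟨N, by omega, h⟩ }
  refine main_contra B hε0 ((min_le_right _ _).trans (min_le_right _ _)) (fun p hp => ?_) hn ?_
  · have h1 := hrr (x := p) (by rw [dist_zero_right]; exact hp.trans_le (min_le_left _ _))
    rw [dist_eq_norm, norm_sub_rev] at h1
    have h2 : ε ≤ ‖F 0‖ / 2 := (min_le_right _ _).trans (min_le_left _ _)
    have h3 := norm_le_norm_add_norm_sub' (F 0) (F p)
    linarith
  · have := (hcl 0).trans_le (min_le_right _ _)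
    rwa [sub_zero] at this

end DR

/-- An orientation-preserving recurrent homeomorphism of the closed disc which is
the identity on the boundary circle is the identity. -/
theorem disc_recurrent_id_on_boundary (f : Disc2 ≃ₜ Disc2)
    (hrec : IsRecurrent (f : Disc2 → Disc2))
    (hor : DiscOrientationPreserving f)
    (hbd : ∀ x : Disc2, ‖(x : EuclideanSpace ℝ (Fin 2))‖ = 1 → f x = x) :
    ∀ x, f x = x :=
  DR.reduction f hrec hbd
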